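/- Let K = Q(√-1) or Q(√-3), let k and k' be even integers, p a prime with p ≥ 5, and l ≥ 1. If f ∈ M_k^{(s)}(U_2(O_K), ν_k)_{Z_(p)} and g ∈ M_{k'}^{(s)}(U_2(O_K), ν_{k'})_{Z_(p)} satisfy f ≢ 0 (mod p) and f ≡ g (mod p^l) (i.e. a_f(H) ≡ a_g(H) (mod p^l) for all semi-positive H ∈ Λ_2(K)), then k ≡ k' (mod (p−1)p^{l−1}). -/

import Mathlib

open Complex Matrix
open scoped ComplexOrder

noncomputable section

/-- `√d_K` for an imaginary quadratic discriminant `d < 0`,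
taken as `√|d| · i` in the upper half plane. -/
def sqrtD (d : ℤ) : ℂ := Real.sqrt (-d) * Complex.I

/-- The ring of integers `O_K = ℤ[(d + √d)/2]` of the imaginary quadratic field of
discriminant `d`, viewed as a subset of `ℂ`. -/
def ringInt (d : ℤ) : Set ℂ :=
  {z | ∃ a b : ℤ, z = (a : ℂ) + (b : ℂ) * (((d : ℂ) + sqrtD d) / 2)}

/-- The inverse different `D_K⁻¹ = O_K / √d_K`. -/
def invDiff (d : ℤ) : Set ℂ := {z | sqrtD d * z ∈ ringInt d}

/-- The Hermitian upper half-space of degree 2: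
`Z` with `(Z - ᵗZ̄)/(2i)` positive definite. -/
def HermitianUpperHalfSpace : Set (Matrix (Fin 2) (Fin 2) ℂ) :=
  {Z | ((Z - Zᴴ).map (fun w => w / (2 * Complex.I))).PosDef}

/-- The lattice `Λ₂(K)`: Hermitian matrices with integral diagonal and
`√d_K ·`(off-diagonal entries) in `O_K`. -/
def LambdaH (d : ℤ) : Set (Matrix (Fin 2) (Fin 2) ℂ) :=
  {H | H.IsHermitian ∧ (∀ i, ∃ n : ℤ, H i i = (n : ℂ)) ∧
    ∀ i j, sqrtD d * H i j ∈ ringInt d}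

/-- Semi-positive elements of `Λ₂(K)`, the index set of Fourier expansions. -/
def HermLattice (d : ℤ) : Set (Matrix (Fin 2) (Fin 2) ℂ) :=
  {H | H ∈ LambdaH d ∧ H.PosSemidef}

/-- The symplectic-form matrix `J₂ = [[0, -1], [1, 0]]` (2×2 blocks). -/
def J2 : Matrix (Fin 2 ⊕ Fin 2) (Fin 2 ⊕ Fin 2) ℂ :=
  Matrix.fromBlocks 0 (-1) 1 0

/-- The Hermitian modular group `U₂(O_K)`:
matrices with entries in `O_K` satisfying `ᵗM̄ J₂ M = J₂`. -/
def HermitianModularGroup (d : ℤ) : Set (Matrix (Fin 2 ⊕ Fin 2) (Fin 2 ⊕ Fin 2) ℂ) :=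
  {M | (∀ i j, M i j ∈ ringInt d) ∧ Mᴴ * J2 * M = J2}

/-- The fractional-linear action `Z ↦ (AZ + B)(CZ + D)⁻¹`. -/
def matAct (M : Matrix (Fin 2 ⊕ Fin 2) (Fin 2 ⊕ Fin 2) ℂ)
    (Z : Matrix (Fin 2) (Fin 2) ℂ) : Matrix (Fin 2) (Fin 2) ℂ :=
  (M.toBlocks₁₁ * Z + M.toBlocks₁₂) * (M.toBlocks₂₁ * Z + M.toBlocks₂₂)⁻¹

/-- The character `ν_k`: `det^{k/2}` for `K = ℚ(√-1)` (i.e. `d = -4`, `k` even),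
and `det^k` for `K = ℚ(√-3)` (i.e. `d = -3`). -/
def nuChar (d k : ℤ) (M : Matrix (Fin 2 ⊕ Fin 2) (Fin 2 ⊕ Fin 2) ℂ) : ℂ :=
  if d = -4 then M.det ^ (k / 2) else M.det ^ k

/-- A Hermitian modular form of degree 2, weight `k` and character `ν_k` for `U₂(O_K)`,
bundled with its Fourier expansion over the semi-positive part of `Λ₂(K)`. -/
structure HermitianModularForm (d k : ℤ) where
  toFun : Matrix (Fin 2) (Fin 2) ℂ → ℂ
  coeff : Matrix (Fin 2) (Fin 2) ℂ → ℂ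
  holo : DifferentiableOn ℂ (fun Z : Fin 2 → Fin 2 → ℂ => toFun (Matrix.of Z))
    {Z | Matrix.of Z ∈ HermitianUpperHalfSpace}
  transform : ∀ M ∈ HermitianModularGroup d, ∀ Z ∈ HermitianUpperHalfSpace,
    toFun (matAct M Z) =
      nuChar d k M * (M.toBlocks₂₁ * Z + M.toBlocks₂₂).det ^ k * toFun Z
  coeff_supported : ∀ H, coeff H ≠ 0 → H ∈ HermLattice d
  expansion : ∀ Z ∈ HermitianUpperHalfSpace,
    HasSum (fun H : HermLattice d =>
      coeff H * Complex.exp (2 * Real.pi * Complex.I * ((H : Matrix (Fin 2) (Fin 2) ℂ) * Z).trace))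
      (toFun Z)

/-- A Hermitian modular form is symmetric if `f(ᵗZ) = f(Z)`. -/
def IsSymmetricHMF {d k : ℤ} (f : HermitianModularForm d k) : Prop :=
  ∀ Z ∈ HermitianUpperHalfSpace, f.toFun Zᵀ = f.toFun Z

/-- `z` is a `p`-integral rational number: `z = a/b` with `p ∤ b`. -/
def IsPIntegral (p : ℕ) (z : ℂ) : Prop :=
  ∃ a b : ℤ, ¬ (p : ℤ) ∣ b ∧ (b : ℂ) * z = (a : ℂ)

/-- `z ≡ w (mod p^l)` in the local ring `ℤ_(p)`, i.e. `(z - w)/p^l` is `p`-integral. -/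
def ModCongr (p l : ℕ) (z w : ℂ) : Prop :=
  IsPIntegral p ((z - w) / (p : ℂ) ^ l)


/-- The lexicographic order on `Λ₂(K)` used to define `ord_p`:
compare first `tr H`, then the `(1,1)`-entry `m`, then (for off-diagonal entry
`(a + b i)/2`) first `a`, then `b`. -/
def lexLt (H H' : Matrix (Fin 2) (Fin 2) ℂ) : Prop :=
  H.trace.re < H'.trace.re ∨
    (H.trace = H'.trace ∧
      ((H 0 0).re < (H' 0 0).re ∨
        (H 0 0 = H' 0 0 ∧
          ((H 0 1).re < (H' 0 1).re ∨
            ((H 0 1).re = (H' 0 1).re ∧ (H 0 1).im < (H' 0 1).im)))))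

/-- The Siegel upper half-space of degree `n`: symmetric complex matrices with
positive definite imaginary part. -/
def SiegelUpperHalfSpace (n : ℕ) : Set (Matrix (Fin n) (Fin n) ℂ) :=
  {Z | Z.IsSymm ∧ ((Z - Zᴴ).map (fun w => w / (2 * Complex.I))).PosDef}

/-- The symplectic-form matrix over `ℤ` in degree `n`. -/
def Jn (n : ℕ) : Matrix (Fin n ⊕ Fin n) (Fin n ⊕ Fin n) ℤ :=
  Matrix.fromBlocks 0 (-1) 1 0

/-- The Siegel modular group `Γ_n = Sp_n(ℤ)` (as a set of `2n × 2n` integer matrices). -/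
def SiegelModularGroup (n : ℕ) : Set (Matrix (Fin n ⊕ Fin n) (Fin n ⊕ Fin n) ℤ) :=
  {M | Mᵀ * Jn n * M = Jn n}

/-- The fractional-linear action of an integral symplectic matrix on the Siegel
upper half-space. -/
def matActS {n : ℕ} (M : Matrix (Fin n ⊕ Fin n) (Fin n ⊕ Fin n) ℤ)
    (Z : Matrix (Fin n) (Fin n) ℂ) : Matrix (Fin n) (Fin n) ℂ :=
  ((M.map (fun a => (a : ℂ))).toBlocks₁₁ * Z + (M.map (fun a => (a : ℂ))).toBlocks₁₂) *
    ((M.map (fun a => (a : ℂ))).toBlocks₂₁ * Z + (M.map (fun a => (a : ℂ))).toBlocks₂₂)⁻¹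

/-- The index lattice of Fourier expansions of Siegel modular forms of level `N`:
semi-positive symmetric rational matrices `T` with `N·T` half-integral,
i.e. `T ∈ (1/N)Λ_n`. -/
def SiegelLattice (n : ℕ) (N : ℕ) : Set (Matrix (Fin n) (Fin n) ℚ) :=
  {T | T.IsSymm ∧ (∀ i, ∃ a : ℤ, (N : ℚ) * T i i = (a : ℚ)) ∧
    (∀ i j, ∃ a : ℤ, 2 * (N : ℚ) * T i j = (a : ℚ)) ∧
    (T.map (fun q => (q : ℝ))).PosSemidef}

/-- A Siegel modular form of degree `n` and weight `k` for a subgroup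
`Γ ⊆ Γ_n = Sp_n(ℤ)` of level `N`, bundled with its Fourier expansion. For the
full modular group take `Γ = SiegelModularGroup n` and `N = 1`. -/
structure SiegelModularForm (n : ℕ) (k : ℤ)
    (Γ : Set (Matrix (Fin n ⊕ Fin n) (Fin n ⊕ Fin n) ℤ)) (N : ℕ) where
  toFun : Matrix (Fin n) (Fin n) ℂ → ℂ
  coeff : Matrix (Fin n) (Fin n) ℚ → ℂ
  holo : DifferentiableOn ℂ (fun Z : Fin n → Fin n → ℂ => toFun (Matrix.of Z))
    {Z | Matrix.of Z ∈ SiegelUpperHalfSpace n}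
  transform : ∀ M ∈ Γ, ∀ Z ∈ SiegelUpperHalfSpace n,
    toFun (matActS M Z) =
      ((M.map (fun a => (a : ℂ))).toBlocks₂₁ * Z +
        (M.map (fun a => (a : ℂ))).toBlocks₂₂).det ^ k * toFun Z
  coeff_supported : ∀ T, coeff T ≠ 0 → T ∈ SiegelLattice n N
  expansion : ∀ Z ∈ SiegelUpperHalfSpace n,
    HasSum (fun T : SiegelLattice n N =>
      coeff T * Complex.exp (2 * Real.pi * Complex.I *
        (((T : Matrix (Fin n) (Fin n) ℚ).map (fun q => (q : ℂ))) * Z).trace))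
      (toFun Z)


/-- A Hermitian cusp form (degree 2, class number one field): the Fourier
coefficients vanish off the positive definite part of the lattice. -/
def IsCuspHMF {d k : ℤ} (f : HermitianModularForm d k) : Prop :=
  ∀ H, ¬ H.PosDef → f.coeff H = 0

/-- `H0 = ord_p f`: `H0` is the minimal element of `Λ₂(K)`, in the lexicographic
order `lexLt`, whose Fourier coefficient is not divisible by `p`. -/
def IsOrdP (p : ℕ) {d k : ℤ} (f : HermitianModularForm d k)
    (H0 : Matrix (Fin 2) (Fin 2) ℂ) : Prop :=
  H0 ∈ HermLattice d ∧ ¬ ModCongr p 1 (f.coeff H0) 0 ∧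
    ∀ H ∈ HermLattice d, lexLt H H0 → ModCongr p 1 (f.coeff H) 0

namespace HalfWeight

/-! ### Weighted homogeneous polynomials in two variables of half-weights `2` and `3` -/

section Polynomials

variable {k : Type*} [Field k]

/-- `F(X, Y)` is homogeneous of half-weight `n`, where `X` and `Y` have half-weights `2` and `3`. -/
def IsHom (F : MvPolynomial (Fin 2) k) (n : ℕ) : Prop :=
  MvPolynomial.IsWeightedHomogeneous (![2, 3] : Fin 2 → ℕ) F n

lemma weight_apply (d : Fin 2 →₀ ℕ) :
    Finsupp.weight (![2, 3] : Fin 2 → ℕ) d = 2 * d 0 + 3 * d 1 := by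
  simp [Finsupp.weight_apply, Finsupp.sum_fintype, mul_comm]

lemma IsHom.eq_of_coeff_ne_zero {F : MvPolynomial (Fin 2) k} {n : ℕ} (hF : IsHom F n)
    {d : Fin 2 →₀ ℕ} (hd : F.coeff d ≠ 0) : 2 * d 0 + 3 * d 1 = n := by
  rw [← weight_apply]; exact hF hd

lemma isHom_X : IsHom (MvPolynomial.X 0 : MvPolynomial (Fin 2) k) 2 :=
  MvPolynomial.isWeightedHomogeneous_X k _ 0

lemma isHom_Y : IsHom (MvPolynomial.X 1 : MvPolynomial (Fin 2) k) 3 :=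
  MvPolynomial.isWeightedHomogeneous_X k _ 1

lemma IsHom.smul {F : MvPolynomial (Fin 2) k} {n : ℕ} (hF : IsHom F n) (c : k) :
    IsHom (c • F) n :=
  (MvPolynomial.weightedHomogeneousSubmodule k (![2, 3] : Fin 2 → ℕ) n).smul_mem c hF

lemma IsHom.of_eq {F : MvPolynomial (Fin 2) k} {n m : ℕ} (hF : IsHom F n) (h : n = m) :
    IsHom F m := h ▸ hF

lemma IsHom.zero (n : ℕ) : IsHom (0 : MvPolynomial (Fin 2) k) n :=
  MvPolynomial.isWeightedHomogeneous_zero _ _ _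

lemma IsHom.add {F G : MvPolynomial (Fin 2) k} {n : ℕ} (hF : IsHom F n) (hG : IsHom G n) :
    IsHom (F + G) n :=
  MvPolynomial.IsWeightedHomogeneous.add hF hG

lemma IsHom.mul {F G : MvPolynomial (Fin 2) k} {n m : ℕ} (hF : IsHom F n) (hG : IsHom G m) :
    IsHom (F * G) (n + m) :=
  MvPolynomial.IsWeightedHomogeneous.mul hF hG

lemma IsHom.pow {F : MvPolynomial (Fin 2) k} {n : ℕ} (hF : IsHom F n) (m : ℕ) :
    IsHom (F ^ m) (m * n) :=
  MvPolynomial.IsWeightedHomogeneous.pow hF m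

lemma IsHom.sub {F G : MvPolynomial (Fin 2) k} {n : ℕ} (hF : IsHom F n) (hG : IsHom G n) :
    IsHom (F - G) n :=
  (MvPolynomial.weightedHomogeneousSubmodule k (![2, 3] : Fin 2 → ℕ) n).sub_mem hF hG

/-- Restriction of a polynomial in two variables to the curve `t ↦ (t ^ u, t ^ v)`. -/
def restr (u v : ℕ) : MvPolynomial (Fin 2) k →ₐ[k] Polynomial k :=
  MvPolynomial.aeval ![Polynomial.X ^ u, Polynomial.X ^ v]

lemma restr_X (u v : ℕ) : restr u v (MvPolynomial.X 0 : MvPolynomial (Fin 2) k) =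
    Polynomial.X ^ u := by simp [restr]

lemma restr_Y (u v : ℕ) : restr u v (MvPolynomial.X 1 : MvPolynomial (Fin 2) k) =
    Polynomial.X ^ v := by simp [restr]

lemma restr_eq_sum (u v : ℕ) (F : MvPolynomial (Fin 2) k) :
    restr u v F = ∑ d ∈ F.support, Polynomial.monomial (u * d 0 + v * d 1) (F.coeff d) := by
  conv_lhs => rw [F.as_sum, map_sum]
  refine Finset.sum_congr rfl fun d _ => ?_
  rw [restr, MvPolynomial.aeval_monomial, ← Polynomial.C_mul_X_pow_eq_monomial]
  simp [Finsupp.prod_fintype, pow_add, pow_mul]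

lemma IsHom.coeff_restr {F : MvPolynomial (Fin 2) k} {n : ℕ} (hF : IsHom F n) {u v : ℕ}
    (huv : 2 * v ≠ 3 * u) {d : Fin 2 →₀ ℕ} (hd : F.coeff d ≠ 0) :
    (restr u v F).coeff (u * d 0 + v * d 1) = F.coeff d := by
  rw [restr_eq_sum, Polynomial.finsetSum_coeff, Finset.sum_eq_single d]
  · simp
  · intro e he hne
    rw [Polynomial.coeff_monomial, if_neg]
    intro h
    apply hne
    have h1 := hF.eq_of_coeff_ne_zero hd
    have h2 := hF.eq_of_coeff_ne_zero (MvPolynomial.mem_support_iff.mp he)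
    have h0 : d 0 = e 0 := by
      zify at h h1 h2 huv ⊢
      have h3 : (2 * (v : ℤ) - 3 * u) * (d 0 - e 0) = 0 := by
        linear_combination (v : ℤ) * (h1 - h2) + 3 * h
      rcases mul_eq_zero.mp h3 with h4 | h4
      · exact absurd (by linarith) huv
      · linarith
    ext i
    fin_cases i
    · exact h0.symm
    · change e 1 = d 1
      omega
  · intro h
    exact absurd (MvPolynomial.mem_support_iff.mpr hd) h

lemma IsHom.restr_ne_zero {F : MvPolynomial (Fin 2) k} {n : ℕ} (hF : IsHom F n) {u v : ℕ}
    (huv : 2 * v ≠ 3 * u) (h0 : F ≠ 0) : restr u v F ≠ 0 := by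
  obtain ⟨d, hd⟩ := MvPolynomial.ne_zero_iff.mp h0
  intro h
  have := hF.coeff_restr huv hd
  rw [h, Polynomial.coeff_zero] at this
  exact hd this.symm

lemma IsHom.aeval_scale {S : Type*} [CommRing S] [Algebra k S] {F : MvPolynomial (Fin 2) k}
    {n : ℕ} (hF : IsHom F n) (c x y : S) :
    MvPolynomial.aeval ![c ^ 2 * x, c ^ 3 * y] F = c ^ n * MvPolynomial.aeval ![x, y] F := by
  rw [F.as_sum, map_sum, map_sum, Finset.mul_sum]
  refine Finset.sum_congr rfl fun d hd => ?_
  have h1 := hF.eq_of_coeff_ne_zero (MvPolynomial.mem_support_iff.mp hd)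
  rw [MvPolynomial.aeval_monomial, MvPolynomial.aeval_monomial, ← h1]
  simp [Finsupp.prod_fintype, pow_add, pow_mul, mul_pow]
  ring

/-- Serre's derivation `X ↦ -Y/3`, `Y ↦ -X²/2`. -/
def serreDer (F : MvPolynomial (Fin 2) k) : MvPolynomial (Fin 2) k :=
  -((3 : k)⁻¹ • (MvPolynomial.pderiv 0 F * MvPolynomial.X 1) +
    (2 : k)⁻¹ • (MvPolynomial.pderiv 1 F * MvPolynomial.X 0 ^ 2))

lemma IsHom.pderiv_mul {F G : MvPolynomial (Fin 2) k} {n m : ℕ} {i : Fin 2} (hF : IsHom F n)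
    (hG : IsHom G ((![2, 3] : Fin 2 → ℕ) i + m)) :
    IsHom (MvPolynomial.pderiv i F * G) (n + m) := by
  by_cases h : (![2, 3] : Fin 2 → ℕ) i ≤ n
  · obtain ⟨n', rfl⟩ := Nat.exists_eq_add_of_le' h
    exact IsHom.of_eq (MvPolynomial.IsWeightedHomogeneous.mul
      (MvPolynomial.IsWeightedHomogeneous.pderiv hF rfl) hG) (by ring)
  · have : MvPolynomial.pderiv i F = 0 := by
      apply MvPolynomial.pderiv_eq_zero_of_notMem_vars
      intro hi
      obtain ⟨d, hd, hid⟩ := (MvPolynomial.mem_vars_iff_mem_support i).mp hi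
      have h1 := hF.eq_of_coeff_ne_zero (MvPolynomial.mem_support_iff.mp hd)
      have h2 := Finsupp.mem_support_iff.mp hid
      fin_cases i <;> simp at h h2 <;> omega
    rw [this, zero_mul]
    exact MvPolynomial.isWeightedHomogeneous_zero _ _ _

lemma isHom_serreDer {F : MvPolynomial (Fin 2) k} {n : ℕ} (hF : IsHom F n) :
    IsHom (serreDer F) (n + 1) := by
  have h1 : IsHom (MvPolynomial.pderiv 0 F * MvPolynomial.X 1) (n + 1) :=
    hF.pderiv_mul (isHom_Y.of_eq (by simp))
  have h2 : IsHom (MvPolynomial.pderiv 1 F * MvPolynomial.X 0 ^ 2) (n + 1) :=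
    hF.pderiv_mul ((isHom_X.pow 2).of_eq (by simp))
  rw [serreDer, ← neg_one_smul k]
  exact ((h1.smul _).add (h2.smul _)).smul _

lemma IsHom.euler {F : MvPolynomial (Fin 2) k} {n : ℕ} (hF : IsHom F n) :
    2 * (MvPolynomial.X 0 * MvPolynomial.pderiv 0 F) +
      3 * (MvPolynomial.X 1 * MvPolynomial.pderiv 1 F) = (n : MvPolynomial (Fin 2) k) * F := by
  have := MvPolynomial.IsWeightedHomogeneous.sum_weight_X_mul_pderiv hF
  simpa [Fin.sum_univ_two, nsmul_eq_mul] using this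

/-- Chain rule for a derivation composed with the evaluation at two elements. -/
lemma derivation_aeval {S : Type*} [CommRing S] [Algebra k S] (D : Derivation k S S) (x y : S)
    (F : MvPolynomial (Fin 2) k) :
    D (MvPolynomial.aeval ![x, y] F) =
      MvPolynomial.aeval ![x, y] (MvPolynomial.pderiv 0 F) * D x +
      MvPolynomial.aeval ![x, y] (MvPolynomial.pderiv 1 F) * D y := by
  induction F using MvPolynomial.induction_on with
  | C a => simp
  | add p q hp hq => simp only [map_add, hp, hq]; ring
  | mul_X p i hp =>
    rw [map_mul, Derivation.leibniz, hp]
    fin_cases i <;> simp [MvPolynomial.pderiv_X] <;> ring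

lemma IsHom.restr_zero_one_derivative (h2 : (2 : k) ≠ 0) (h3 : (3 : k) ≠ 0)
    {F : MvPolynomial (Fin 2) k} {n : ℕ} (hF : IsHom F n) :
    3 * (Polynomial.X ^ 2 - 1) * Polynomial.derivative (restr 0 1 F) =
      (n : Polynomial k) * Polynomial.X * restr 0 1 F + 6 * restr 0 1 (serreDer F) := by
  have hd : Polynomial.derivative (restr 0 1 F) = restr 0 1 (MvPolynomial.pderiv 1 F) := by
    have := derivation_aeval (Polynomial.derivative') (Polynomial.X ^ 0) (Polynomial.X ^ 1) F
    simpa [restr] using this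
  have he := congrArg (restr 0 1) hF.euler
  simp only [map_add, map_mul, restr_X, restr_Y, map_natCast, map_ofNat, pow_zero, pow_one,
    one_mul] at he
  have hs : restr 0 1 (serreDer F) = -(Polynomial.C (3 : k)⁻¹ * (restr 0 1 (MvPolynomial.pderiv 0 F)
      * Polynomial.X) + Polynomial.C (2 : k)⁻¹ * restr 0 1 (MvPolynomial.pderiv 1 F)) := by
    simp [serreDer, restr_X, restr_Y, Polynomial.smul_eq_C_mul]
  have e3 : (3 : Polynomial k) * Polynomial.C (3 : k)⁻¹ = 1 := by
    rw [← Polynomial.C_ofNat, ← Polynomial.C_mul]; simp [h3]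
  have e2 : (2 : Polynomial k) * Polynomial.C (2 : k)⁻¹ = 1 := by
    rw [← Polynomial.C_ofNat, ← Polynomial.C_mul]; simp [h2]
  rw [hd, hs]
  linear_combination Polynomial.X * he +
    2 * restr 0 1 (MvPolynomial.pderiv 0 F) * Polynomial.X * e3 +
    3 * restr 0 1 (MvPolynomial.pderiv 1 F) * e2

lemma IsHom.restr_one_zero_derivative (h2 : (2 : k) ≠ 0) (h3 : (3 : k) ≠ 0)
    {F : MvPolynomial (Fin 2) k} {n : ℕ} (hF : IsHom F n) :
    2 * (Polynomial.X ^ 3 - 1) * Polynomial.derivative (restr 1 0 F) =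
      (n : Polynomial k) * Polynomial.X ^ 2 * restr 1 0 F + 6 * restr 1 0 (serreDer F) := by
  have hd : Polynomial.derivative (restr 1 0 F) = restr 1 0 (MvPolynomial.pderiv 0 F) := by
    have := derivation_aeval (Polynomial.derivative') (Polynomial.X ^ 1) (Polynomial.X ^ 0) F
    simpa [restr] using this
  have he := congrArg (restr 1 0) hF.euler
  simp only [map_add, map_mul, restr_X, restr_Y, map_natCast, map_ofNat, pow_zero, pow_one,
    one_mul] at he
  have hs : restr 1 0 (serreDer F) = -(Polynomial.C (3 : k)⁻¹ * restr 1 0 (MvPolynomial.pderiv 0 F)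
      + Polynomial.C (2 : k)⁻¹ * (restr 1 0 (MvPolynomial.pderiv 1 F) * Polynomial.X ^ 2)) := by
    simp [serreDer, restr_X, restr_Y, Polynomial.smul_eq_C_mul]
  have e3 : (3 : Polynomial k) * Polynomial.C (3 : k)⁻¹ = 1 := by
    rw [← Polynomial.C_ofNat, ← Polynomial.C_mul]; simp [h3]
  have e2 : (2 : Polynomial k) * Polynomial.C (2 : k)⁻¹ = 1 := by
    rw [← Polynomial.C_ofNat, ← Polynomial.C_mul]; simp [h2]
  rw [hd, hs]
  linear_combination Polynomial.X ^ 2 * he +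
    2 * restr 1 0 (MvPolynomial.pderiv 0 F) * e3 +
    3 * restr 1 0 (MvPolynomial.pderiv 1 F) * Polynomial.X ^ 2 * e2

end Polynomials

end HalfWeight

namespace HalfWeight

section CharP

variable {k : Type*} [Field k]

/-- The derivation `q d/dq` on power series. -/
def theta : Derivation k (PowerSeries k) (PowerSeries k) :=
  (PowerSeries.X : PowerSeries k) • PowerSeries.derivative k

lemma coeff_theta (f : PowerSeries k) (n : ℕ) :
    PowerSeries.coeff n (theta f) = n * PowerSeries.coeff n f := by
  rw [theta, Derivation.smul_apply, smul_eq_mul]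
  cases n with
  | zero => simp
  | succ n => rw [PowerSeries.coeff_succ_X_mul]; simp [PowerSeries.coeff_derivative, mul_comm]

variable (k) in
/-- Power series `Q = E₄`, `R = E₆`, `P = E₂` satisfying Ramanujan's differential equations. -/
structure Ramanujan where
  Q : PowerSeries k
  R : PowerSeries k
  P : PowerSeries k
  Q_zero : PowerSeries.constantCoeff Q = 1
  R_zero : PowerSeries.constantCoeff R = 1
  Q_one : PowerSeries.coeff 1 Q = 240
  R_one : PowerSeries.coeff 1 R = -504
  theta_Q : 3 * theta Q = P * Q - R
  theta_R : 2 * theta R = P * R - Q ^ 2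
  theta_P : 12 * theta P = P ^ 2 - Q

namespace Ramanujan

variable (S : Ramanujan k)

/-- Evaluation of a polynomial at `(E₄, E₆)`. -/
def ev : MvPolynomial (Fin 2) k →ₐ[k] PowerSeries k := MvPolynomial.aeval ![S.Q, S.R]

lemma ev_X : S.ev (MvPolynomial.X 0) = S.Q := by simp [ev]

lemma ev_Y : S.ev (MvPolynomial.X 1) = S.R := by simp [ev]

lemma six_theta_ev (h2 : (2 : k) ≠ 0) (h3 : (3 : k) ≠ 0) {F : MvPolynomial (Fin 2) k} {n : ℕ}
    (hF : IsHom F n) :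
    6 * theta (S.ev F) = 6 * S.ev (serreDer F) + (n : PowerSeries k) * S.P * S.ev F := by
  have hd : theta (S.ev F) = _ := derivation_aeval theta S.Q S.R F
  rw [← ev] at hd
  have he := congrArg S.ev hF.euler
  simp only [map_add, map_mul, ev_X, ev_Y, map_natCast, map_ofNat] at he
  have hs : S.ev (serreDer F) = -(PowerSeries.C (3 : k)⁻¹ *
      (S.ev (MvPolynomial.pderiv 0 F) * S.R) + PowerSeries.C (2 : k)⁻¹ *
      (S.ev (MvPolynomial.pderiv 1 F) * S.Q ^ 2)) := by
    simp [serreDer, ev_X, ev_Y, PowerSeries.smul_eq_C_mul]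
  have e3 : (3 : PowerSeries k) * PowerSeries.C (3 : k)⁻¹ = 1 := by
    rw [← map_ofNat PowerSeries.C, ← map_mul]; simp [h3]
  have e2 : (2 : PowerSeries k) * PowerSeries.C (2 : k)⁻¹ = 1 := by
    rw [← map_ofNat PowerSeries.C, ← map_mul]; simp [h2]
  rw [hd, hs]
  linear_combination S.P * he +
    2 * S.ev (MvPolynomial.pderiv 0 F) * S.R * e3 +
    3 * S.ev (MvPolynomial.pderiv 1 F) * S.Q ^ 2 * e2 +
    2 * S.ev (MvPolynomial.pderiv 0 F) * S.theta_Q +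
    3 * S.ev (MvPolynomial.pderiv 1 F) * S.theta_R

lemma constantCoeff_ev (F : MvPolynomial (Fin 2) k) :
    PowerSeries.constantCoeff (S.ev F) = MvPolynomial.aeval ![(1 : k), 1] F := by
  rw [ev, MvPolynomial.aeval_def, MvPolynomial.aeval_def, MvPolynomial.hom_eval₂]
  congr 1
  ext i
  fin_cases i <;> simp [S.Q_zero, S.R_zero]

lemma eq_zero_of_ev_eq_zero [IsAlgClosed k] (h2 : (2 : k) ≠ 0) (h3 : (3 : k) ≠ 0)
    {F : MvPolynomial (Fin 2) k} {n : ℕ} (hF : IsHom F n) (h : S.ev F = 0) : F = 0 := by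
  by_contra hF0
  have hR : S.R * S.R⁻¹ = 1 := PowerSeries.mul_inv_cancel _ (by simp [S.R_zero])
  set z := S.Q ^ 3 * S.R⁻¹ ^ 2 with hz
  have h1 : MvPolynomial.aeval ![z, z] F = 0 := by
    have := hF.aeval_scale (S.Q * S.R⁻¹) S.Q S.R
    rw [← ev, h, mul_zero] at this
    rw [← this]
    congr 2
    ext1 i
    fin_cases i
    · simp [hz]; ring
    · simp only [hz, Fin.mk_one, Matrix.cons_val_one, Matrix.cons_val_fin_one]
      linear_combination - S.Q ^ 3 * S.R⁻¹ ^ 2 * hR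
  have h4 : Polynomial.aeval z (restr 1 1 F) = 0 := by
    rw [← h1, restr, ← AlgHom.comp_apply]
    congr 1
    ext i
    fin_cases i <;> simp
  have hzint : IsIntegral k z :=
    IsAlgebraic.isIntegral ⟨restr 1 1 F, hF.restr_ne_zero (by norm_num) hF0, h4⟩
  obtain ⟨c, hc⟩ := minpoly.mem_range_of_degree_eq_one k z
    (IsAlgClosed.degree_eq_one_of_irreducible k (minpoly.irreducible hzint))
  have h5 : PowerSeries.C c * S.R ^ 2 = S.Q ^ 3 := by
    change PowerSeries.C c = z at hc
    rw [hc, hz]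
    linear_combination S.Q ^ 3 * (S.R * S.R⁻¹ + 1) * hR
  have h6 := congrArg PowerSeries.constantCoeff h5
  simp [S.Q_zero, S.R_zero] at h6
  have h7 := congrArg (PowerSeries.coeff 1) h5
  rw [h6, map_one, one_mul, PowerSeries.coeff_one_pow, PowerSeries.coeff_one_pow,
    S.Q_one, S.R_one, S.Q_zero, S.R_zero] at h7
  have h8 : (2 : k) ^ 6 * 3 ^ 3 = 0 := by
    norm_num at h7 ⊢
    linear_combination -h7
  simp [h2, h3] at h8

lemma ev_inj [IsAlgClosed k] (h2 : (2 : k) ≠ 0) (h3 : (3 : k) ≠ 0)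
    {F G : MvPolynomial (Fin 2) k} {n : ℕ} (hF : IsHom F n) (hG : IsHom G n)
    (h : S.ev F = S.ev G) : F = G :=
  sub_eq_zero.mp (S.eq_zero_of_ev_eq_zero h2 h3 (hF.sub hG) (by rw [map_sub, h, sub_self]))

end Ramanujan

section Multiplicity

open Polynomial

lemma pow_succ_dvd_of_dvd_derivative {f : k[X]} {t : k} {n : ℕ} (hn : (n : k) ≠ 0)
    (h1 : (X - C t) ^ n ∣ f) (h2 : (X - C t) ^ n ∣ derivative f) : (X - C t) ^ (n + 1) ∣ f := by
  obtain ⟨e, rfl⟩ := h1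
  obtain ⟨m, rfl⟩ : ∃ m, n = m + 1 := Nat.exists_eq_succ_of_ne_zero (by rintro rfl; simp at hn)
  rw [derivative_mul, derivative_X_sub_C_pow] at h2
  have h3 := (dvd_add_left (dvd_mul_right _ _)).mp h2
  rw [Nat.add_sub_cancel, pow_succ, mul_comm (C _) _, mul_assoc,
    mul_dvd_mul_iff_left (pow_ne_zero _ (X_sub_C_ne_zero t)), ← smul_eq_C_mul] at h3
  have h4 : (X - C t) ∣ e := by
    rw [dvd_iff_isRoot] at h3 ⊢
    push_cast at hn
    simpa [IsRoot, hn] using h3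
  exact pow_succ (X - C t) (m + 1) ▸ mul_dvd_mul_left _ h4

lemma pow_dvd_of_pow_dvd_mul {c f : k[X]} {t : k} {n : ℕ} (hc : c.eval t ≠ 0)
    (h : (X - C t) ^ n ∣ c * f) : (X - C t) ^ n ∣ f := by
  refine IsCoprime.dvd_of_dvd_mul_left (IsCoprime.pow_left ?_) h
  exact ((irreducible_X_sub_C t).coprime_iff_not_dvd).mpr fun h => hc (dvd_iff_isRoot.mp h)

/-- A nonzero solution of a first order linear system has no common zero with its companion. -/
lemma eval_ne_zero_of_system {p : ℕ} [CharP k p] {a b c u u' w' : k[X]} {w t : k}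
    (hc : c.eval t ≠ 0) (hw : w ≠ 0)
    (h1 : c * derivative a = u * a + C w * b) (h2 : c * derivative b = u' * b + w' * a)
    (ha : a ≠ 0) (hdeg : a.natDegree < p) (hroot : a.IsRoot t) : b.eval t ≠ 0 := by
  intro hb
  have key : ∀ n, 1 ≤ n → n ≤ p → (X - C t) ^ n ∣ a ∧ (X - C t) ^ n ∣ b := by
    intro n hn
    induction n, hn using Nat.le_induction with
    | base => intro _; rw [pow_one]; exact ⟨dvd_iff_isRoot.mpr hroot, dvd_iff_isRoot.mpr hb⟩
    | succ n hn ih =>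
      intro hnp
      obtain ⟨ia, ib⟩ := ih (by omega)
      have hn0 : (n : k) ≠ 0 := by
        rw [Ne, CharP.cast_eq_zero_iff k p]
        intro h
        exact absurd (Nat.le_of_dvd hn h) (by omega)
      refine ⟨pow_succ_dvd_of_dvd_derivative hn0 ia (pow_dvd_of_pow_dvd_mul hc ?_),
        pow_succ_dvd_of_dvd_derivative hn0 ib (pow_dvd_of_pow_dvd_mul hc ?_)⟩
      · rw [h1]; exact dvd_add (ia.mul_left _) (ib.mul_left _)
      · rw [h2]; exact dvd_add (ib.mul_left _) (ia.mul_left _)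
  have h3 := natDegree_le_of_dvd (key p (by omega) le_rfl).1 ha
  rw [natDegree_pow, natDegree_X_sub_C, mul_one] at h3
  omega

lemma rootMultiplicity_eq_one_of_system {a b c u : k[X]} {w t : k} (hw : w ≠ 0)
    (h1 : c * derivative a = u * a + C w * b)
    (ha : a ≠ 0) (hroot : a.IsRoot t) (hb : b.eval t ≠ 0) : a.rootMultiplicity t = 1 := by
  have h2 : 0 < a.rootMultiplicity t := (rootMultiplicity_pos ha).mpr hroot
  by_contra h3
  have h4 := (one_lt_rootMultiplicity_iff_isRoot ha).mp (by omega : 1 < a.rootMultiplicity t)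
  have h5 := congrArg (eval t) h1
  simp only [eval_mul, eval_add, eval_C] at h5
  rw [h4.2.eq_zero, hroot.eq_zero, mul_zero, mul_zero, zero_add] at h5
  exact mul_ne_zero hw hb h5.symm

end Multiplicity

end CharP

end HalfWeight

namespace HalfWeight

section Hasse

variable {k : Type*} [Field k]

lemma eval_restr (u v : ℕ) (F : MvPolynomial (Fin 2) k) (t : k) :
    (restr u v F).eval t = MvPolynomial.aeval ![t ^ u, t ^ v] F := by
  rw [← Polynomial.coe_aeval_eq_eval, restr]
  change ((Polynomial.aeval (R := k) t).comp (MvPolynomial.aeval _)) F = _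
  congr 1
  ext i
  fin_cases i <;> simp

lemma IsHom.natDegree_restr_le {F : MvPolynomial (Fin 2) k} {n : ℕ} (hF : IsHom F n) {u v : ℕ}
    (hu : u ≤ 1) (hv : v ≤ 1) : (restr u v F).natDegree ≤ n := by
  rw [restr_eq_sum]
  refine Polynomial.natDegree_sum_le_of_forall_le _ _ fun d hd => ?_
  refine (Polynomial.natDegree_monomial_le _).trans ?_
  have := hF.eq_of_coeff_ne_zero (MvPolynomial.mem_support_iff.mp hd)
  interval_cases u <;> interval_cases v <;> omega

variable {p h : ℕ} [CharP k p] [IsAlgClosed k] (S : Ramanujan k)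

/-- A Hasse invariant: a polynomial of weight `p - 1 = 2h` whose `q`-expansion is `1`. -/
structure IsHasse (S : Ramanujan k) (p h : ℕ) (A : MvPolynomial (Fin 2) k) : Prop where
  prime : p.Prime
  five_le : 5 ≤ p
  half : 2 * h + 1 = p
  isHom : IsHom A h
  ev_eq : S.ev A = 1

variable {S} {A : MvPolynomial (Fin 2) k}

namespace IsHasse

lemma natCast_ne_zero (hA : IsHasse S p h A) {n : ℕ} (h0 : 0 < n) (hn : n < p) :
    (n : k) ≠ 0 := by
  rw [Ne, CharP.cast_eq_zero_iff k p]
  exact fun h => absurd (Nat.le_of_dvd h0 h) (by omega)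

lemma two_ne_zero (hA : IsHasse S p h A) : (2 : k) ≠ 0 := by
  exact_mod_cast hA.natCast_ne_zero (by norm_num) (by have := hA.five_le; omega : 2 < p)

lemma three_ne_zero (hA : IsHasse S p h A) : (3 : k) ≠ 0 := by
  exact_mod_cast hA.natCast_ne_zero (by norm_num) (by have := hA.five_le; omega : 3 < p)

lemma two_mul_half (hA : IsHasse S p h A) : (2 : k) * h = -1 := by
  have : ((2 * h + 1 : ℕ) : k) = 0 := by rw [hA.half]; exact CharP.cast_eq_zero k p
  push_cast at this
  linear_combination this

lemma two_mul_half' (hA : IsHasse S p h A) : (2 : PowerSeries k) * h = -1 := by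
  have := congrArg PowerSeries.C hA.two_mul_half
  rwa [map_mul, map_ofNat, map_natCast, map_neg, map_one] at this

lemma ne_zero (hA : IsHasse S p h A) : A ≠ 0 := by
  rintro rfl
  simpa using hA.ev_eq

/-- The polynomial of weight `p + 1` whose `q`-expansion is that of `E₂`. -/
def companion (A : MvPolynomial (Fin 2) k) : MvPolynomial (Fin 2) k := (12 : k) • serreDer A

lemma isHom_companion (hA : IsHasse S p h A) : IsHom (companion A) (h + 1) :=
  (isHom_serreDer hA.isHom).smul _

lemma ev_companion (hA : IsHasse S p h A) : S.ev (companion A) = S.P := by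
  have h1 := S.six_theta_ev hA.two_ne_zero hA.three_ne_zero hA.isHom
  rw [hA.ev_eq, Derivation.map_one_eq_zero, mul_zero] at h1
  have h3 : S.ev (companion A) = 12 * S.ev (serreDer A) := by
    rw [companion, map_smul, PowerSeries.smul_eq_C_mul, map_ofNat]
  rw [h3]
  linear_combination -2 * h1 - S.P * hA.two_mul_half'

lemma serreDer_companion (hA : IsHasse S p h A) :
    12 * serreDer (companion A) = -(MvPolynomial.X 0 * A) := by
  have e12 : (12 : MvPolynomial (Fin 2) k) * serreDer (companion A) =
      (12 : k) • serreDer (companion A) := by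
    rw [MvPolynomial.smul_eq_C_mul, map_ofNat]
  rw [e12]
  have hd := S.six_theta_ev hA.two_ne_zero hA.three_ne_zero hA.isHom_companion
  refine S.ev_inj hA.two_ne_zero hA.three_ne_zero
    ((isHom_serreDer hA.isHom_companion).smul 12) (n := h + 1 + 1) ?_ ?_
  · have := ((isHom_X.mul hA.isHom).smul (-1)).of_eq (by omega : 2 + h = h + 1 + 1)
    rwa [neg_one_smul] at this
  · rw [map_smul, PowerSeries.smul_eq_C_mul, map_ofNat, map_neg, map_mul, hA.ev_eq, mul_one,
      Ramanujan.ev_X]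
    rw [hA.ev_companion] at hd
    push_cast at hd
    linear_combination -2 * hd - S.P ^ 2 * hA.two_mul_half' + S.theta_P

lemma aeval_one (hA : IsHasse S p h A) : MvPolynomial.aeval ![(1 : k), 1] A = 1 := by
  rw [← S.constantCoeff_ev, hA.ev_eq, map_one]

/-- The Hasse invariant has a simple zero, at which its companion does not vanish. -/
lemma exists_simple_root (hA : IsHasse S p h A) : ∃ (u v : ℕ) (t : k), 2 * v ≠ 3 * u ∧
    (restr u v A).rootMultiplicity t = 1 ∧ (restr u v (companion A)).eval t ≠ 0 := by
  have h2 := hA.two_ne_zero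
  have h3 := hA.three_ne_zero
  have hp5 := hA.five_le
  have hph := hA.half
  have e2 : (2 : Polynomial k) * Polynomial.C (2 : k)⁻¹ = 1 := by
    rw [← Polynomial.C_ofNat, ← Polynomial.C_mul]; simp [h2]
  have hB : ∀ u v, restr u v (companion A) = 12 * restr u v (serreDer A) := by
    intro u v
    rw [companion, map_smul, Polynomial.smul_eq_C_mul, map_ofNat]
  have hBd : ∀ u v, 12 * restr u v (serreDer (companion A)) =
      -(restr u v (MvPolynomial.X 0) * restr u v A) := by
    intro u v
    have := congrArg (restr u v) hA.serreDer_companion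
    rwa [map_mul, map_ofNat, map_neg, map_mul] at this
  by_cases hdeg : (restr 0 1 A).degree = 0
  · refine ⟨1, 0, 0, by norm_num, ?_⟩
    have ha : restr 1 0 A ≠ 0 := hA.isHom.restr_ne_zero (by norm_num) hA.ne_zero
    have hroot : (restr 1 0 A).IsRoot 0 := by
      rw [Polynomial.IsRoot, ← Polynomial.coeff_zero_eq_eval_zero, restr_eq_sum,
        Polynomial.finsetSum_coeff]
      refine Finset.sum_eq_zero fun d hd => ?_
      rw [Polynomial.coeff_monomial, if_neg]
      have hd' := MvPolynomial.mem_support_iff.mp hd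
      have h4 := hA.isHom.eq_of_coeff_ne_zero hd'
      have h5 := hA.isHom.coeff_restr (u := 0) (v := 1) (by norm_num) hd'
      have h6 : d 1 = 0 := by
        by_contra h7
        rw [Polynomial.eq_C_of_degree_eq_zero hdeg, Polynomial.coeff_C_of_ne_zero (by omega)] at h5
        exact hd' h5.symm
      omega
    have hc : ((2 : Polynomial k) * (Polynomial.X ^ 3 - 1)).eval 0 ≠ 0 := by simp [h2]
    have s1 := hA.isHom.restr_one_zero_derivative h2 h3
    have s2 := hA.isHom_companion.restr_one_zero_derivative h2 h3
    have s1' : 2 * (Polynomial.X ^ 3 - 1) * Polynomial.derivative (restr 1 0 A) =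
        ((h : Polynomial k) * Polynomial.X ^ 2) * restr 1 0 A +
          Polynomial.C (2 : k)⁻¹ * restr 1 0 (companion A) := by
      rw [s1, hB]
      linear_combination -6 * restr 1 0 (serreDer A) * e2
    have s2' : 2 * (Polynomial.X ^ 3 - 1) * Polynomial.derivative (restr 1 0 (companion A)) =
        (((h + 1 : ℕ) : Polynomial k) * Polynomial.X ^ 2) * restr 1 0 (companion A) +
          (-(Polynomial.C (2 : k)⁻¹ * Polynomial.X)) * restr 1 0 A := by
      have := hBd 1 0
      rw [restr_X] at this
      rw [s2]
      linear_combination -6 * restr 1 0 (serreDer (companion A)) * e2 +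
        Polynomial.C (2 : k)⁻¹ * this
    have hb := eval_ne_zero_of_system (p := p) hc (inv_ne_zero h2) s1' s2' ha
      ((hA.isHom.natDegree_restr_le le_rfl zero_le_one).trans_lt (by omega)) hroot
    exact ⟨rootMultiplicity_eq_one_of_system (inv_ne_zero h2) s1' ha hroot hb, hb⟩
  · obtain ⟨t, hroot⟩ := IsAlgClosed.exists_root _ hdeg
    refine ⟨0, 1, t, by norm_num, ?_⟩
    have ha : restr 0 1 A ≠ 0 := hA.isHom.restr_ne_zero (by norm_num) hA.ne_zero
    have hc : ((3 : Polynomial k) * (Polynomial.X ^ 2 - 1)).eval t ≠ 0 := by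
      intro hc
      have : t ^ 2 = 1 := by simpa [h3, sub_eq_zero] using hc
      rw [Polynomial.IsRoot, eval_restr] at hroot
      rcases sq_eq_one_iff.mp this with rfl | rfl
      · simp [hA.aeval_one] at hroot
      · have := hA.isHom.aeval_scale (-1 : k) 1 1
        rw [hA.aeval_one] at this
        norm_num at this hroot
        rw [this] at hroot
        exact pow_ne_zero _ (by simp) hroot
    have s1 := hA.isHom.restr_zero_one_derivative h2 h3
    have s2 := hA.isHom_companion.restr_zero_one_derivative h2 h3
    have s1' : 3 * (Polynomial.X ^ 2 - 1) * Polynomial.derivative (restr 0 1 A) =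
        ((h : Polynomial k) * Polynomial.X) * restr 0 1 A +
          Polynomial.C (2 : k)⁻¹ * restr 0 1 (companion A) := by
      rw [s1, hB]
      linear_combination -6 * restr 0 1 (serreDer A) * e2
    have s2' : 3 * (Polynomial.X ^ 2 - 1) * Polynomial.derivative (restr 0 1 (companion A)) =
        (((h + 1 : ℕ) : Polynomial k) * Polynomial.X) * restr 0 1 (companion A) +
          (-(Polynomial.C (2 : k)⁻¹)) * restr 0 1 A := by
      have := hBd 0 1
      rw [restr_X] at this
      rw [s2]
      linear_combination -6 * restr 0 1 (serreDer (companion A)) * e2 +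
        Polynomial.C (2 : k)⁻¹ * this
    have hb := eval_ne_zero_of_system (p := p) hc (inv_ne_zero h2) s1' s2' ha
      ((hA.isHom.natDegree_restr_le zero_le_one le_rfl).trans_lt (by omega)) hroot
    exact ⟨rootMultiplicity_eq_one_of_system (inv_ne_zero h2) s1' ha hroot hb, hb⟩

end IsHasse

end Hasse

end HalfWeight

namespace HalfWeight

lemma rootMultiplicity_pow {k : Type*} [Field k] (f : Polynomial k) (t : k) (n : ℕ) :
    (f ^ n).rootMultiplicity t = n * f.rootMultiplicity t := by
  classical
  rw [← Polynomial.count_roots, ← Polynomial.count_roots, Polynomial.roots_pow,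
    Multiset.count_nsmul]

namespace IsHasse

variable {k : Type*} [Field k] {p h : ℕ} [CharP k p] [IsAlgClosed k] {S : Ramanujan k}
  {A : MvPolynomial (Fin 2) k}

lemma dvd_of_ev_eq_aux (hA : IsHasse S p h A) {a b : MvPolynomial (Fin 2) k} {n s : ℕ}
    (ha : IsHom a n) (hb : IsHom b (n + s)) (hab : S.ev a = S.ev b) (h0 : S.ev a ≠ 0) :
    h ∣ s := by
  have h1 : a ^ h * A ^ s = b ^ h := by
    refine S.ev_inj hA.two_ne_zero hA.three_ne_zero
      ((ha.pow h).mul (hA.isHom.pow s)) ((hb.pow h).of_eq (by ring)) ?_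
    rw [map_mul, map_pow, map_pow, map_pow, hA.ev_eq, hab, one_pow, mul_one]
  obtain ⟨u, v, t, huv, hAt, -⟩ := hA.exists_simple_root
  have ha0 : a ≠ 0 := by rintro rfl; simp at h0
  have h2 := congrArg (fun F => (restr u v F).rootMultiplicity t) h1
  have ra : restr u v a ≠ 0 := ha.restr_ne_zero huv ha0
  have rA : restr u v A ≠ 0 := hA.isHom.restr_ne_zero huv hA.ne_zero
  simp only [map_mul, map_pow] at h2
  rw [Polynomial.rootMultiplicity_mul (mul_ne_zero (pow_ne_zero _ ra) (pow_ne_zero _ rA)),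
    rootMultiplicity_pow, rootMultiplicity_pow] at h2
  rw [rootMultiplicity_pow, hAt, mul_one] at h2
  exact (Nat.dvd_add_right (dvd_mul_right _ _)).mp (h2 ▸ dvd_mul_right _ _)

/-- Congruent forms have weights congruent modulo `p - 1`. -/
theorem dvd_of_ev_eq (hA : IsHasse S p h A) {a b : MvPolynomial (Fin 2) k} {n m : ℕ}
    (ha : IsHom a n) (hb : IsHom b m) (hab : S.ev a = S.ev b) (h0 : S.ev a ≠ 0) :
    (h : ℤ) ∣ m - n := by
  rcases le_total n m with hnm | hnm
  · obtain ⟨s, rfl⟩ := Nat.exists_eq_add_of_le hnm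
    simpa using Int.natCast_dvd_natCast.mpr (hA.dvd_of_ev_eq_aux ha hb hab h0)
  · obtain ⟨s, rfl⟩ := Nat.exists_eq_add_of_le hnm
    simpa using Int.natCast_dvd_natCast.mpr (hA.dvd_of_ev_eq_aux hb ha hab.symm (hab ▸ h0))

/-- Polynomials whose `q`-expansions are the iterated derivatives of `E₂`. -/
def iterTheta (h : ℕ) (A : MvPolynomial (Fin 2) k) : ℕ → MvPolynomial (Fin 2) k
  | 0 => companion A
  | j + 1 => A * serreDer (iterTheta h A j) +
      ((((j + 1) * (h + 1) : ℕ) : k) / 6) • (companion A * iterTheta h A j)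

lemma isHom_iterTheta (hA : IsHasse S p h A) (j : ℕ) :
    IsHom (iterTheta h A j) ((j + 1) * (h + 1)) := by
  induction j with
  | zero => exact hA.isHom_companion.of_eq (by ring)
  | succ j ih =>
    exact ((hA.isHom.mul (isHom_serreDer ih)).of_eq (m := (j + 1 + 1) * (h + 1)) (by ring)).add
      (((hA.isHom_companion.mul ih).of_eq (m := (j + 1 + 1) * (h + 1)) (by ring)).smul _)

lemma six_ne_zero (hA : IsHasse S p h A) : (6 : k) ≠ 0 := by
  have : (6 : k) = 2 * 3 := by norm_num
  rw [this]
  exact mul_ne_zero hA.two_ne_zero hA.three_ne_zero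

lemma ev_iterTheta (hA : IsHasse S p h A) (j : ℕ) :
    S.ev (iterTheta h A j) = theta^[j] S.P := by
  induction j with
  | zero => exact hA.ev_companion
  | succ j ih =>
    rw [Function.iterate_succ_apply', ← ih]
    have h1 := S.six_theta_ev hA.two_ne_zero hA.three_ne_zero (hA.isHom_iterTheta j)
    have h6 : (PowerSeries.C (6 : k)) ≠ 0 := by
      exact (map_ne_zero_iff _ PowerSeries.C_injective).mpr hA.six_ne_zero
    refine mul_left_cancel₀ h6 ?_
    rw [map_ofNat, h1, iterTheta, map_add, map_mul, hA.ev_eq, one_mul, map_smul, map_mul,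
      hA.ev_companion, PowerSeries.smul_eq_C_mul, mul_add]
    have h7 : (6 : PowerSeries k) * PowerSeries.C ((((j + 1) * (h + 1) : ℕ) : k) / 6) =
        (((j + 1) * (h + 1) : ℕ) : PowerSeries k) := by
      rw [← map_ofNat PowerSeries.C, ← map_mul, mul_div_cancel₀ _ hA.six_ne_zero, map_natCast]
    rw [← mul_assoc (6 : PowerSeries k) (PowerSeries.C _), h7, ← mul_assoc]

lemma eval_iterTheta_ne_zero (hA : IsHasse S p h A) {u v : ℕ} {t : k}
    (h0 : (restr u v A).eval t = 0) (hB : (restr u v (companion A)).eval t ≠ 0) {j : ℕ}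
    (hj : j < p) : (restr u v (iterTheta h A j)).eval t ≠ 0 := by
  induction j with
  | zero => exact hB
  | succ j ih =>
    rw [iterTheta, map_add, map_mul, map_smul, map_mul, Polynomial.eval_add, Polynomial.eval_mul,
      h0, zero_mul, zero_add, Polynomial.eval_smul, Polynomial.eval_mul, smul_eq_mul]
    refine mul_ne_zero (div_ne_zero ?_ hA.six_ne_zero) (mul_ne_zero hB (ih (by omega)))
    have hp := hA.half
    have := hA.five_le
    rw [Nat.cast_mul]
    exact mul_ne_zero (hA.natCast_ne_zero (by omega) hj)
      (hA.natCast_ne_zero (by omega) (by omega))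

section AlgebraicIndependence

open Polynomial

lemma false_of_mul_eq {a b c d : k[X]} {t : k} (hp : p.Prime) (ha : a ≠ 0) (hc : c ≠ 0)
    (hct : c.rootMultiplicity t = 1) (hd : d.eval t ≠ 0)
    (h : c ^ (p + 1) * (b * a ^ (p - 1) - b ^ p) = a ^ p * d) : False := by
  obtain ⟨q, rfl⟩ : ∃ q, p = q + 1 := Nat.exists_eq_succ_of_ne_zero hp.ne_zero
  have hc0 : c.eval t = 0 := (rootMultiplicity_pos hc).mp (by omega)
  have hd0 : d ≠ 0 := by rintro rfl; simp at hd
  have hb : b ≠ 0 := by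
    rintro rfl
    simp [ha, hd0] at h
  rw [Nat.add_sub_cancel] at h
  obtain ⟨a', ha', hat⟩ := exists_eq_pow_rootMultiplicity_mul_and_not_dvd a ha t
  obtain ⟨b', hb', hbt⟩ := exists_eq_pow_rootMultiplicity_mul_and_not_dvd b hb t
  rw [dvd_iff_isRoot, IsRoot] at hat hbt
  have hX : ∀ n, (X - C t) ^ n ≠ 0 := fun n => pow_ne_zero _ (X_sub_C_ne_zero t)
  rcases le_or_gt (a.rootMultiplicity t) (b.rootMultiplicity t) with hle | hlt
  · obtain ⟨e, he⟩ := Nat.exists_eq_add_of_le hle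
    rw [he, pow_add, mul_assoc] at hb'
    set x := (X - C t) ^ a.rootMultiplicity t with hx
    set f := (X - C t) ^ e * b'
    have h1 : x ^ (q + 1) * (c ^ (q + 1 + 1) * (f * a' ^ q - f ^ (q + 1))) =
        x ^ (q + 1) * (a' ^ (q + 1) * d) := by
      calc _ = c ^ (q + 1 + 1) * ((x * f) * (x * a') ^ q - (x * f) ^ (q + 1)) := by ring
        _ = (x * a') ^ (q + 1) * d := by rw [← ha', ← hb', h]
        _ = _ := by ring
    have h2 := congrArg (eval t) (mul_left_cancel₀ (pow_ne_zero _ (hX _)) h1)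
    simp only [eval_mul, eval_pow, hc0, zero_pow (Nat.succ_ne_zero _), zero_mul] at h2
    exact mul_ne_zero (pow_ne_zero _ hat) hd h2.symm
  · obtain ⟨e, he⟩ := Nat.exists_eq_add_of_lt hlt
    rw [he, add_assoc, pow_add, mul_assoc] at ha'
    set x := (X - C t) ^ b.rootMultiplicity t with hx
    set y := (X - C t) ^ (e + 1) with hy
    set f := y * a' with hf
    have hf0 : f.eval t = 0 := by simp [hf, hy]
    have h1 : x ^ (q + 1) * (c ^ (q + 1 + 1) * (b' * (f ^ q - b' ^ q))) =
        x ^ (q + 1) * (f ^ (q + 1) * d) := by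
      calc _ = c ^ (q + 1 + 1) * ((x * b') * (x * f) ^ q - (x * b') ^ (q + 1)) := by ring
        _ = (x * f) ^ (q + 1) * d := by rw [← ha', ← hb', h]
        _ = _ := by ring
    have h2 := mul_left_cancel₀ (pow_ne_zero _ (hX _)) h1
    have hq : q ≠ 0 := by rintro rfl; exact Nat.not_prime_one hp
    have hu : (b' * (f ^ q - b' ^ q)).eval t ≠ 0 := by
      rw [eval_mul, eval_sub, eval_pow, eval_pow, hf0, zero_pow hq, zero_sub]
      exact mul_ne_zero hbt (neg_ne_zero.mpr (pow_ne_zero _ hbt))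
    have ha0 : a' ≠ 0 := by rintro rfl; simp at hat
    have hf1 : f ≠ 0 := mul_ne_zero (hX _) ha0
    have hu0 : b' * (f ^ q - b' ^ q) ≠ 0 := by intro h; rw [h] at hu; simp at hu
    have h3 := congrArg (rootMultiplicity t) h2
    rw [rootMultiplicity_mul (mul_ne_zero (pow_ne_zero _ hc) hu0),
      rootMultiplicity_mul (mul_ne_zero (pow_ne_zero _ hf1) hd0),
      HalfWeight.rootMultiplicity_pow, HalfWeight.rootMultiplicity_pow, hct,
      rootMultiplicity_eq_zero hd, rootMultiplicity_eq_zero hu, mul_one, add_zero, add_zero] at h3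
    have h4 : q + 1 ∣ 1 := (Nat.dvd_add_right (dvd_refl (q + 1))).mp (h3 ▸ dvd_mul_right _ _)
    exact hp.one_lt.ne' (Nat.dvd_one.mp h4)

end AlgebraicIndependence

/-- A solution of the Artin–Schreier equation attached to `θ ^ (p - 2) E₂` and its `p`-power
iterates are not quotients of forms of equal weight. -/
theorem ev_ne_mul_pow (hA : IsHasse S p h A) {c : k} (hc : c ≠ 0) {β : PowerSeries k}
    (hβ : β - β ^ p = c • theta^[p - 2] S.P) (s : ℕ) {a b : MvPolynomial (Fin 2) k} {n : ℕ}
    (ha : IsHom a n) (hb : IsHom b n) (h0 : S.ev a ≠ 0) : S.ev b ≠ S.ev a * β ^ p ^ s := by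
  have hp := hA.half
  have hp5 := hA.five_le
  have : Fact p.Prime := ⟨hA.prime⟩
  have : CharP (PowerSeries k) p :=
    charP_of_injective_algebraMap (algebraMap k (PowerSeries k)).injective p
  set Ψ := c • iterTheta h A (p - 2) with hΨ
  have hΨev : S.ev Ψ = β - β ^ p := by rw [hβ, hΨ, map_smul, hA.ev_iterTheta]
  have hΨhom : IsHom Ψ ((p + 1) * h) :=
    ((hA.isHom_iterTheta (p - 2)).smul c).of_eq (by
      obtain ⟨q, rfl⟩ : ∃ q, p = q + 2 := ⟨p - 2, by omega⟩
      rw [Nat.add_sub_cancel]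
      have : q + 1 = 2 * h := by omega
      rw [show q + 2 + 1 = 2 * h + 2 by omega, this]
      ring)
  induction s generalizing a b n with
  | zero =>
    intro hab
    rw [pow_zero, pow_one] at hab
    have h1 : A ^ (p + 1) * (b * a ^ (p - 1) - b ^ p) = a ^ p * Ψ := by
      refine S.ev_inj hA.two_ne_zero hA.three_ne_zero
        ((hA.isHom.pow (p + 1)).mul (((hb.mul (ha.pow (p - 1))).of_eq (m := p * n) ?_).sub
          (hb.pow p))) (((ha.pow p).mul hΨhom).of_eq (by ring)) ?_
      · obtain ⟨q, rfl⟩ : ∃ q, p = q + 1 := ⟨p - 1, by omega⟩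
        rw [Nat.add_sub_cancel]; ring
      · simp only [map_mul, map_pow, map_sub, hA.ev_eq, hab, hΨev]
        obtain ⟨q, rfl⟩ : ∃ q, p = q + 1 := ⟨p - 1, by omega⟩
        rw [Nat.add_sub_cancel]; ring
    obtain ⟨u, v, t, huv, hAt, hBt⟩ := hA.exists_simple_root
    have rA : restr u v A ≠ 0 := hA.isHom.restr_ne_zero huv hA.ne_zero
    have rA0 : (restr u v A).eval t = 0 := (Polynomial.rootMultiplicity_pos rA).mp (by omega)
    have ha0 : a ≠ 0 := by rintro rfl; simp at h0
    refine false_of_mul_eq hA.prime (ha.restr_ne_zero huv ha0) rA hAt (d := restr u v Ψ)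
      (b := restr u v b) ?_ ?_
    · rw [hΨ, map_smul, Polynomial.eval_smul]
      exact mul_ne_zero hc (hA.eval_iterTheta_ne_zero rA0 hBt (by omega))
    · simpa only [map_mul, map_pow, map_sub] using congrArg (restr u v) h1
  | succ s ih =>
    intro hab
    have hs : S.ev Ψ ^ p ^ s = β ^ p ^ s - β ^ p ^ (s + 1) := by
      rw [hΨev, sub_pow_char_pow, ← pow_mul, ← pow_succ']
    refine ih (n := n + p ^ s * (p + 1) * h) (a := a * A ^ (p ^ s * (p + 1)))
      (b := b * A ^ (p ^ s * (p + 1)) + a * Ψ ^ p ^ s)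
      (ha.mul (hA.isHom.pow _)) ((hb.mul (hA.isHom.pow _)).add
        ((ha.mul (hΨhom.pow _)).of_eq (m := n + p ^ s * (p + 1) * h) (by ring))) ?_ ?_
    · simpa [hA.ev_eq] using h0
    · simp only [map_mul, map_pow, map_add, hA.ev_eq, hab, hs]
      ring

end IsHasse

end HalfWeight

namespace HalfWeight

open UpperHalfPlane hiding I
open Function.Periodic (qParam)
open scoped Manifold MatrixGroups ModularForm Derivative Topology

/-- `F` is given on the upper half plane by the power series `c` in `exp (2 π i τ / L)`. -/
def HasQ (L : ℕ) (F : ℍ → ℂ) (c : PowerSeries ℂ) : Prop :=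
  ∀ τ : ℍ, HasSum (fun m ↦ PowerSeries.coeff m c * qParam L τ ^ m) (F τ)

namespace HasQ

variable {L : ℕ} {F G : ℍ → ℂ} {c d : PowerSeries ℂ}

lemma add (hF : HasQ L F c) (hG : HasQ L G d) : HasQ L (F + G) (c + d) := fun τ ↦ by
  simpa [add_mul] using (hF τ).add (hG τ)

lemma sub (hF : HasQ L F c) (hG : HasQ L G d) : HasQ L (F - G) (c - d) := fun τ ↦ by
  simpa [sub_mul] using (hF τ).sub (hG τ)

lemma const (a : ℂ) : HasQ L (fun _ ↦ a) (PowerSeries.C a) := fun τ ↦ by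
  have := hasSum_single (f := fun m ↦ PowerSeries.coeff m (PowerSeries.C a) * qParam L τ ^ m) 0
    (fun m hm ↦ by simp [PowerSeries.coeff_C, hm])
  simpa using this

lemma mul (hF : HasQ L F c) (hG : HasQ L G d) : HasQ L (F * G) (c * d) := fun τ ↦ by
  have h1 := (hF τ).summable.norm
  have h2 := (hG τ).summable.norm
  have h := summable_norm_sum_mul_antidiagonal_of_summable_norm h1 h2
  have h' := tsum_mul_tsum_eq_tsum_sum_antidiagonal_of_summable_norm h1 h2
  rw [(hF τ).tsum_eq, (hG τ).tsum_eq] at h'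
  have e : (fun m ↦ PowerSeries.coeff m (c * d) * qParam L τ ^ m) = fun n ↦
      ∑ kl ∈ Finset.HasAntidiagonal.antidiagonal n, PowerSeries.coeff kl.1 c * qParam L τ ^ kl.1 *
        (PowerSeries.coeff kl.2 d * qParam L τ ^ kl.2) := by
    funext m
    rw [PowerSeries.coeff_mul, Finset.sum_mul]
    refine Finset.sum_congr rfl fun x hx ↦ ?_
    rw [← Finset.HasAntidiagonal.mem_antidiagonal.mp hx, pow_add]
    ring
  rw [e, Pi.mul_apply, h']
  exact h.of_norm.hasSum

/-- The ring of pairs of a function and a power series representing it. -/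
def subring (L : ℕ) : Subring ((ℍ → ℂ) × PowerSeries ℂ) where
  carrier := {x | HasQ L x.1 x.2}
  mul_mem' := fun h h' ↦ h.mul h'
  one_mem' := by
    have := HasQ.const (L := L) 1
    rwa [map_one] at this
  add_mem' := fun h h' ↦ h.add h'
  zero_mem' := by
    have := HasQ.const (L := L) 0
    rwa [map_zero] at this
  neg_mem' := fun {x} h ↦ by
    have := (HasQ.const (L := L) 0).sub h
    have e : (fun _ ↦ (0 : ℂ)) - x.1 = -x.1 := by ext; simp
    rw [e] at this
    simpa using this

lemma mem_subring : (F, c) ∈ subring L ↔ HasQ L F c := Iff.rfl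

lemma pow (hF : HasQ L F c) (n : ℕ) : HasQ L (F ^ n) (c ^ n) :=
  pow_mem (mem_subring.mpr hF) n

lemma const_mul (a : ℂ) (hF : HasQ L F c) : HasQ L (fun τ ↦ a * F τ) (a • c) := by
  have := (HasQ.const a).mul hF
  rwa [← PowerSeries.smul_eq_C_mul] at this

lemma sum {ι : Type*} {s : Finset ι} {F : ι → ℍ → ℂ} {c : ι → PowerSeries ℂ}
    (h : ∀ i ∈ s, HasQ L (F i) (c i)) : HasQ L (∑ i ∈ s, F i) (∑ i ∈ s, c i) := by
  have := sum_mem (S := subring L) (t := s) (f := fun i ↦ (F i, c i)) h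
  rw [← mem_subring]
  convert this using 1
  ext1 <;> simp [Prod.fst_sum, Prod.snd_sum]

lemma prod {ι : Type*} {s : Finset ι} {F : ι → ℍ → ℂ} {c : ι → PowerSeries ℂ}
    (h : ∀ i ∈ s, HasQ L (F i) (c i)) : HasQ L (∏ i ∈ s, F i) (∏ i ∈ s, c i) := by
  have := prod_mem (S := subring L) (t := s) (f := fun i ↦ (F i, c i)) h
  rw [← mem_subring]
  convert this using 1
  ext1 <;> simp [Prod.fst_prod, Prod.snd_prod]

lemma expand (hL : L ≠ 0) (hF : HasQ 1 F c) : HasQ L F (PowerSeries.expand L hL c) := fun τ ↦ by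
  have hq : qParam (1 : ℕ) τ = qParam L τ ^ L := by
    rw [qParam, qParam, ← Complex.exp_nat_mul]
    congr 1
    have : (L : ℂ) ≠ 0 := by exact_mod_cast hL
    push_cast
    field_simp
  have hinj : Function.Injective (fun m : ℕ ↦ L * m) := fun a b h ↦ Nat.eq_of_mul_eq_mul_left
    (Nat.pos_of_ne_zero hL) h
  refine (hinj.hasSum_iff (fun m hm ↦ ?_)).mp ?_
  · rw [PowerSeries.coeff_expand_of_not_dvd, zero_mul]
    rintro ⟨a, rfl⟩
    exact hm ⟨a, rfl⟩
  · convert hF τ using 2 with m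
    simp only [Function.comp_apply]
    rw [PowerSeries.coeff_expand_mul, hq, ← pow_mul]

lemma bounded (hL : L ≠ 0) (hF : HasQ L F c) : IsBoundedAtImInfty F :=
  isBoundedAtImInfty_of_hasSum_qExpansion (h := L) (c := fun m ↦ PowerSeries.coeff m c)
    (by exact_mod_cast Nat.pos_of_ne_zero hL) hF

lemma unique (hL : L ≠ 0) (hF : HasQ L F c) (hF' : HasQ L F d) : c = d := by
  have h := hF.sub hF'
  rw [sub_self] at h
  have h0 : ∀ m, PowerSeries.coeff m (c - d) = 0 := fun m ↦ by
    have := ModularFormClass.qExpansion_coeff_unique (f := (0 : ModularForm 𝒮ℒ 0)) (h := (L : ℝ))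
      (c := fun m ↦ PowerSeries.coeff m (c - d)) (by exact_mod_cast Nat.pos_of_ne_zero hL)
      (by simpa using ⟨(L : ℤ), by simp⟩) h m
    rw [this, FunLike.coe_zero, qExpansion_zero, map_zero]
  ext m
  have := h0 m
  rw [map_sub] at this
  exact sub_eq_zero.mp this

lemma summable_norm {r : ℝ} (hL : L ≠ 0) (hF : HasQ L F c) (hr : 0 < r) :
    Summable fun m ↦ ‖PowerSeries.coeff m c‖ * Real.exp (-2 * Real.pi * r / L) ^ m := by
  have := (hF ⟨r * I, by simpa using hr⟩).summable.norm
  simpa [Function.Periodic.norm_qParam] using this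

lemma deriv_aux (hL : L ≠ 0) (hF : HasQ L F c) (z : ℍ) :
    DifferentiableAt ℂ (F ∘ ofComplex) z ∧
    HasSum (fun m : ℕ ↦ (m : ℂ) * PowerSeries.coeff m c * qParam L z ^ m)
      ((L : ℂ) * Derivative.normalizedDerivOfComplex F z) := by
  have hL0 : (L : ℂ) ≠ 0 := by exact_mod_cast hL
  set r := z.im / 2 with hr
  have hr0 : 0 < r := half_pos z.im_pos
  let U : Set ℂ := {w | r < w.im}
  have hU : IsOpen U := isOpen_lt continuous_const Complex.continuous_im
  have hz : (z : ℂ) ∈ U := by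
    change r < (z : ℂ).im
    have := z.im_pos
    rw [UpperHalfPlane.coe_im, hr]; linarith
  let f : ℕ → ℂ → ℂ := fun m w ↦ PowerSeries.coeff m c * qParam L w ^ m
  have hder : ∀ m w, HasDerivAt (f m)
      (PowerSeries.coeff m c * (qParam L w ^ m * (2 * Real.pi * I / L * m))) w := fun m w ↦ by
    have h1 : HasDerivAt (fun w ↦ cexp (m * (2 * Real.pi * I * w / L)))
        (cexp (m * (2 * Real.pi * I * w / L)) * (m * (2 * Real.pi * I * 1 / L))) w :=
      ((((hasDerivAt_id w).const_mul (2 * Real.pi * I)).div_const (L : ℂ)).const_mul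
        (m : ℂ)).cexp
    have h2 := h1.const_mul (PowerSeries.coeff m c)
    have e : f m = fun w ↦ PowerSeries.coeff m c * cexp (m * (2 * Real.pi * I * w / L)) := by
      funext w; simp only [f, qParam]; rw [← Complex.exp_nat_mul]; norm_cast
    rw [e, qParam, ← Complex.exp_nat_mul]
    refine h2.congr_deriv ?_
    push_cast
    ring
  have hle : ∀ (m : ℕ) (w : ℂ), w ∈ U → ‖f m w‖ ≤
      ‖PowerSeries.coeff m c‖ * Real.exp (-2 * Real.pi * r / L) ^ m := fun m w hw ↦ by
    simp only [f, norm_mul, norm_pow, Function.Periodic.norm_qParam]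
    have hw' : r ≤ w.im := le_of_lt hw
    gcongr ‖_‖ * ?_ ^ m
    apply Real.exp_le_exp.mpr
    have := Real.pi_pos
    gcongr ?_ / _
    nlinarith
  have hdiff : ∀ m, DifferentiableOn ℂ (f m) U := fun m w _ ↦
    (hder m w).differentiableAt.differentiableWithinAt
  have hsum := Complex.hasSum_deriv_of_summable_norm (hF.summable_norm hL hr0) hdiff hU hle hz
  have hdiff' := Complex.differentiableOn_tsum_of_summable_norm (hF.summable_norm hL hr0) hdiff
    hU hle
  have hev : (F ∘ ofComplex) =ᶠ[𝓝 (z : ℂ)] fun w ↦ ∑' m, f m w := by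
    filter_upwards [hU.mem_nhds hz] with w hw
    have hw0 : 0 < w.im := hr0.trans hw
    rw [Function.comp_apply, ofComplex_apply_of_im_pos hw0]
    exact (hF ⟨w, hw0⟩).tsum_eq.symm
  refine ⟨((hdiff' z hz).differentiableAt (hU.mem_nhds hz)).congr_of_eventuallyEq hev, ?_⟩
  rw [← hev.deriv_eq] at hsum
  have h3 := hsum.mul_left ((L : ℂ) * (2 * Real.pi * I)⁻¹)
  rw [Derivative.normalizedDerivOfComplex, ← mul_assoc]
  refine (congrArg (HasSum · _) (funext fun m ↦ ?_)).mpr h3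
  rw [(hder m z).deriv]
  have : (2 * Real.pi * I : ℂ) ≠ 0 := by simp [Real.pi_ne_zero]
  field_simp

lemma mdiff (hL : L ≠ 0) (hF : HasQ L F c) : MDiff F := fun z ↦
  UpperHalfPlane.mdifferentiableAt_iff.mpr (hF.deriv_aux hL z).1

lemma deriv (hF : HasQ 1 F c) : HasQ 1 (Derivative.normalizedDerivOfComplex F) (theta c) := fun z ↦ by
  simpa [coeff_theta] using (hF.deriv_aux one_ne_zero z).2

end HasQ

/-- Invariance under the weight `w` action of the full modular group. -/
def IsForm (w : ℤ) (F : ℍ → ℂ) : Prop := ∀ γ : SL(2, ℤ), F ∣[w] γ = F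

lemma IsForm.exists_modularForm {w : ℤ} {F : ℍ → ℂ} (h : IsForm w F) (hF : MDiff F)
    (hb : IsBoundedAtImInfty F) : ∃ Φ : ModularForm 𝒮ℒ w, ⇑Φ = F :=
  ⟨{ toFun := F
     slash_action_eq' := fun _ ⟨γ, hγ⟩ ↦ hγ ▸ h γ
     holo' := hF
     bdd_at_cusps' := fun {c} hc ↦ by
      rw [Subgroup.IsArithmetic.isCusp_iff_isCusp_SL2Z] at hc
      rw [OnePoint.isBoundedAt_iff_forall_SL2Z hc]
      intro γ _
      rw [h γ]
      exact hb }, rfl⟩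

lemma hasQ_modularForm {w : ℤ} (Φ : ModularForm 𝒮ℒ w) : HasQ 1 Φ (qExpansion 1 Φ) := fun τ ↦ by
  simpa using ModularForm.hasSum_qExpansion (h := 1) Φ one_pos (by simp) τ

lemma isForm_modularForm {w : ℤ} (Φ : ModularForm 𝒮ℒ w) : IsForm w Φ := fun γ ↦
  SlashInvariantForm.slash_action_eqn _ _ (MonoidHom.mem_range.mpr ⟨γ, rfl⟩)

lemma IsForm.eq_expand {w : ℤ} {F : ℍ → ℂ} {L : ℕ} {c : PowerSeries ℂ} (h : IsForm w F)
    (hL : L ≠ 0) (hc : HasQ L F c) :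
    ∃ Φ : ModularForm 𝒮ℒ w, ⇑Φ = F ∧ c = PowerSeries.expand L hL (qExpansion 1 Φ) := by
  obtain ⟨Φ, rfl⟩ := h.exists_modularForm (hc.mdiff hL) (hc.bounded hL)
  exact ⟨Φ, rfl, hc.unique hL ((hasQ_modularForm Φ).expand hL)⟩

end HalfWeight

namespace HalfWeight

open UpperHalfPlane hiding I
open Function.Periodic (qParam)
open EisensteinSeries (E2 D2)
open ModularForm (E₄ E₆)
open scoped Manifold MatrixGroups ModularForm Derivative Topology

namespace IsForm

variable {w w' : ℤ} {F G : ℍ → ℂ}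

lemma add (hF : IsForm w F) (hG : IsForm w G) : IsForm w (F + G) := fun γ ↦ by
  rw [SlashAction.add_slash, hF γ, hG γ]

lemma const_mul (a : ℂ) (hF : IsForm w F) : IsForm w (fun τ ↦ a * F τ) := fun γ ↦ by
  have := ModularForm.SL_smul_slash w γ F a
  rwa [hF γ] at this

lemma sub (hF : IsForm w F) (hG : IsForm w G) : IsForm w (F - G) := by
  have := hF.add (hG.const_mul (-1))
  convert! this using 1
  ext; simp [sub_eq_add_neg]

lemma mul (hF : IsForm w F) (hG : IsForm w' G) : IsForm (w + w') (F * G) := fun γ ↦ by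
  rw [ModularForm.mul_slash_SL2, hF γ, hG γ]

lemma one : IsForm 0 1 := fun γ ↦ by
  simp [ModularForm.is_invariant_one]

lemma pow (hF : IsForm w F) (n : ℕ) : IsForm (n * w) (F ^ n) := by
  induction n with
  | zero => simpa using one
  | succ n ih =>
    rw [pow_succ]
    have := ih.mul hF
    convert! this using 1
    push_cast; ring

lemma eq_zero_of_coeff_zero (hF : IsForm w F) {c : PowerSeries ℂ} (hc : HasQ 1 F c) (hw : w < 12)
    (h0 : PowerSeries.coeff 0 c = 0) : c = 0 := by
  obtain ⟨Φ, rfl⟩ := hF.exists_modularForm (hc.mdiff one_ne_zero) (hc.bounded one_ne_zero)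
  obtain rfl := hc.unique one_ne_zero (hasQ_modularForm Φ)
  have : Φ = 0 := by
    apply ModularForm.sturm_bound_levelOne
    have h12 : w.toNat / 12 = 0 := by omega
    rw [h12]
    refine lt_of_lt_of_le (b := 1) (by simp) ?_
    exact PowerSeries.nat_le_order _ 1 fun i hi ↦ by
      obtain rfl : i = 0 := by omega
      exact h0
  rw [this, FunLike.coe_zero, qExpansion_zero]

end IsForm

/-- The generating series of the divisor sums `σ_j`. -/
def sigmaSeries (j : ℕ) : PowerSeries ℤ :=
  PowerSeries.mk fun n ↦ (ArithmeticFunction.sigma j n : ℤ)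

def intQ : PowerSeries ℤ := 1 + 240 * sigmaSeries 3
def intR : PowerSeries ℤ := 1 - 504 * sigmaSeries 5
def intP : PowerSeries ℤ := 1 - 24 * sigmaSeries 1

lemma coeff_natCast_mul {R : Type*} [CommRing R] (a n : ℕ) (f : PowerSeries R) :
    PowerSeries.coeff n ((a : PowerSeries R) * f) = a * PowerSeries.coeff n f := by
  rw [← nsmul_eq_mul, map_nsmul, nsmul_eq_mul]

lemma coeff_intQ (n : ℕ) : PowerSeries.coeff n intQ =
    if n = 0 then 1 else 240 * (ArithmeticFunction.sigma 3 n : ℤ) := by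
  have := coeff_natCast_mul 240 n (sigmaSeries 3)
  rw [intQ, map_add, PowerSeries.coeff_one]
  push_cast at this
  rw [this]
  split_ifs with h <;> simp [h, sigmaSeries]

lemma coeff_intR (n : ℕ) : PowerSeries.coeff n intR =
    if n = 0 then 1 else -504 * (ArithmeticFunction.sigma 5 n : ℤ) := by
  have := coeff_natCast_mul 504 n (sigmaSeries 5)
  rw [intR, map_sub, PowerSeries.coeff_one]
  push_cast at this
  rw [this]
  split_ifs with h <;> simp [h, sigmaSeries]

lemma coeff_intP (n : ℕ) : PowerSeries.coeff n intP =
    if n = 0 then 1 else -24 * (ArithmeticFunction.sigma 1 n : ℤ) := by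
  have := coeff_natCast_mul 24 n (sigmaSeries 1)
  rw [intP, map_sub, PowerSeries.coeff_one]
  push_cast at this
  rw [this]
  split_ifs with h <;> simp [h, sigmaSeries]

lemma hasQ_E4 : HasQ 1 E₄ (intQ.map (Int.castRingHom ℂ)) := by
  convert! hasQ_modularForm E₄
  ext n
  rw [EisensteinSeries.E_qExpansion_coeff _ ⟨2, rfl⟩, PowerSeries.coeff_map, coeff_intQ]
  split_ifs
  · simp
  · norm_num [show bernoulli 4 = -1 / 30 by decide +kernel]

lemma hasQ_E6 : HasQ 1 E₆ (intR.map (Int.castRingHom ℂ)) := by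
  convert! hasQ_modularForm E₆
  ext n
  rw [EisensteinSeries.E_qExpansion_coeff _ ⟨3, rfl⟩, PowerSeries.coeff_map, coeff_intR]
  split_ifs
  · simp
  · norm_num [show bernoulli 6 = 1 / 42 by decide +kernel]

lemma hasQ_E2 : HasQ 1 E2 (intP.map (Int.castRingHom ℂ)) := fun τ ↦ by
  have h := EisensteinSeries.hasSum_qExpansion_E2 (z := τ)
  refine (congrArg (HasSum · _) (funext fun m ↦ ?_)).mpr h
  rw [PowerSeries.coeff_map, coeff_intP]
  simp only [qParam, smul_eq_mul]
  split_ifs <;> simp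

lemma isForm_serre {w : ℤ} {F : ℍ → ℂ} (hF : IsForm w F) (hd : MDiff F) :
    IsForm (w + 2) (Derivative.serreDerivative w F) := fun γ ↦
  Derivative.serreDerivative_slash_invariant hd (hF γ)

lemma hasQ_serre (w : ℂ) {F : ℍ → ℂ} {c : PowerSeries ℂ} (hF : HasQ 1 F c) :
    HasQ 1 (Derivative.serreDerivative w F)
      (theta c - (w * 12⁻¹) • (intP.map (Int.castRingHom ℂ) * c)) := by
  convert! hF.deriv.sub ((hasQ_E2.mul hF).const_mul (w * 12⁻¹)) using 1
  ext z
  simp [mul_assoc]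


lemma hasDerivAt_D2 (γ : SL(2, ℤ)) (z : ℍ) :
    HasDerivAt (D2 γ ∘ ofComplex)
      (-(2 * Real.pi * I * ((γ 1 0 : ℂ) / denom γ z) ^ 2)) z := by
  have hden : (γ 1 0 : ℂ) * z + γ 1 1 ≠ 0 := by
    have := denom_ne_zero γ z
    rwa [ModularGroup.denom_apply] at this
  have h1 : HasDerivAt (fun w : ℂ ↦ (γ 1 0 : ℂ) * w + γ 1 1) (γ 1 0 : ℂ) z := by
    simpa using ((hasDerivAt_id (z : ℂ)).const_mul (γ 1 0 : ℂ)).add_const (γ 1 1 : ℂ)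
  have h2 := (h1.inv hden).const_mul (2 * Real.pi * I * (γ 1 0 : ℂ))
  refine (h2.congr_of_eventuallyEq ?_).congr_deriv ?_
  · filter_upwards [isOpen_upperHalfPlaneSet.mem_nhds z.im_pos] with w hw
    rw [Function.comp_apply, ofComplex_apply_of_im_pos hw, D2, ModularGroup.denom_apply,
      div_eq_mul_inv]
    rfl
  · rw [ModularGroup.denom_apply]
    field_simp

lemma slash_D_E2 (γ : SL(2, ℤ)) (z : ℍ) :
    (Derivative.normalizedDerivOfComplex E2 ∣[(4 : ℤ)] γ) z =
      Derivative.normalizedDerivOfComplex E2 z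
        - I / Real.pi * ((γ 1 0 : ℂ) / denom γ z) * E2 z
        - 3 / Real.pi ^ 2 * ((γ 1 0 : ℂ) / denom γ z) ^ 2 := by
  have hE2 : MDiff E2 := hasQ_E2.mdiff one_ne_zero
  have h1 := congrFun (Derivative.normalizedDerivOfComplex_SL_slash (k := 2) hE2 (γ := γ)) z
  have hD2 : MDiff (D2 γ) := fun z ↦
    UpperHalfPlane.mdifferentiableAt_iff.mpr (hasDerivAt_D2 γ z).differentiableAt
  have hD : Derivative.normalizedDerivOfComplex (D2 γ) z = -((γ 1 0 : ℂ) / denom γ z) ^ 2 := by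
    rw [Derivative.normalizedDerivOfComplex, (hasDerivAt_D2 γ z).deriv]
    have : (2 * Real.pi * I : ℂ) ≠ 0 := by simp [Real.pi_ne_zero]
    field_simp
  rw [EisensteinSeries.E2_slash_action γ, Derivative.normalizedDerivOfComplex_sub _ _ hE2
    (hD2.const_smul _), Derivative.normalizedDerivOfComplex_smul _ _ hD2] at h1
  simp only [Pi.sub_apply, Pi.smul_apply, smul_eq_mul, hD, riemannZeta_two, D2] at h1
  rw [show (4 : ℤ) = 2 + 2 from rfl]
  have hpi : (Real.pi : ℂ) ≠ 0 := by simp [Real.pi_ne_zero]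
  have hden : denom γ z ≠ 0 := denom_ne_zero _ z
  rw [eq_sub_iff_add_eq] at h1
  rw [← h1]
  push_cast
  field_simp
  ring_nf
  simp [Complex.I_sq]

lemma isForm_E2 : IsForm 4 (Derivative.normalizedDerivOfComplex E2 - (12⁻¹ : ℂ) • (E2 * E2)) := by
  intro γ
  have h2 := EisensteinSeries.E2_slash_action γ
  rw [sub_eq_add_neg, SlashAction.add_slash, SlashAction.neg_slash, ModularForm.SL_smul_slash,
    show (4 : ℤ) = 2 + 2 from rfl, ModularForm.mul_slash_SL2, h2]
  ext z
  have h1 := slash_D_E2 γ z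
  rw [show (4 : ℤ) = 2 + 2 from rfl] at h1
  simp only [Pi.add_apply, h1, Pi.neg_apply, Pi.smul_apply, Pi.mul_apply, Pi.sub_apply,
    smul_eq_mul, riemannZeta_two, D2]
  have hpi : (Real.pi : ℂ) ≠ 0 := by simp [Real.pi_ne_zero]
  have hden : denom γ z ≠ 0 := denom_ne_zero _ z
  field_simp
  ring_nf
  simp [Complex.I_sq]

end HalfWeight

namespace HalfWeight

open UpperHalfPlane hiding I
open EisensteinSeries (E2 D2)
open ModularForm (E₄ E₆)
open scoped Manifold MatrixGroups ModularForm Derivative Topology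

/-- Reduction of an integral power series. -/
abbrev toField (k : Type*) [Field k] (f : PowerSeries ℤ) : PowerSeries k :=
  f.map (Int.castRingHom k)

lemma coeff_zero_toField_intP (k : Type*) [Field k] :
    PowerSeries.constantCoeff (toField k intP) = 1 := by
  rw [← PowerSeries.coeff_zero_eq_constantCoeff_apply, PowerSeries.coeff_map, coeff_intP]; simp

lemma coeff_zero_toField_intQ (k : Type*) [Field k] :
    PowerSeries.constantCoeff (toField k intQ) = 1 := by
  rw [← PowerSeries.coeff_zero_eq_constantCoeff_apply, PowerSeries.coeff_map, coeff_intQ]; simp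

lemma coeff_zero_toField_intR (k : Type*) [Field k] :
    PowerSeries.constantCoeff (toField k intR) = 1 := by
  rw [← PowerSeries.coeff_zero_eq_constantCoeff_apply, PowerSeries.coeff_map, coeff_intR]; simp

lemma constantCoeff_theta {k : Type*} [Field k] (f : PowerSeries k) :
    PowerSeries.constantCoeff (theta f) = 0 := by
  rw [← PowerSeries.coeff_zero_eq_constantCoeff_apply, coeff_theta]; simp

lemma theta_Q_complex :
    3 * theta (toField ℂ intQ) = toField ℂ intP * toField ℂ intQ - toField ℂ intR := by
  have hf := ((isForm_serre (isForm_modularForm E₄) (hasQ_E4.mdiff one_ne_zero)).const_mul 3).add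
    (isForm_modularForm E₆)
  have hq := ((hasQ_serre (4 : ℤ) hasQ_E4).const_mul 3).add hasQ_E6
  have h := hf.eq_zero_of_coeff_zero hq (by norm_num) ?_
  · simp only [PowerSeries.smul_eq_C_mul, map_mul, map_ofNat] at h
    have h4 : (PowerSeries.C ((4 : ℤ) : ℂ) : PowerSeries ℂ) = 4 := by rw [Int.cast_ofNat, map_ofNat]
    have h12 : (PowerSeries.C (12 : ℂ)⁻¹ : PowerSeries ℂ) * 12 = 1 := by
      rw [← map_ofNat (PowerSeries.C (R := ℂ)) 12, ← map_mul]; simp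
    rw [h4] at h
    linear_combination h + (toField ℂ intP * toField ℂ intQ) * h12
  · simp [coeff_zero_toField_intP, coeff_zero_toField_intQ, coeff_zero_toField_intR,
      constantCoeff_theta]
    norm_num

lemma theta_R_complex :
    2 * theta (toField ℂ intR) = toField ℂ intP * toField ℂ intR - toField ℂ intQ ^ 2 := by
  have hf := ((isForm_serre (isForm_modularForm E₆) (hasQ_E6.mdiff one_ne_zero)).const_mul 2).add
    ((isForm_modularForm E₄).pow 2)
  have hq := ((hasQ_serre (6 : ℤ) hasQ_E6).const_mul 2).add (hasQ_E4.pow 2)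
  have h := hf.eq_zero_of_coeff_zero hq (by norm_num) ?_
  · simp only [PowerSeries.smul_eq_C_mul, map_mul, map_ofNat] at h
    have h4 : (PowerSeries.C ((6 : ℤ) : ℂ) : PowerSeries ℂ) = 6 := by rw [Int.cast_ofNat, map_ofNat]
    have h12 : (PowerSeries.C (12 : ℂ)⁻¹ : PowerSeries ℂ) * 12 = 1 := by
      rw [← map_ofNat (PowerSeries.C (R := ℂ)) 12, ← map_mul]; simp
    rw [h4] at h
    linear_combination h + (toField ℂ intP * toField ℂ intR) * h12
  · simp [coeff_zero_toField_intP, coeff_zero_toField_intQ, coeff_zero_toField_intR,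
      constantCoeff_theta]
    norm_num

lemma theta_P_complex :
    12 * theta (toField ℂ intP) = toField ℂ intP ^ 2 - toField ℂ intQ := by
  have hf := (isForm_E2.const_mul 12).add (isForm_modularForm E₄)
  have hq := ((hasQ_E2.deriv.sub ((hasQ_E2.mul hasQ_E2).const_mul 12⁻¹)).const_mul 12).add hasQ_E4
  have h := IsForm.eq_zero_of_coeff_zero hf hq (by norm_num) ?_
  · simp only [PowerSeries.smul_eq_C_mul, map_ofNat] at h
    have h12 : (PowerSeries.C (12 : ℂ)⁻¹ : PowerSeries ℂ) * 12 = 1 := by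
      rw [← map_ofNat (PowerSeries.C (R := ℂ)) 12, ← map_mul]; simp
    linear_combination h + (toField ℂ intP * toField ℂ intP) * h12
  · simp [coeff_zero_toField_intP, coeff_zero_toField_intQ, coeff_zero_toField_intR,
      constantCoeff_theta]

lemma theta_transfer {a : ℕ} {f g : PowerSeries ℤ}
    (h : (a : PowerSeries ℂ) * theta (toField ℂ f) = toField ℂ g) (k : Type*) [Field k] :
    (a : PowerSeries k) * theta (toField k f) = toField k g := by
  have hz : ∀ n, (a : ℤ) * (n * PowerSeries.coeff n f) = PowerSeries.coeff n g := fun n ↦ by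
    have := congrArg (PowerSeries.coeff n) h
    rw [coeff_natCast_mul, coeff_theta, PowerSeries.coeff_map, PowerSeries.coeff_map] at this
    simp only [eq_intCast] at this
    exact_mod_cast this
  ext n
  rw [coeff_natCast_mul, coeff_theta, PowerSeries.coeff_map, PowerSeries.coeff_map, ← hz]
  simp

/-- The Eisenstein series `E₄`, `E₆`, `E₂` over an arbitrary field. -/
def ramanujan (k : Type*) [Field k] : Ramanujan k where
  Q := toField k intQ
  R := toField k intR
  P := toField k intP
  Q_zero := coeff_zero_toField_intQ k
  R_zero := coeff_zero_toField_intR k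
  Q_one := by rw [PowerSeries.coeff_map, coeff_intQ]; simp
  R_one := by rw [PowerSeries.coeff_map, coeff_intR]; simp
  theta_Q := by
    have := theta_transfer (a := 3) (f := intQ) (g := intP * intQ - intR)
      (by simpa using theta_Q_complex) k
    simpa using this
  theta_R := by
    have := theta_transfer (a := 2) (f := intR) (g := intP * intR - intQ ^ 2)
      (by simpa using theta_R_complex) k
    simpa using this
  theta_P := by
    have := theta_transfer (a := 12) (f := intP) (g := intP ^ 2 - intQ)
      (by simpa using theta_P_complex) k
    simpa using this

end HalfWeight

namespace HalfWeight

open UpperHalfPlane hiding I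
open ModularForm (E₄ E₆)
open scoped Manifold MatrixGroups ModularForm Derivative Topology

variable {O : Subring ℂ}

/-- An integral power series viewed with coefficients in a subring of `ℂ`. -/
abbrev toSubring (O : Subring ℂ) (f : PowerSeries ℤ) : PowerSeries O :=
  f.map (Int.castRingHom O)

lemma map_toSubring {R : Type*} [CommRing R] (ρ : O →+* R) (f : PowerSeries ℤ) :
    (toSubring O f).map ρ = f.map (Int.castRingHom R) := by
  ext n; simp [PowerSeries.coeff_map]

lemma map_subtype_injective {c d : PowerSeries O} (h : c.map O.subtype = d.map O.subtype) :
    c = d := by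
  ext n
  simpa [PowerSeries.coeff_map] using congrArg (PowerSeries.coeff n) h

/-- The discriminant series `(E₄³ - E₆²) / 1728`, divided by its leading monomial. -/
lemma exists_discriminant_unit (h : IsUnit (1728 : O)) :
    ∃ u : (PowerSeries O)ˣ, (1728 : PowerSeries O) * (PowerSeries.X * (u : PowerSeries O)) =
      toSubring O intQ ^ 3 - toSubring O intR ^ 2 := by
  obtain ⟨e, he⟩ := h.exists_right_inv
  have hQ0 : PowerSeries.constantCoeff (toSubring O intQ) = 1 := by
    rw [← PowerSeries.coeff_zero_eq_constantCoeff_apply, PowerSeries.coeff_map, coeff_intQ]; simp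
  have hR0 : PowerSeries.constantCoeff (toSubring O intR) = 1 := by
    rw [← PowerSeries.coeff_zero_eq_constantCoeff_apply, PowerSeries.coeff_map, coeff_intR]; simp
  have hX : (PowerSeries.X : PowerSeries O) ∣ toSubring O intQ ^ 3 - toSubring O intR ^ 2 := by
    rw [PowerSeries.X_dvd_iff]; simp [hQ0, hR0]
  obtain ⟨v, hv⟩ := hX
  have hv0 : PowerSeries.constantCoeff v = 1728 := by
    have h1 := congrArg (PowerSeries.coeff 1) hv
    rw [show (1 : ℕ) = 0 + 1 from rfl, PowerSeries.coeff_succ_X_mul] at h1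
    rw [← PowerSeries.coeff_zero_eq_constantCoeff_apply, ← h1]
    have hQ1 : PowerSeries.coeff 1 (toSubring O intQ) = 240 := by
      rw [PowerSeries.coeff_map, coeff_intQ]; simp
    have hR1 : PowerSeries.coeff 1 (toSubring O intR) = -504 := by
      rw [PowerSeries.coeff_map, coeff_intR]; simp
    generalize toSubring O intQ = q at *
    generalize toSubring O intR = r at *
    simp [PowerSeries.coeff_mul, pow_succ, Finset.Nat.antidiagonal_succ, hQ0, hR0, hQ1, hR1]
    norm_num
  have hC : (PowerSeries.C e : PowerSeries O) * 1728 = 1 := by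
    rw [← map_ofNat (PowerSeries.C (R := O)) 1728, ← map_mul, mul_comm, he, map_one]
  have hu : IsUnit (PowerSeries.C e * v) := by
    rw [PowerSeries.isUnit_iff_constantCoeff]
    simp [hv0, mul_comm e, he]
  refine ⟨hu.unit, ?_⟩
  rw [IsUnit.unit_spec, hv]
  linear_combination (PowerSeries.X * v) * hC

lemma hasQ_discriminant :
    HasQ 1 ModularForm.discriminant
      ((1728 : ℂ)⁻¹ • (toField ℂ intQ ^ 3 - toField ℂ intR ^ 2)) := by
  convert! ((hasQ_E4.pow 3).sub (hasQ_E6.pow 2)).const_mul (1728 : ℂ)⁻¹ using 1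
  ext z
  rw [ModularForm.discriminant_eq_E₄_cube_sub_E₆_sq]
  simp [div_eq_inv_mul]

lemma exists_div_discriminant (h : IsUnit (1728 : O)) {w : ℤ} {F : ℍ → ℂ} {c : PowerSeries O}
    (hF : IsForm w F) (hc : HasQ 1 F (c.map O.subtype)) (h0 : PowerSeries.constantCoeff c = 0) :
    ∃ (G : ℍ → ℂ) (d : PowerSeries O), IsForm (w - 12) G ∧ HasQ 1 G (d.map O.subtype) ∧
      1728 * c = (toSubring O intQ ^ 3 - toSubring O intR ^ 2) * d := by
  obtain ⟨Φ, rfl⟩ := hF.exists_modularForm (hc.mdiff one_ne_zero) (hc.bounded one_ne_zero)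
  have hΦ := hc.unique one_ne_zero (hasQ_modularForm Φ)
  have hcusp : (qExpansion 1 Φ).coeff 0 = 0 := by
    rw [← hΦ, PowerSeries.coeff_map, PowerSeries.coeff_zero_eq_constantCoeff_apply, h0, map_zero]
  have key := ModularForm.qExpansion_eq_qExpansion_discriminant_mul Φ hcusp
  set Ψ := CuspForm.discriminantEquiv (ModularForm.toCuspForm Φ hcusp) with hΨ
  have hD : qExpansion 1 ModularForm.discriminant =
      (1728 : ℂ)⁻¹ • (toField ℂ intQ ^ 3 - toField ℂ intR ^ 2) := by
    have := hasQ_modularForm (CuspForm.discriminant : ModularForm 𝒮ℒ 12)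
    exact this.unique one_ne_zero hasQ_discriminant
  obtain ⟨u, hu⟩ := exists_discriminant_unit h
  obtain ⟨c', rfl⟩ := PowerSeries.X_dvd_iff.mpr h0
  refine ⟨Ψ, (↑u⁻¹ : PowerSeries O) * c', isForm_modularForm Ψ, ?_, ?_⟩
  · convert! hasQ_modularForm Ψ using 1
    have hu' := congrArg (PowerSeries.map O.subtype) hu
    simp only [map_mul, map_sub, map_pow, map_toSubring, map_ofNat, PowerSeries.map_X] at hu'
    have hui : PowerSeries.map O.subtype (u : PowerSeries O) *
        PowerSeries.map O.subtype (↑u⁻¹ : PowerSeries O) = 1 := by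
      rw [← map_mul, Units.mul_inv, map_one]
    rw [← hΦ, hD] at key
    have hC : (PowerSeries.C (1728 : ℂ)⁻¹ : PowerSeries ℂ) * 1728 = 1 := by
      rw [← map_ofNat (PowerSeries.C (R := ℂ)) 1728, ← map_mul, inv_mul_cancel₀ (by norm_num),
        map_one]
    rw [PowerSeries.smul_eq_C_mul, map_mul, PowerSeries.map_X] at key
    change _ = (PowerSeries.C (1728 : ℂ)⁻¹ * (PowerSeries.map (Int.castRingHom ℂ) intQ ^ 3 -
      PowerSeries.map (Int.castRingHom ℂ) intR ^ 2)) * _ at key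
    rw [← hu', ← mul_assoc (PowerSeries.C _), hC, one_mul, mul_assoc] at key
    have key' := mul_left_cancel₀ PowerSeries.X_ne_zero key
    rw [map_mul, key']
    linear_combination (qExpansion 1 Ψ) * hui
  · rw [← hu]
    linear_combination -(1728 * PowerSeries.X * c') * u.mul_inv

lemma exists_two_three (n : ℕ) (hn : n ≠ 1) : ∃ a b : ℕ, 2 * a + 3 * b = n := by
  rcases Nat.even_or_odd' n with ⟨m, rfl | rfl⟩
  · exact ⟨m, 0, by omega⟩
  · exact ⟨m - 1, 1, by omega⟩

lemma IsForm.eq_zero_of_weight_two {F : ℍ → ℂ} {c : PowerSeries ℂ} (hF : IsForm 2 F)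
    (hc : HasQ 1 F c) : c = 0 := by
  obtain ⟨Φ, rfl⟩ := hF.exists_modularForm (hc.mdiff one_ne_zero) (hc.bounded one_ne_zero)
  obtain rfl := hc.unique one_ne_zero (hasQ_modularForm Φ)
  rw [rank_zero_iff_forall_zero.mp ModularForm.levelOne_weight_two_rank_zero Φ, FunLike.coe_zero,
    qExpansion_zero]

/-- The reduction of a form of weight `2 n` is a homogeneous polynomial in `E₄` and `E₆`. -/
theorem exists_isHom_of_isForm {k : Type*} [Field k] (ρ : O →+* k) (h : IsUnit (1728 : O)) (n : ℕ)
    {F : ℍ → ℂ} {c : PowerSeries O} (hF : IsForm (2 * n) F) (hc : HasQ 1 F (c.map O.subtype)) :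
    ∃ A : MvPolynomial (Fin 2) k, IsHom A n ∧ (ramanujan k).ev A = c.map ρ := by
  induction n using Nat.strong_induction_on generalizing F c with
  | _ n ih =>
  by_cases hn : n = 1
  · subst hn
    have : c = 0 := map_subtype_injective (by
      rw [map_zero]; exact IsForm.eq_zero_of_weight_two hF hc)
    exact ⟨0, IsHom.zero _, by rw [this, map_zero, map_zero]⟩
  obtain ⟨a, b, hab⟩ := exists_two_three n hn
  set c0 := PowerSeries.constantCoeff c with hc0
  set M : PowerSeries O := toSubring O intQ ^ a * toSubring O intR ^ b with hM
  have hM0 : PowerSeries.constantCoeff M = 1 := by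
    have hQ0 : PowerSeries.constantCoeff (toSubring O intQ) = 1 := by
      rw [← PowerSeries.coeff_zero_eq_constantCoeff_apply, PowerSeries.coeff_map, coeff_intQ]; simp
    have hR0 : PowerSeries.constantCoeff (toSubring O intR) = 1 := by
      rw [← PowerSeries.coeff_zero_eq_constantCoeff_apply, PowerSeries.coeff_map, coeff_intR]; simp
    simp [hM, hQ0, hR0]
  let G : ℍ → ℂ := F - fun τ ↦ (c0 : ℂ) * (⇑E₄ ^ a * ⇑E₆ ^ b) τ
  set d := c - c0 • M with hd
  have hGf : IsForm (2 * n) G := by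
    refine hF.sub (IsForm.const_mul _ ?_)
    convert! ((isForm_modularForm E₄).pow a).mul ((isForm_modularForm E₆).pow b) using 1
    rw [← hab]; push_cast; ring
  have hGq : HasQ 1 G (d.map O.subtype) := by
    convert! hc.sub (((hasQ_E4.pow a).mul (hasQ_E6.pow b)).const_mul (c0 : ℂ)) using 1
    rw [hd, map_sub, hM, PowerSeries.smul_eq_C_mul, PowerSeries.smul_eq_C_mul]
    simp only [map_mul, map_pow, map_toSubring, PowerSeries.map_C]
    rfl
  have hd0 : PowerSeries.constantCoeff d = 0 := by
    simp [hd, PowerSeries.smul_eq_C_mul, hM0, hc0]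
  have hev : (ramanujan k).ev (ρ c0 • (MvPolynomial.X 0 ^ a * MvPolynomial.X 1 ^ b)) =
      (c0 • M).map ρ := by
    rw [map_smul, map_mul, map_pow, map_pow, Ramanujan.ev_X, Ramanujan.ev_Y,
      PowerSeries.smul_eq_C_mul, PowerSeries.smul_eq_C_mul]
    simp only [hM, map_mul, map_pow, map_toSubring, PowerSeries.map_C]
    rfl
  have hhom : IsHom (ρ c0 • (MvPolynomial.X 0 ^ a * MvPolynomial.X 1 ^ b) :
      MvPolynomial (Fin 2) k) n :=
    (((isHom_X.pow a).mul (isHom_Y.pow b)).smul _).of_eq (by omega)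
  have hcd : c = d + c0 • M := by rw [hd]; ring
  by_cases hn6 : n < 6
  · have : d = 0 := map_subtype_injective (by
      rw [map_zero]
      refine IsForm.eq_zero_of_coeff_zero hGf hGq (by omega) ?_
      rw [PowerSeries.coeff_map, PowerSeries.coeff_zero_eq_constantCoeff_apply, hd0, map_zero])
    exact ⟨_, hhom, by rw [hev, hcd, this, zero_add]⟩
  · obtain ⟨G', e, hG', he, hde⟩ := exists_div_discriminant h hGf hGq hd0
    obtain ⟨A, hA, hAe⟩ := ih (n - 6) (by omega) (F := G') (c := e)
      (by convert! hG' using 1; omega) he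
    obtain ⟨t, ht⟩ := h.exists_right_inv
    have ht' : ρ t * 1728 = 1 := by
      have := congrArg ρ ht
      rw [map_mul, map_one, map_ofNat] at this
      rw [mul_comm, this]
    refine ⟨ρ t • ((MvPolynomial.X 0 ^ 3 - MvPolynomial.X 1 ^ 2) * A) +
      ρ c0 • (MvPolynomial.X 0 ^ a * MvPolynomial.X 1 ^ b), IsHom.add ?_ hhom, ?_⟩
    · exact ((((isHom_X.pow 3).sub (isHom_Y.pow 2)).mul hA).smul _).of_eq (by omega)
    · rw [map_add, hev, map_smul, map_mul, hAe, map_sub, map_pow, map_pow, Ramanujan.ev_X,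
        Ramanujan.ev_Y, hcd, map_add]
      congr 1
      have h2 := congrArg (PowerSeries.map ρ) hde
      simp only [map_mul, map_sub, map_pow, map_toSubring, map_ofNat] at h2
      change ρ t • ((PowerSeries.map (Int.castRingHom k) intQ ^ 3 -
        PowerSeries.map (Int.castRingHom k) intR ^ 2) * _) = _
      rw [← h2, PowerSeries.smul_eq_C_mul, ← mul_assoc,
        ← map_ofNat (PowerSeries.C (R := k)) 1728, ← map_mul, ht', map_one, one_mul]

end HalfWeight

namespace HalfWeight

open UpperHalfPlane hiding I
open scoped Manifold MatrixGroups ModularForm Derivative Topology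

lemma toField_pow_char {k : Type*} [Field k] {p : ℕ} [Fact p.Prime] [CharP k p]
    (f : PowerSeries ℤ) :
    toField k f ^ p = PowerSeries.expand p (Fact.out : p.Prime).ne_zero (toField k f) := by
  rw [← MvPowerSeries.map_frobenius_expand (p := p) (hp := (Fact.out : p.Prime).ne_zero)]
  ext n
  change PowerSeries.coeff n (PowerSeries.map (frobenius k p)
    (PowerSeries.expand p _ (toField k f))) = _
  rw [PowerSeries.coeff_map, PowerSeries.coeff_expand]
  split_ifs
  · rw [PowerSeries.coeff_map]; simp
  · simp

lemma sigma_mul_char {k : Type*} [Field k] {p : ℕ} [Fact p.Prime] [CharP k p] {j : ℕ} (hj : j ≠ 0)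
    (n : ℕ) : (ArithmeticFunction.sigma j (p * n) : k) = ArithmeticFunction.sigma j n := by
  have hp : p.Prime := Fact.out
  have key : ∀ m : ℕ, (ArithmeticFunction.sigma j m : k) =
      ∑ d ∈ m.divisors with ¬ p ∣ d, (d : k) ^ j := fun m ↦ by
    rw [ArithmeticFunction.sigma_apply, Nat.cast_sum, Finset.sum_filter]
    refine Finset.sum_congr rfl fun d _ ↦ ?_
    split_ifs with h
    · simp [(CharP.cast_eq_zero_iff k p d).mpr h, hj]
    · simp
  rw [key, key]
  refine Finset.sum_congr ?_ fun _ _ ↦ rfl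
  ext d
  simp only [Finset.mem_filter, Nat.mem_divisors, mul_ne_zero_iff, hp.ne_zero, ne_eq,
    not_false_eq_true, true_and]
  constructor
  · rintro ⟨⟨h1, h2⟩, h3⟩
    exact ⟨⟨(Nat.Coprime.dvd_mul_left ((Nat.Prime.coprime_iff_not_dvd hp).mpr h3).symm).mp h1, h2⟩,
      h3⟩
  · rintro ⟨⟨h1, h2⟩, h3⟩
    exact ⟨⟨h1.mul_left p, h2⟩, h3⟩

lemma natCast_pow_sub_one {k : Type*} [Field k] {p : ℕ} [Fact p.Prime] [CharP k p] {n : ℕ}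
    (hn : ¬ p ∣ n) : (n : k) ^ (p - 1) = 1 := by
  have h : (n : ZMod p) ≠ 0 := by rwa [Ne, ZMod.natCast_eq_zero_iff]
  simpa using congrArg (ZMod.castHom dvd_rfl k) (ZMod.pow_card_sub_one_eq_one h)

lemma pow_mul_sigma_one {k : Type*} [Field k] {p : ℕ} [Fact p.Prime] [CharP k p] (hp2 : 2 ≤ p)
    {n : ℕ} (hn : ¬ p ∣ n) :
    (n : k) ^ (p - 2) * ArithmeticFunction.sigma 1 n = ArithmeticFunction.sigma (p - 2) n := by
  rw [ArithmeticFunction.sigma_apply, ArithmeticFunction.sigma_apply, Nat.cast_sum, Nat.cast_sum,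
    Finset.mul_sum, ← Nat.sum_div_divisors]
  refine Finset.sum_congr rfl fun d hd ↦ ?_
  obtain ⟨e, rfl⟩ := Nat.dvd_of_mem_divisors hd
  have hn0 : d * e ≠ 0 := fun h ↦ hn (h ▸ dvd_zero p)
  have hd0 : 0 < d := Nat.pos_of_ne_zero (left_ne_zero_of_mul hn0)
  rw [Nat.mul_div_cancel_left _ hd0]
  have h1 := natCast_pow_sub_one (k := k) (fun h ↦ hn (h.mul_left d) : ¬ p ∣ e)
  rw [show p - 1 = p - 2 + 1 by omega, pow_succ] at h1
  push_cast
  rw [mul_pow]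
  linear_combination (d : k) ^ (p - 2) * h1

lemma coeff_iterate_theta {k : Type*} [Field k] (f : PowerSeries k) (j n : ℕ) :
    PowerSeries.coeff n (theta^[j] f) = n ^ j * PowerSeries.coeff n f := by
  induction j with
  | zero => simp
  | succ j ih => rw [Function.iterate_succ_apply', coeff_theta, ih]; ring

lemma artinSchreier_sigma {k : Type*} [Field k] {p : ℕ} [Fact p.Prime] [CharP k p] (hp5 : 5 ≤ p) :
    (-24 : k) • (toField k (sigmaSeries (p - 2)) - toField k (sigmaSeries (p - 2)) ^ p) =
      theta^[p - 2] (toField k intP) := by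
  rw [toField_pow_char]
  ext n
  rw [coeff_iterate_theta, PowerSeries.coeff_smul, map_sub, PowerSeries.coeff_expand,
    PowerSeries.coeff_map, PowerSeries.coeff_map, PowerSeries.coeff_map, coeff_intP]
  by_cases hn : p ∣ n
  · obtain ⟨m, rfl⟩ := hn
    simp [sigmaSeries, sigma_mul_char (k := k) (show p - 2 ≠ 0 by omega),
      Nat.mul_div_cancel_left _ (show 0 < p by omega), show p - 2 ≠ 0 by omega]
  · have hn0 : n ≠ 0 := fun h ↦ hn (h ▸ dvd_zero p)
    rw [if_neg hn, if_neg hn0]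
    simp only [sigmaSeries, PowerSeries.coeff_mk]
    push_cast
    simp only [map_natCast, map_neg, map_mul, map_ofNat, sub_zero, smul_eq_mul,
      ← pow_mul_sigma_one (k := k) (show 2 ≤ p by omega) hn]
    ring

variable {O : Subring ℂ} {k : Type*} [Field k] {p : ℕ}

lemma isUnit_natCast (ρ : O →+* k) [IsLocalHom ρ] [CharP k p] {n : ℕ} (hn : ¬ p ∣ n) :
    IsUnit (n : O) := by
  refine isUnit_of_map_unit ρ _ ?_
  rw [map_natCast, isUnit_iff_ne_zero]
  rwa [Ne, CharP.cast_eq_zero_iff k p]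

lemma exists_mul_bernoulli (ρ : O →+* k) [IsLocalHom ρ] [CharP k p] (hp : p.Prime) (hp5 : 5 ≤ p) :
    ∃ y : O, (y : ℂ) = p * bernoulli (p - 1) ∧ ρ y = -1 := by
  obtain ⟨h, hh⟩ : ∃ h, p = 2 * h + 1 := hp.odd_of_ne_two (by omega)
  obtain ⟨z, hz⟩ := Bernoulli.vonStaudt_clausen h
  set T := {q ∈ Finset.range (2 * h + 2) | q.Prime ∧ (q - 1) ∣ 2 * h} with hT
  have hpT : p ∈ T := by
    simp only [hT, Finset.mem_filter, Finset.mem_range]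
    exact ⟨by omega, hp, by rw [hh]; simp⟩
  have key : ∀ U : Finset ℕ, (∀ q ∈ U, ¬ p ∣ q) → ∃ x : O, (x : ℂ) = ∑ q ∈ U, (1 : ℂ) / q := by
    intro U hU
    have : ∀ q : U, ∃ x : O, (x : ℂ) = 1 / (q : ℕ) := fun q ↦ by
      obtain ⟨e, he⟩ := (isUnit_natCast ρ (hU q q.2)).exists_right_inv
      refine ⟨e, eq_one_div_of_mul_eq_one_right ?_⟩
      exact_mod_cast congrArg (Subtype.val) he
    choose x hx using this
    refine ⟨∑ q, x q, ?_⟩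
    rw [AddSubmonoidClass.coe_finsetSum, ← Finset.sum_coe_sort U fun q ↦ (1 : ℂ) / q]
    exact Finset.sum_congr rfl fun q _ ↦ hx q
  obtain ⟨x, hx⟩ := key (T.erase p) fun q hq hpq ↦ by
    simp only [hT, Finset.mem_erase, Finset.mem_filter] at hq
    exact hq.1 ((Nat.prime_dvd_prime_iff_eq hp hq.2.2.1).mp hpq).symm
  rw [← Finset.add_sum_erase _ _ hpT] at hz
  have hz' := congrArg (Rat.cast (K := ℂ)) hz
  push_cast at hz'
  rw [← hx] at hz'
  have hp0 : (p : ℂ) ≠ 0 := Nat.cast_ne_zero.mpr hp.ne_zero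
  refine ⟨p * (z - x) - 1, ?_, ?_⟩
  · rw [show p - 1 = 2 * h by omega]
    push_cast
    rw [hz']
    field_simp
    ring
  · rw [map_sub, map_mul, map_natCast, CharP.cast_eq_zero, zero_mul, map_one, zero_sub]

/-- The Eisenstein series of weight `p - 1` is `1` plus `p` times a series reducing to a nonzero
multiple of the divisor sum series. -/
lemma exists_eisenstein (ρ : O →+* k) [IsLocalHom ρ] [CharP k p] (hp : p.Prime) (hp5 : 5 ≤ p) :
    ∃ (F : ℍ → ℂ) (α : PowerSeries O), IsForm ((p : ℤ) - 1) F ∧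
      HasQ 1 F ((1 + (p : PowerSeries O) * α).map O.subtype) ∧
      α.map ρ = (-2 : k) • toField k (sigmaSeries (p - 2)) := by
  obtain ⟨y, hy, hρy⟩ := exists_mul_bernoulli ρ hp hp5
  obtain ⟨e, he⟩ := (isUnit_of_map_unit ρ y (by rw [hρy]; simp)).exists_right_inv
  have h3 : 3 ≤ p - 1 := by omega
  have hodd : Even (p - 1) := hp.even_sub_one (by omega)
  refine ⟨ModularForm.E h3, (-2 * ((p : O) - 1) * e) • toSubring O (sigmaSeries (p - 2)), ?_, ?_,
    ?_⟩
  · convert! isForm_modularForm (ModularForm.E h3) using 1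
    omega
  · convert! hasQ_modularForm (ModularForm.E h3)
    ext n
    have hB : (p : ℂ) * bernoulli (p - 1) * e = 1 := by
      rw [← hy]; exact_mod_cast congrArg (Subtype.val) he
    have hB0 : ((bernoulli (p - 1) : ℚ) : ℂ) ≠ 0 := by
      rintro h
      rw [h] at hB; simp at hB
    rw [EisensteinSeries.E_qExpansion_coeff _ hodd, PowerSeries.coeff_map, map_add,
      PowerSeries.coeff_one, coeff_natCast_mul, PowerSeries.coeff_smul, PowerSeries.coeff_map]
    split_ifs with hn
    · simp [hn, sigmaSeries]
    · simp only [sigmaSeries, PowerSeries.coeff_mk, smul_eq_mul, zero_add]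
      rw [show p - 1 - 1 = p - 2 by omega]
      push_cast [show 1 ≤ p by omega]
      simp only [Subring.subtype_apply, Subring.coe_mul, map_natCast]
      push_cast
      have h2 : ((2 : O) : ℂ) = 2 := rfl
      simp only [h2, Int.cast_natCast, SubringClass.coe_natCast]
      field_simp
      linear_combination -((p : ℂ) - 1) * hB
  · have hρe : ρ e = -1 := by
      have := congrArg ρ he
      rw [map_mul, hρy, map_one] at this
      linear_combination -this
    ext n
    simp [PowerSeries.coeff_map, PowerSeries.coeff_smul, hρe, map_ofNat ρ 2]

end HalfWeight

namespace HalfWeight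

open UpperHalfPlane hiding I
open scoped Manifold MatrixGroups ModularForm Derivative Topology

section MixedEsymm

variable {V R : Type*} [Fintype V] [DecidableEq V] [CommRing R]

/-- The part of bidegree `(j - i, i)` of the elementary symmetric function of degree `j` in `x`
and `y`. -/
def mixedEsymm (x y : V → R) (j i : ℕ) : R :=
  ∑ S ∈ Finset.powersetCard j Finset.univ, ∑ S' ∈ Finset.powersetCard i S,
    (∏ v ∈ S \ S', x v) * ∏ v ∈ S', y v

lemma mixedEsymm_perm (x y : V → R) (j i : ℕ) (e : Equiv.Perm V) :
    mixedEsymm (fun v ↦ x (e v)) (fun v ↦ y (e v)) j i = mixedEsymm x y j i := by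
  unfold mixedEsymm
  conv_rhs => rw [← Finset.map_univ_equiv e, Finset.powersetCard_map, Finset.sum_map]
  refine Finset.sum_congr rfl fun S _ ↦ ?_
  change _ = ∑ S' ∈ Finset.powersetCard i (S.map e.toEmbedding),
    (∏ v ∈ S.map e.toEmbedding \ S', x v) * ∏ v ∈ S', y v
  rw [Finset.powersetCard_map, Finset.sum_map]
  refine Finset.sum_congr rfl fun S' _ ↦ ?_
  change _ = (∏ v ∈ S.map e.toEmbedding \ S'.map e.toEmbedding, x v) *
    ∏ v ∈ S'.map e.toEmbedding, y v
  rw [← Finset.map_sdiff, Finset.prod_map, Finset.prod_map]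
  rfl

lemma mixedEsymm_mul (a b : R) (x y : V → R) (j i : ℕ) :
    mixedEsymm (fun v ↦ a * x v) (fun v ↦ b * y v) j i =
      a ^ (j - i) * b ^ i * mixedEsymm x y j i := by
  unfold mixedEsymm
  simp only [Finset.mul_sum]
  refine Finset.sum_congr rfl fun S hS ↦ Finset.sum_congr rfl fun S' hS' ↦ ?_
  rw [Finset.mem_powersetCard] at hS hS'
  rw [Finset.prod_mul_distrib, Finset.prod_mul_distrib, Finset.prod_const, Finset.prod_const,
    Finset.card_sdiff_of_subset hS'.1, hS.2, hS'.2]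
  ring

lemma mixedEsymm_self_mul (b : R) (x : V → R) (j i : ℕ) :
    mixedEsymm x (fun v ↦ b * x v) j i = j.choose i * b ^ i * mixedEsymm x x j 0 := by
  have h := mixedEsymm_mul 1 b x x j i
  simp only [one_mul, one_pow] at h
  rw [h]
  unfold mixedEsymm
  simp only [Finset.mul_sum, Finset.powersetCard_zero, Finset.sum_singleton, Finset.sdiff_empty,
    Finset.prod_empty, mul_one]
  refine Finset.sum_congr rfl fun S hS ↦ ?_
  rw [Finset.mem_powersetCard] at hS
  rw [Finset.sum_congr rfl (g := fun _ ↦ b ^ i * ∏ v ∈ S, x v), Finset.sum_const,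
    Finset.card_powersetCard, hS.2, nsmul_eq_mul, mul_assoc]
  intro S' hS'
  rw [Finset.prod_sdiff (Finset.mem_powersetCard.mp hS').1]

lemma mixedEsymm_zero_ne_zero [IsDomain R] [DecidableEq R] (x : V → R) :
    mixedEsymm x x (Finset.card {v | x v ≠ 0}) 0 ≠ 0 := by
  unfold mixedEsymm
  simp only [Finset.powersetCard_zero, Finset.sum_singleton, Finset.sdiff_empty, Finset.prod_empty,
    mul_one]
  rw [Finset.sum_eq_single (Finset.filter (fun v ↦ x v ≠ 0) Finset.univ)]
  · exact Finset.prod_ne_zero_iff.mpr fun v hv ↦ (Finset.mem_filter.mp hv).2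
  · intro S hS hne
    rw [Finset.mem_powersetCard] at hS
    rw [Finset.prod_eq_zero_iff]
    by_contra! hcon
    exact hne (Finset.eq_of_subset_of_card_le (fun v hv ↦ by simp [hcon v hv]) hS.2.ge)
  · intro h
    exact absurd (Finset.mem_powersetCard.mpr ⟨Finset.subset_univ _, rfl⟩) h

lemma map_mixedEsymm {R' : Type*} [CommRing R'] (φ : R →+* R') (x y : V → R) (j i : ℕ) :
    φ (mixedEsymm x y j i) = mixedEsymm (fun v ↦ φ (x v)) (fun v ↦ φ (y v)) j i := by
  simp [mixedEsymm, map_sum, map_prod]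

lemma HasQ.mixedEsymm {L : ℕ} {F G : V → ℍ → ℂ} {c d : V → PowerSeries ℂ}
    (hF : ∀ v, HasQ L (F v) (c v)) (hG : ∀ v, HasQ L (G v) (d v)) (j i : ℕ) :
    HasQ L (HalfWeight.mixedEsymm F G j i) (HalfWeight.mixedEsymm c d j i) :=
  HasQ.sum fun _ _ ↦ HasQ.sum fun _ _ ↦ (HasQ.prod fun v _ ↦ hF v).mul (HasQ.prod fun v _ ↦ hG v)

end MixedEsymm

/-- A family of functions permuted by the weight `w` action of `SL(2, ℤ)`. -/
def IsFamily {V : Type*} (e : SL(2, ℤ) → Equiv.Perm V) (w : ℤ) (F : V → ℍ → ℂ) : Prop :=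
  ∀ (γ : SL(2, ℤ)) v (τ : ℍ), F v (γ • τ) = denom γ τ ^ w * F (e γ v) τ

lemma isForm_iff {w : ℤ} {F : ℍ → ℂ} :
    IsForm w F ↔ ∀ (γ : SL(2, ℤ)) (τ : ℍ), F (γ • τ) = denom γ τ ^ w * F τ := by
  simp only [IsForm, funext_iff]
  refine forall_congr' fun γ ↦ forall_congr' fun τ ↦ ?_
  rw [ModularForm.SL_slash_apply, _root_.zpow_neg, ← div_eq_mul_inv,
    div_eq_iff (zpow_ne_zero _ (denom_ne_zero _ _)), mul_comm]

section Family

variable {V : Type*} [Fintype V] [DecidableEq V] {e : SL(2, ℤ) → Equiv.Perm V} {w w' : ℤ}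
  {F G : V → ℍ → ℂ}

lemma IsFamily.isForm_mixedEsymm (hF : IsFamily e w F) (hG : IsFamily e w' G) {j i : ℕ}
    (hij : i ≤ j) : IsForm ((j - i : ℤ) * w + i * w') (mixedEsymm F G j i) := by
  rw [isForm_iff]
  intro γ τ
  have key : ∀ z : ℍ, mixedEsymm F G j i z = mixedEsymm (fun v ↦ F v z) (fun v ↦ G v z) j i :=
    fun z ↦ map_mixedEsymm (Pi.evalRingHom (fun _ ↦ ℂ) z) F G j i
  have h0 := denom_ne_zero γ τ
  rw [key, key]
  simp only [hF γ _ τ, hG γ _ τ]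
  rw [mixedEsymm_mul, mixedEsymm_perm (fun v ↦ F v τ) (fun v ↦ G v τ), zpow_add₀ h0,
    mul_comm (j - i : ℤ) w, mul_comm (i : ℤ) w', _root_.zpow_mul, _root_.zpow_mul, ← Nat.cast_sub hij,
    zpow_natCast, zpow_natCast]

lemma not_dvd_choose_pow {p t : ℕ} [Fact p.Prime] (ht : ¬ p ∣ t) (s : ℕ) :
    ¬ p ∣ (p ^ s * t).choose (p ^ s) := by
  induction s with
  | zero => simpa using ht
  | succ s ih =>
    have hp : 0 < p := (Fact.out : p.Prime).pos
    have := Choose.choose_modEq_choose_mod_mul_choose_div_nat (n := p ^ (s + 1) * t)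
      (k := p ^ (s + 1)) (p := p)
    rw [pow_succ', mul_assoc, Nat.mul_mod_right, Nat.mul_mod_right, Nat.mul_div_cancel_left _ hp,
      Nat.mul_div_cancel_left _ hp, Nat.choose_self, one_mul] at this
    rwa [pow_succ', mul_assoc, this.dvd_iff dvd_rfl]

variable {O : Subring ℂ} {k : Type*} [Field k] {p : ℕ}

lemma isUnit_1728 [Fact p.Prime] [CharP k p] (hp5 : 5 ≤ p) (ρ : O →+* k) [IsLocalHom ρ] :
    IsUnit (1728 : O) := by
  have hp : p.Prime := Fact.out
  refine isUnit_natCast (p := p) (n := 1728) ρ fun h ↦ ?_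
  rw [show 1728 = 2 ^ 6 * 3 ^ 3 by norm_num, hp.dvd_mul] at h
  rcases h with h | h
  · exact absurd (Nat.le_of_dvd (by norm_num) (hp.dvd_of_dvd_pow h)) (by omega)
  · exact absurd (Nat.le_of_dvd (by norm_num) (hp.dvd_of_dvd_pow h)) (by omega)

lemma expand_injective {R : Type*} [CommRing R] {L : ℕ} (hL : L ≠ 0) :
    Function.Injective (PowerSeries.expand (R := R) L hL) := fun a b h ↦ by
  ext n
  simpa [PowerSeries.coeff_expand_mul] using congrArg (PowerSeries.coeff (L * n)) h

lemma exists_isHom_expand (ρ : O →+* k) (h : IsUnit (1728 : O)) {w : ℤ} (hw : Even w) {L : ℕ}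
    (hL : L ≠ 0) {F : ℍ → ℂ} {c : PowerSeries O} (hF : IsForm w F)
    (hc : HasQ L F (c.map O.subtype)) (hc0 : c.map ρ ≠ 0) :
    ∃ (n : ℕ) (A : MvPolynomial (Fin 2) k), w = 2 * n ∧ IsHom A n ∧
      PowerSeries.expand L hL ((ramanujan k).ev A) = c.map ρ := by
  obtain ⟨Φ, rfl, hΦ⟩ := hF.eq_expand hL hc
  have hw0 : 0 ≤ w := by
    by_contra! hneg
    have h0 : (Φ : ℍ → ℂ) = 0 := ModularFormClass.levelOne_neg_weight_eq_zero hneg Φ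
    refine hc0 ?_
    rw [show c = 0 from map_subtype_injective (by rw [hΦ, h0, qExpansion_zero, map_zero, map_zero]),
      map_zero]
  obtain ⟨m, hm⟩ := hw
  lift m to ℕ using by omega
  set d : PowerSeries O := PowerSeries.mk fun n ↦ PowerSeries.coeff (L * n) c
  have hcoeff : ∀ n, O.subtype (PowerSeries.coeff n c) =
      PowerSeries.coeff n (PowerSeries.expand L hL (qExpansion 1 Φ)) := fun n ↦ by
    rw [← PowerSeries.coeff_map, hΦ]
  have hd : d.map O.subtype = qExpansion 1 Φ := by
    ext n
    rw [PowerSeries.coeff_map, PowerSeries.coeff_mk, hcoeff, PowerSeries.coeff_expand_mul]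
  have hcd : c = PowerSeries.expand L hL d := map_subtype_injective (by
    rw [PowerSeries.map_expand, hd, hΦ])
  have hw : w = 2 * m := by omega
  obtain ⟨A, hA, hev⟩ := exists_isHom_of_isForm ρ h m (F := Φ) (c := d) (hw ▸ hF)
    (hd ▸ hasQ_modularForm Φ)
  exact ⟨m, A, hw, hA, by rw [hev, hcd, PowerSeries.map_expand]⟩

/-- Two proportional families yield proportional reductions of level one forms. -/
theorem exists_isHom_of_isFamily (ρ : O →+* k) [IsLocalHom ρ] [CharP k p] [Fact p.Prime]
    (hp5 : 5 ≤ p) (hw : Even w) (hw' : Even w') {L : ℕ} (hL : L ≠ 0) (hF : IsFamily e w F)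
    (hG : IsFamily e w' G) {c d : V → PowerSeries O}
    (hc : ∀ v, HasQ L (F v) ((c v).map O.subtype)) (hd : ∀ v, HasQ L (G v) ((d v).map O.subtype))
    {β : PowerSeries k} (hβ : β ≠ 0)
    (hcd : ∀ v, (d v).map ρ = PowerSeries.expand L hL β * (c v).map ρ)
    {v₀ : V} (hv₀ : (c v₀).map ρ ≠ 0) :
    ∃ (j s n n' : ℕ) (C : k) (A A' : MvPolynomial (Fin 2) k),
      j * w = 2 * n ∧ (j - p ^ s : ℤ) * w + p ^ s * w' = 2 * n' ∧ IsHom A n ∧ IsHom A' n' ∧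
      C ≠ 0 ∧ (ramanujan k).ev A ≠ 0 ∧
      (ramanujan k).ev A' = C • ((ramanujan k).ev A * β ^ p ^ s) := by
  classical
  have hp : p.Prime := Fact.out
  have h1728 : IsUnit (1728 : O) := isUnit_1728 hp5 ρ
  set x : V → PowerSeries k := fun v ↦ (c v).map ρ with hx
  set j := Finset.card {v | x v ≠ 0} with hj
  have hj0 : j ≠ 0 := Finset.card_ne_zero_of_mem (Finset.mem_filter.mpr ⟨Finset.mem_univ v₀, hv₀⟩)
  obtain ⟨s, t, ht, hjt⟩ := Nat.exists_eq_pow_mul_and_not_dvd hj0 p hp.ne_one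
  have hi : p ^ s ≤ j := by
    rw [hjt]; exact Nat.le_mul_of_pos_right _ (Nat.pos_of_ne_zero fun h ↦ ht (h ▸ dvd_zero p))
  have hC : ((j.choose (p ^ s) : ℕ) : k) ≠ 0 := by
    rw [Ne, CharP.cast_eq_zero_iff k p, hjt]; exact not_dvd_choose_pow ht s
  have hβL : PowerSeries.expand L hL β ≠ 0 := fun h ↦
    hβ (expand_injective hL (h.trans (map_zero _).symm))
  have he0 : (mixedEsymm c c j 0).map ρ = mixedEsymm x x j 0 := map_mixedEsymm _ _ _ _ _
  have he0' : mixedEsymm x x j 0 ≠ 0 := mixedEsymm_zero_ne_zero x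
  have he1 : (mixedEsymm c d j (p ^ s)).map ρ =
      (j.choose (p ^ s) : ℕ) * PowerSeries.expand L hL β ^ p ^ s * mixedEsymm x x j 0 := by
    rw [← mixedEsymm_self_mul]
    simp only [hx, ← hcd]
    exact map_mixedEsymm _ _ _ _ _
  have hCC : ((j.choose (p ^ s) : ℕ) : PowerSeries k) = PowerSeries.C (j.choose (p ^ s) : k) := by
    simp
  have hq0 := HasQ.mixedEsymm hc hc j 0
  have hq1 := HasQ.mixedEsymm hc hd j (p ^ s)
  rw [← map_mixedEsymm (PowerSeries.map O.subtype)] at hq0 hq1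
  obtain ⟨n, A, hn, hA, hAe⟩ := exists_isHom_expand ρ h1728
    (((hw.mul_left _).add (hw.mul_left _))) hL
    (hF.isForm_mixedEsymm hF (Nat.zero_le j)) hq0 (he0 ▸ he0')
  obtain ⟨n', A', hn', hA', hAe'⟩ := exists_isHom_expand ρ h1728
    (((hw.mul_left _).add (hw'.mul_left _))) hL
    (hF.isForm_mixedEsymm hG hi) hq1 (by
      rw [he1, hCC]
      refine mul_ne_zero (mul_ne_zero (fun h ↦ hC ?_) (pow_ne_zero _ hβL)) he0'
      simpa using congrArg (PowerSeries.constantCoeff (R := k)) h)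
  refine ⟨j, s, n, n', (j.choose (p ^ s) : ℕ), A, A', ?_, ?_, hA, hA', hC, ?_, ?_⟩
  · rw [← hn]; push_cast; ring
  · rw [← hn']; push_cast; ring
  · rintro h
    rw [h, map_zero, he0] at hAe
    exact he0' hAe.symm
  · refine expand_injective hL ?_
    rw [hAe', PowerSeries.expand_smul, map_mul, map_pow, hAe, he1, he0, hCC,
      PowerSeries.smul_eq_C_mul]
    ring

end Family

end HalfWeight

namespace HalfWeight

open UpperHalfPlane hiding I
open scoped Manifold MatrixGroups ModularForm Derivative Topology

lemma one_add_mul_pow {R : Type*} [CommRing R] {p : ℕ} (hp : Odd p) (a : R) (u e : ℕ) :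
    ∃ δ : R, (1 + (p : R) * a) ^ (p ^ e * u) = 1 + (p : R) ^ (e + 1) * (u * a + p * δ) := by
  induction e with
  | zero =>
    induction u with
    | zero => exact ⟨0, by simp⟩
    | succ u ih =>
      obtain ⟨δ, hδ⟩ := ih
      refine ⟨δ + a * (u * a + p * δ), ?_⟩
      rw [pow_zero, one_mul] at hδ ⊢
      rw [pow_succ, hδ]
      push_cast
      ring
  | succ e ih =>
    obtain ⟨δ, hδ⟩ := ih
    set z := (p : R) ^ e * (u * a + p * δ) with hz
    obtain ⟨κ, hκ⟩ := odd_sq_dvd_geom_sum₂_sub 1 z hp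
    have hg := Commute.geom_sum₂_mul (Commute.one_right (1 + (p : R) * z)) p
    refine ⟨δ + κ * (u * a + p * δ), ?_⟩
    rw [pow_succ', mul_assoc, pow_mul', hδ, pow_succ', mul_assoc, ← hz]
    simp only [one_pow, mul_one] at hκ hg
    linear_combination -hg + (p : R) * z * hκ + (p : R) ^ 2 * (1 + p * κ) * hz

section

variable {V : Type*} [Fintype V] {e : SL(2, ℤ) → Equiv.Perm V} {w w' : ℤ}
  {F G : V → ℍ → ℂ} {O : Subring ℂ} {k : Type*} [Field k] {p : ℕ}

lemma isHasse_of_eisenstein [Fact p.Prime] [CharP k p] (hp5 : 5 ≤ p) (ρ : O →+* k) [IsLocalHom ρ]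
    (h1728 : IsUnit (1728 : O)) {E : ℍ → ℂ} {α : PowerSeries O} (hE : IsForm ((p : ℤ) - 1) E)
    (hq : HasQ 1 E ((1 + (p : PowerSeries O) * α).map O.subtype)) :
    ∃ (h : ℕ) (A : MvPolynomial (Fin 2) k), IsHasse (ramanujan k) p h A := by
  obtain ⟨h, hh⟩ : ∃ h, p = 2 * h + 1 := (Fact.out : p.Prime).odd_of_ne_two (by omega)
  obtain ⟨A, hA, hev⟩ := exists_isHom_of_isForm ρ h1728 h (by convert! hE using 1; omega) hq
  refine ⟨h, A, ⟨Fact.out, hp5, hh.symm, hA, ?_⟩⟩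
  have : CharP (PowerSeries k) p :=
    charP_of_injective_algebraMap (algebraMap k (PowerSeries k)).injective p
  rw [hev, map_add, map_mul, map_one, map_natCast, CharP.cast_eq_zero, zero_mul, add_zero]

/-- Congruent families have weights congruent modulo `p - 1`. -/
lemma sub_one_dvd_of_isFamily [Fact p.Prime] [CharP k p] [IsAlgClosed k] (hp5 : 5 ≤ p)
    (ρ : O →+* k) [IsLocalHom ρ] (hw : Even w) (hw' : Even w') {L : ℕ} (hL : L ≠ 0)
    (hF : IsFamily e w F) (hG : IsFamily e w' G) {c d : V → PowerSeries O}
    (hc : ∀ v, HasQ L (F v) ((c v).map O.subtype)) (hd : ∀ v, HasQ L (G v) ((d v).map O.subtype))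
    (hcd : ∀ v, (d v).map ρ = (c v).map ρ) {v₀ : V} (hv₀ : (c v₀).map ρ ≠ 0) :
    (p : ℤ) - 1 ∣ w' - w := by
  classical
  have hp : p.Prime := Fact.out
  obtain ⟨E, α, hE, hEq, -⟩ := exists_eisenstein ρ hp hp5
  obtain ⟨h, H, hH⟩ := isHasse_of_eisenstein hp5 ρ (isUnit_1728 hp5 ρ) hE hEq
  obtain ⟨j, s, n, n', C, A, A', hn, hn', hA, hA', hC, h0, hev⟩ :=
    exists_isHom_of_isFamily ρ hp5 hw hw' hL hF hG hc hd one_ne_zero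
      (fun v ↦ by rw [map_one, one_mul, hcd]) hv₀
  have hdvd := hH.dvd_of_ev_eq (hA.smul C) hA'
    (by rw [hev, map_smul, one_pow, mul_one]) (by rw [map_smul]; exact smul_ne_zero hC h0)
  have hph : (p : ℤ) - 1 = 2 * h := by have := hH.half; omega
  have h1 : (p : ℤ) - 1 ∣ p ^ s * (w' - w) := by
    rw [hph, show (p : ℤ) ^ s * (w' - w) = 2 * (n' - n) by linear_combination hn' - hn]
    exact mul_dvd_mul_left 2 hdvd
  refine IsCoprime.dvd_of_dvd_mul_left (IsCoprime.pow_right ?_) h1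
  exact ⟨-1, 1, by ring⟩

lemma pow_dvd_of_isFamily [Fact p.Prime] [CharP k p] [IsAlgClosed k] (hp5 : 5 ≤ p)
    (ρ : O →+* k) [IsLocalHom ρ] (hw' : Even w') {L : ℕ} (hL : L ≠ 0)
    (hF : IsFamily e w F) (hG : IsFamily e w' G) {c d : V → PowerSeries O}
    (hc : ∀ v, HasQ L (F v) ((c v).map O.subtype)) (hd : ∀ v, HasQ L (G v) ((d v).map O.subtype))
    {l : ℕ} (hcd : ∀ v, (p : PowerSeries O) ^ l ∣ d v - c v) {v₀ : V} (hv₀ : (c v₀).map ρ ≠ 0)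
    {r : ℕ} (hr : w' = w + (p - 1) * r) : p ^ (l - 1) ∣ r := by
  classical
  have hp : p.Prime := Fact.out
  by_contra hndvd
  have hr0 : r ≠ 0 := fun h ↦ hndvd (h ▸ dvd_zero _)
  obtain ⟨m, u, hu, rfl⟩ := Nat.exists_eq_pow_mul_and_not_dvd hr0 p hp.ne_one
  have hm : m + 2 ≤ l := by
    by_contra! hlt
    exact hndvd ((pow_dvd_pow p (by omega)).mul_right u)
  obtain ⟨E, α, hE, hEq, hα⟩ := exists_eisenstein ρ hp hp5
  obtain ⟨h, H, hH⟩ := isHasse_of_eisenstein hp5 ρ (isUnit_1728 hp5 ρ) hE hEq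
  obtain ⟨δ, hδ⟩ := one_add_mul_pow (hp.odd_of_ne_two (by omega)) α u m
  choose b hb using hcd
  have hcharP : CharP (PowerSeries k) p :=
    charP_of_injective_algebraMap (algebraMap k (PowerSeries k)).injective p
  have hp0 : (p : ℂ) ≠ 0 := Nat.cast_ne_zero.mpr hp.ne_zero
  set r := p ^ m * u
  set ξ : PowerSeries O := PowerSeries.expand L hL (u * α + p * δ) with hξ
  set F' : V → ℍ → ℂ := fun v ↦ F v * E ^ r with hF'
  set c' : V → PowerSeries O := fun v ↦ c v * (1 + (p : PowerSeries O) ^ (m + 1) * ξ) with hc'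
  set d' : V → PowerSeries O := fun v ↦ c v * ξ - (p : PowerSeries O) ^ (l - (m + 1)) * b v with hd'
  have hF'fam : IsFamily e w' F' := fun γ v τ ↦ by
    have h0 := denom_ne_zero γ τ
    simp only [hF', Pi.mul_apply, Pi.pow_apply]
    rw [hF γ v τ, isForm_iff.mp hE γ τ, hr, zpow_add₀ h0, _root_.zpow_mul, zpow_natCast]
    ring
  have hc'q : ∀ v, HasQ L (F' v) ((c' v).map O.subtype) := fun v ↦ by
    convert! (hc v).mul ((hEq.pow r).expand hL) using 1
    rw [hc', map_mul, ← map_pow (PowerSeries.map O.subtype), hδ, ← PowerSeries.map_expand]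
    simp [hξ]
  have hrel : ∀ v, c' v - d v = (p : PowerSeries O) ^ (m + 1) * d' v := fun v ↦ by
    have hpl : (p : PowerSeries O) ^ l = p ^ (m + 1) * p ^ (l - (m + 1)) := by
      rw [← pow_add]; congr 1; omega
    have := hb v
    rw [hpl] at this
    simp only [hc', hd']
    linear_combination -this
  set G' : V → ℍ → ℂ := fun v τ ↦ ((p : ℂ) ^ (m + 1))⁻¹ * (F' v - G v) τ with hG'
  have hG'fam : IsFamily e w' G' := fun γ v τ ↦ by
    simp only [hG', Pi.sub_apply]
    rw [hF'fam γ v τ, hG γ v τ]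
    ring
  have hd'q : ∀ v, HasQ L (G' v) ((d' v).map O.subtype) := fun v ↦ by
    convert! ((hc'q v).sub (hd v)).const_mul ((p : ℂ) ^ (m + 1))⁻¹ using 1
    rw [← map_sub, hrel, map_mul, map_pow, map_natCast, PowerSeries.smul_eq_C_mul, ← mul_assoc,
      ← map_natCast (PowerSeries.C (R := ℂ)), ← map_pow, ← map_mul,
      inv_mul_cancel₀ (pow_ne_zero _ hp0), map_one, one_mul]
  set σ := toField k (sigmaSeries (p - 2)) with hσ
  set β : PowerSeries k := (u : PowerSeries k) * ((-2 : PowerSeries k) * σ) with hβdef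
  have hαC : α.map ρ = (-2 : PowerSeries k) * σ := by
    rw [hα, PowerSeries.smul_eq_C_mul, map_neg, map_ofNat]
  have hξβ : ξ.map ρ = PowerSeries.expand L hL β := by
    rw [hξ, PowerSeries.map_expand, map_add, map_mul, map_mul, map_natCast, map_natCast,
      CharP.cast_eq_zero (PowerSeries k) p, zero_mul, add_zero, hαC]
  have hcmap : ∀ v, (c' v).map ρ = (c v).map ρ := fun v ↦ by
    simp [hc']
  have hdmap : ∀ v, (d' v).map ρ = PowerSeries.expand L hL β * (c' v).map ρ := fun v ↦ by
    rw [hcmap, hd', map_sub, map_mul, map_mul, map_pow, map_natCast, CharP.cast_eq_zero,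
      zero_pow (by omega), zero_mul, sub_zero, hξβ, mul_comm]
  have huk : (u : k) ≠ 0 := by rwa [Ne, CharP.cast_eq_zero_iff k p]
  have h12 : (12 : k) ≠ 0 := by
    have : ¬ p ∣ 12 := fun h ↦ by
      rw [show 12 = 2 ^ 2 * 3 by norm_num, hp.dvd_mul] at h
      rcases h with h | h
      · exact absurd (Nat.le_of_dvd (by norm_num) (hp.dvd_of_dvd_pow h)) (by omega)
      · exact absurd (Nat.le_of_dvd (by norm_num) h) (by omega)
    have := (CharP.cast_eq_zero_iff k p 12).not.mpr this
    exact_mod_cast this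
  have hcast : ∀ z : ℤ, (z : PowerSeries k) ^ p = z := fun z ↦ by
    rw [← map_intCast (ZMod.castHom dvd_rfl (PowerSeries k) : ZMod p →+* PowerSeries k) z,
      ← map_pow, ZMod.pow_card]
  have hβ : β - β ^ p = ((u : k) / 12) • theta^[p - 2] (ramanujan k).P := by
    have h2 := hcast (-2)
    have h3 := hcast u
    push_cast at h2 h3
    rw [show (ramanujan k).P = toField k intP from rfl, ← artinSchreier_sigma hp5, hβdef, mul_pow,
      mul_pow, h2, h3, smul_smul, PowerSeries.smul_eq_C_mul,
      show (u : k) / 12 * -24 = u * -2 by field_simp; norm_num, map_mul, map_natCast, map_neg,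
      map_ofNat]
    ring
  have hβ0 : β ≠ 0 := fun h ↦ by
    have h1 := congrArg (PowerSeries.coeff 1) hβ
    rw [h, zero_pow hp.ne_zero, PowerSeries.coeff_smul, coeff_iterate_theta,
      show (ramanujan k).P = toField k intP from rfl, PowerSeries.coeff_map, coeff_intP] at h1
    simp only [sub_zero, map_zero, Nat.cast_one, one_pow, one_ne_zero, if_false,
      ArithmeticFunction.sigma_one, smul_eq_mul, map_mul, map_neg, map_ofNat, one_mul,
      mul_one] at h1
    have : (u : k) * 2 = 0 := by
      field_simp at h1
      exact (mul_eq_zero.mp (show (u : k) * 2 * 12 = 0 by linear_combination h1)).resolve_right h12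
    have h2 : (2 : k) ≠ 0 := fun h2 ↦ h12 (by linear_combination 6 * h2)
    exact mul_ne_zero huk h2 this
  obtain ⟨j, s, n, n', C, A, A', hn, hn', hA, hA', hC, h0, hev⟩ :=
    exists_isHom_of_isFamily ρ hp5 hw' hw' hL hF'fam hG'fam hc'q hd'q hβ0 hdmap
      (v₀ := v₀) (by rwa [hcmap])
  have hnn : n' = n := by
    have : (2 : ℤ) * n' = 2 * n := by rw [← hn, ← hn']; ring
    omega
  refine hH.ev_ne_mul_pow (div_ne_zero huk h12) hβ s (hA.smul C) (hnn ▸ hA')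
    (by rw [map_smul]; exact smul_ne_zero hC h0) ?_
  rw [hev, map_smul, smul_mul_assoc]

/-- Families congruent modulo `p ^ l` have weights congruent modulo `(p - 1) p ^ (l - 1)`. -/
theorem dvd_of_isFamily [Fact p.Prime] [CharP k p] [IsAlgClosed k] (hp5 : 5 ≤ p)
    (ρ : O →+* k) [IsLocalHom ρ] (hw : Even w) (hw' : Even w') {L : ℕ} (hL : L ≠ 0)
    (hF : IsFamily e w F) (hG : IsFamily e w' G) {c d : V → PowerSeries O}
    (hc : ∀ v, HasQ L (F v) ((c v).map O.subtype)) (hd : ∀ v, HasQ L (G v) ((d v).map O.subtype))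
    {l : ℕ} (hl : 1 ≤ l) (hcd : ∀ v, (p : PowerSeries O) ^ l ∣ d v - c v) {v₀ : V}
    (hv₀ : (c v₀).map ρ ≠ 0) : ((p : ℤ) - 1) * p ^ (l - 1) ∣ w - w' := by
  have hp : p.Prime := Fact.out
  have hcharP : CharP (PowerSeries k) p :=
    charP_of_injective_algebraMap (algebraMap k (PowerSeries k)).injective p
  have hmap : ∀ v, (d v).map ρ = (c v).map ρ := fun v ↦ by
    obtain ⟨b, hb⟩ := hcd v
    have := congrArg (PowerSeries.map ρ) hb
    rw [map_sub, map_mul, map_pow, map_natCast, CharP.cast_eq_zero, zero_pow (by omega), zero_mul,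
      sub_eq_zero] at this
    exact this
  obtain ⟨r, hr⟩ := sub_one_dvd_of_isFamily hp5 ρ hw hw' hL hF hG hc hd hmap hv₀
  rw [show w - w' = (p - 1) * -r by linear_combination -hr]
  refine mul_dvd_mul_left _ (dvd_neg.mpr ?_)
  obtain ⟨r, rfl | rfl⟩ := r.eq_nat_or_neg
  · have := pow_dvd_of_isFamily hp5 ρ hw' hL hF hG hc hd hcd hv₀
      (r := r) (by linear_combination hr)
    exact_mod_cast this
  · have := pow_dvd_of_isFamily hp5 ρ hw hL hG hF hd hc
      (fun v ↦ by rw [← dvd_neg, neg_sub]; exact hcd v) (v₀ := v₀) (by rwa [hmap])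
      (r := r) (by linear_combination -hr)
    rw [dvd_neg]
    exact_mod_cast this

end

end HalfWeight

namespace HalfWeight

/-- A place of `ℂ` above `p`, with algebraically closed residue field. -/
theorem exists_place {p : ℕ} (hp : p.Prime) :
    ∃ (O : Subring ℂ) (k : Type) (_ : Field k) (_ : IsAlgClosed k) (_ : CharP k p) (ρ : O →+* k),
      IsLocalHom ρ ∧ ∀ z : ℂ, ∀ n : ℕ, n ≠ 0 → z ^ n = 1 → z ∈ O := by
  have hI : Ideal.span {(p : ℤ)} ≠ ⊤ := by
    rw [Ne, Ideal.span_singleton_eq_top, Int.isUnit_iff]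
    have := hp.two_le
    omega
  let f : ℤ →+* (Int.castRingHom ℂ).range := (Int.castRingHom ℂ).rangeRestrict
  have hf : Function.Bijective f :=
    ⟨fun a b h ↦ by simpa [f] using congrArg Subtype.val h, RingHom.rangeRestrict_surjective _⟩
  let e := RingEquiv.ofBijective f hf
  obtain ⟨B, -, hB⟩ := Ideal.image_subset_nonunits_valuationSubring
    (A := (Int.castRingHom ℂ).range) ((Ideal.span {(p : ℤ)}).map e) (fun h ↦ hI (by
      have := congrArg (Ideal.comap e) h
      rwa [Ideal.comap_map_of_bijective _ e.bijective, Ideal.comap_top] at this))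
  have hpB : (p : ℂ) ∈ B.nonunits := hB ⟨e p, Ideal.mem_map_of_mem _
    (Ideal.mem_span_singleton_self _), by simp [e, f]⟩
  have hpm : (p : B) ∈ IsLocalRing.maximalIdeal B := by
    rw [ValuationSubring.mem_nonunits_iff_exists_mem_maximalIdeal] at hpB
    obtain ⟨h, hh⟩ := hpB
    exact hh
  let k := AlgebraicClosure (IsLocalRing.ResidueField B)
  let ρ : B →+* k := (algebraMap (IsLocalRing.ResidueField B) k).comp (IsLocalRing.residue B)
  have hchar : CharP k p := by
    obtain ⟨q, hq⟩ := CharP.exists k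
    have hdvd : q ∣ p := by
      rw [← CharP.cast_eq_zero_iff k q p, ← map_natCast ρ]
      simp only [ρ, RingHom.comp_apply]
      rw [(IsLocalRing.residue_eq_zero_iff _).mpr hpm, map_zero]
    rcases (Nat.dvd_prime hp).mp hdvd with rfl | rfl
    · exact absurd rfl (CharP.char_ne_one k 1)
    · exact hq
  refine ⟨B.toSubring, k, inferInstance, inferInstance, hchar, ρ, ⟨fun a ha ↦ ?_⟩, ?_⟩
  · have hloc : ∀ a : B, IsUnit (ρ a) → IsUnit a := fun a ha ↦ by
      by_contra hcon
      refine ha.ne_zero ?_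
      simp only [ρ, RingHom.comp_apply]
      rw [(IsLocalRing.residue_eq_zero_iff _).mpr ((IsLocalRing.mem_maximalIdeal _).mpr hcon),
        map_zero]
    exact hloc a ha
  · intro z n hn hz
    rcases B.mem_or_inv_mem z with h | h
    · exact h
    · have hz0 : z ≠ 0 := fun h0 ↦ by simp [h0, hn] at hz
      have : z = z⁻¹ ^ (n - 1) := by
        rw [inv_pow, eq_comm, inv_eq_iff_eq_inv, ← mul_eq_one_iff_eq_inv₀ hz0, ← pow_succ,
          Nat.sub_add_cancel (Nat.one_le_iff_ne_zero.mpr hn), hz]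
      rw [this]
      exact pow_mem h _

lemma mem_of_isPIntegral {p : ℕ} {O : Subring ℂ} {k : Type*} [Field k] [CharP k p] (ρ : O →+* k)
    [IsLocalHom ρ] {z : ℂ} (hz : IsPIntegral p z) : z ∈ O := by
  obtain ⟨a, b, hb, h⟩ := hz
  have hu : IsUnit (b : O) := isUnit_of_map_unit ρ _ (by
    rw [map_intCast, isUnit_iff_ne_zero, Ne, CharP.intCast_eq_zero_iff k p]; exact hb)
  obtain ⟨e, he⟩ := hu.exists_left_inv
  have he' : (e : ℂ) * b = 1 := by exact_mod_cast congrArg Subtype.val he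
  have : z = ((e * a : O) : ℂ) := by
    push_cast
    linear_combination (e : ℂ) * h - z * he'
  rw [this]
  exact (e * a).2

lemma map_ne_zero_of_not_modCongr {p : ℕ} (hp : p.Prime) {O : Subring ℂ} {k : Type*} [Field k]
    [CharP k p] (ρ : O →+* k) {z : O} (hz : IsPIntegral p z) (h0 : ¬ ModCongr p 1 z 0) :
    ρ z ≠ 0 := by
  obtain ⟨a, b, hb, h⟩ := hz
  have ha : ¬ (p : ℤ) ∣ a := by
    rintro ⟨a', rfl⟩
    refine h0 ⟨a', b, hb, ?_⟩
    have hp0 : (p : ℂ) ≠ 0 := Nat.cast_ne_zero.mpr hp.ne_zero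
    push_cast at h
    rw [sub_zero, pow_one, mul_div_assoc', div_eq_iff hp0, h, mul_comm]
  intro hρ
  have h' : (b : O) * z = a := by exact_mod_cast h
  have := congrArg ρ h'
  rw [map_mul, hρ, mul_zero, map_intCast, eq_comm, CharP.intCast_eq_zero_iff k p] at this
  exact ha this

end HalfWeight

namespace HalfWeight

open UpperHalfPlane hiding I
open scoped MatrixGroups

section QuadraticRing

variable {d : ℤ}

/-- The generator `(d + √d) / 2` of the ring of integers. -/
def om (d : ℤ) : ℂ := ((d : ℂ) + sqrtD d) / 2

/-- The element with coordinates `x, y` with respect to the basis `1, om d`. -/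
def el (d x y : ℤ) : ℂ := x + y * om d

lemma el_mem (d x y : ℤ) : el d x y ∈ ringInt d := ⟨x, y, rfl⟩

lemma sqrtD_sq (hd : d < 0) : sqrtD d ^ 2 = d := by
  have h : (0 : ℝ) ≤ -(d : ℝ) := by
    have : (d : ℝ) < 0 := by exact_mod_cast hd
    linarith
  rw [sqrtD, mul_pow, I_sq, ← ofReal_pow, Real.sq_sqrt h]
  push_cast; ring

lemma sqrtD_ne_zero (hd : d < 0) : sqrtD d ≠ 0 := fun h ↦ by
  have := sqrtD_sq hd
  rw [h, zero_pow two_ne_zero] at this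
  exact hd.ne (by exact_mod_cast this.symm)

lemma star_sqrtD (d : ℤ) : star (sqrtD d) = -sqrtD d := by
  simp [sqrtD]

lemma star_om (d : ℤ) : star (om d) = d - om d := by
  simp only [om, star_div₀, star_add, star_sqrtD, star_ofNat, star_intCast]
  ring

lemma om_sub_star (d : ℤ) : om d - star (om d) = sqrtD d := by
  rw [star_om]; simp only [om]; ring

lemma star_el (d x y : ℤ) : star (el d x y) = el d (x + d * y) (-y) := by
  simp only [el, star_add, star_mul', star_intCast, star_om]
  push_cast; ring

lemma exists_om_mul_star (hd : d = -4 ∨ d = -3) : ∃ ν : ℤ, om d * star (om d) = ν := by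
  have hd0 : d < 0 := by omega
  have hsq := sqrtD_sq hd0
  have : om d * star (om d) = ((d : ℂ) ^ 2 - d) / 4 := by
    rw [star_om]; simp only [om]; linear_combination -(1 / 4 : ℂ) * hsq
  rcases hd with rfl | rfl
  · exact ⟨5, by rw [this]; norm_num⟩
  · exact ⟨3, by rw [this]; norm_num⟩

lemma exists_norm_el (hd : d = -4 ∨ d = -3) (x y : ℤ) :
    ∃ n : ℤ, el d x y * star (el d x y) = n := by
  obtain ⟨ν, hν⟩ := exists_om_mul_star hd
  refine ⟨x ^ 2 + d * x * y + ν * y ^ 2, ?_⟩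
  simp only [el, star_add, star_mul', star_intCast]
  rw [star_om] at hν ⊢
  push_cast
  linear_combination (y : ℂ) ^ 2 * hν

lemma exists_trace_el (hd : d = -4 ∨ d = -3) (x y x' y' : ℤ) :
    ∃ n : ℤ, star (el d x y) * el d x' y' + el d x y * star (el d x' y') = n := by
  obtain ⟨ν, hν⟩ := exists_om_mul_star hd
  refine ⟨2 * x * x' + d * (x * y' + x' * y) + 2 * ν * y * y', ?_⟩
  simp only [el, star_add, star_mul', star_intCast]
  rw [star_om] at hν ⊢
  push_cast
  linear_combination 2 * (y : ℂ) * y' * hν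

/-- The trace pairing between the inverse different and the ring of integers. -/
lemma trace_pairing (hd : d < 0) (a b x y : ℤ) :
    star (el d a b / sqrtD d) * el d x y + el d a b / sqrtD d * star (el d x y) = b * x - a * y := by
  have h0 := sqrtD_ne_zero hd
  have h1 := om_sub_star d
  rw [star_div₀, star_sqrtD]
  simp only [el, star_add, star_mul', star_intCast]
  field_simp
  linear_combination (b * x - a * y : ℂ) * h1

end QuadraticRing

section HalfSpace

/-- The point of the Hermitian half-space over `(τ, τ')` attached to the torsion point
`λ τ + μ`. -/
def torsionPoint (lam mu τ τ' : ℂ) : Matrix (Fin 2) (Fin 2) ℂ :=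
  !![τ, lam * τ + mu; star lam * τ + star mu,
    τ' + lam * star lam * τ + (star lam * mu + lam * star mu) / 2]

lemma torsionPoint_mem (lam mu : ℂ) (τ τ' : ℍ) :
    torsionPoint lam mu τ τ' ∈ HermitianUpperHalfSpace := by
  have him : ∀ z : ℂ, (z - star z) / (2 * I) = z.im := fun z ↦ by
    rw [Complex.star_def, Complex.sub_conj]
    field_simp
    push_cast; ring
  have key : (torsionPoint lam mu τ τ' - (torsionPoint lam mu τ τ')ᴴ).map (fun w ↦ w / (2 * I)) =
      (!![1, lam; 0, 1] : Matrix (Fin 2) (Fin 2) ℂ)ᴴ *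
        Matrix.diagonal ![(τ.im : ℂ), (τ'.im : ℂ)] * !![1, lam; 0, 1] := by
    rw [UpperHalfPlane.im, ← him, UpperHalfPlane.im, ← him]
    ext i j
    fin_cases i <;> fin_cases j <;>
      simp [torsionPoint, Matrix.mul_apply, Fin.sum_univ_two, Matrix.diagonal] <;> ring
  change Matrix.PosDef _
  rw [key]
  refine Matrix.PosDef.conjTranspose_mul_mul_same ?_ ?_
  · rw [Matrix.posDef_diagonal_iff]
    intro i
    fin_cases i
    · simpa using τ.im_pos
    · simpa using τ'.im_pos
  · refine Matrix.mulVec_injective_of_isUnit ?_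
    rw [Matrix.isUnit_iff_isUnit_det]
    simp [Matrix.det_fin_two]

end HalfSpace

end HalfWeight

namespace HalfWeight

open UpperHalfPlane hiding I
open scoped MatrixGroups

section Transformations

variable {d k : ℤ}

lemma zero_mem_ringInt (d : ℤ) : (0 : ℂ) ∈ ringInt d := ⟨0, 0, by simp⟩

lemma intCast_mem_ringInt (d a : ℤ) : (a : ℂ) ∈ ringInt d := ⟨a, 0, by simp⟩

lemma one_mem_ringInt (d : ℤ) : (1 : ℂ) ∈ ringInt d := by
  simpa using intCast_mem_ringInt d 1

lemma star_mem_ringInt {z : ℂ} (hz : z ∈ ringInt d) : star z ∈ ringInt d := by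
  obtain ⟨a, b, rfl⟩ := hz
  exact star_el d a b ▸ el_mem d _ _

lemma toFun_eq_of_det_eq_one (f : HermitianModularForm d k)
    {A B C D Z W : Matrix (Fin 2) (Fin 2) ℂ} (hM : fromBlocks A B C D ∈ HermitianModularGroup d)
    (hdet : (fromBlocks A B C D).det = 1) (hZ : Z ∈ HermitianUpperHalfSpace)
    (hCD : (C * Z + D).det ≠ 0) (hW : A * Z + B = W * (C * Z + D)) :
    f.toFun W = (C * Z + D).det ^ k * f.toFun Z := by
  have h := f.transform _ hM Z hZ
  have hact : matAct (fromBlocks A B C D) Z = W := by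
    simp only [matAct, toBlocks_fromBlocks₁₁, toBlocks_fromBlocks₁₂, toBlocks_fromBlocks₂₁,
      toBlocks_fromBlocks₂₂]
    rw [hW, Matrix.mul_nonsing_inv_cancel_right _ _ (isUnit_iff_ne_zero.mpr hCD)]
  have hnu : nuChar d k (fromBlocks A B C D) = 1 := by
    simp [nuChar, hdet]
  rwa [hact, hnu, one_mul, toBlocks_fromBlocks₂₁, toBlocks_fromBlocks₂₂] at h

lemma toFun_torsionPoint_smul (f : HermitianModularForm d k) (γ : SL(2, ℤ)) (lam mu : ℂ)
    (τ τ' : ℍ) :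
    f.toFun (torsionPoint lam mu (γ • τ : ℍ) τ') = denom γ τ ^ k *
      f.toFun (torsionPoint (γ 0 0 * lam + γ 1 0 * mu) (γ 0 1 * lam + γ 1 1 * mu) τ τ') := by
  have hγ : ((γ 0 0 : ℤ) : ℂ) * (γ 1 1 : ℤ) - ((γ 0 1 : ℤ) : ℂ) * (γ 1 0 : ℤ) = 1 := by
    have := γ.det_coe
    rw [Matrix.det_fin_two] at this
    exact_mod_cast this
  have hden : denom γ τ = (γ 1 0 : ℂ) * τ + (γ 1 1 : ℂ) := by
    simp [UpperHalfPlane.denom]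
  have hne : (γ 1 0 : ℂ) * τ + (γ 1 1 : ℂ) ≠ 0 := hden ▸ UpperHalfPlane.denom_ne_zero _ _
  have hw : ((γ • τ : ℍ) : ℂ) * ((γ 1 0 : ℂ) * τ + (γ 1 1 : ℂ)) =
      (γ 0 0 : ℂ) * τ + (γ 0 1 : ℂ) := by
    rw [UpperHalfPlane.specialLinearGroup_apply]
    simp [div_mul_cancel₀ _ hne]
  generalize γ 0 0 = a, γ 0 1 = b, γ 1 0 = c, γ 1 1 = e at *
  generalize ((γ • τ : ℍ) : ℂ) = w at *
  have hw' : (a - w * c) * ((c : ℂ) * τ + e) = 1 := by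
    linear_combination hγ - c * hw
  rw [hden]
  have hCD : ∀ lam mu : ℂ, (!![(c : ℂ), 0; 0, 0] * torsionPoint lam mu τ τ' +
      !![(e : ℂ), 0; 0, 1]).det = c * τ + e := fun lam mu ↦ by
    simp [torsionPoint, Matrix.det_fin_two]
  have hmem : fromBlocks !![(a : ℂ), 0; 0, 1] !![(b : ℂ), 0; 0, 0] !![(c : ℂ), 0; 0, 0]
      !![(e : ℂ), 0; 0, 1] ∈ HermitianModularGroup d := by
    refine ⟨?_, ?_⟩
    · rintro (i | i) (j | j) <;> fin_cases i <;> fin_cases j <;>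
        simp [intCast_mem_ringInt, zero_mem_ringInt, one_mem_ringInt]
    · rw [J2, fromBlocks_conjTranspose, fromBlocks_multiply, fromBlocks_multiply]
      congr 1 <;> ext i j <;> fin_cases i <;> fin_cases j <;> 
        simp [Matrix.mul_apply, Fin.sum_univ_two] <;>
        first | linear_combination hγ | linear_combination -hγ | ring
  have hdet : (fromBlocks !![(a : ℂ), 0; 0, 1] !![(b : ℂ), 0; 0, 0] !![(c : ℂ), 0; 0, 0]
      !![(e : ℂ), 0; 0, 1]).det = 1 := by
    rw [← Matrix.det_reindex_self (finSumFinEquiv (m := 2) (n := 2)), Matrix.reindex_apply,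
      Matrix.det_succ_row_zero]
    simp [Fin.sum_univ_succ, Matrix.det_fin_three, finSumFinEquiv, Fin.addCases, Fin.succAbove]
    linear_combination hγ
  have := toFun_eq_of_det_eq_one f hmem hdet
    (torsionPoint_mem (a * lam + c * mu) (b * lam + e * mu) τ τ') (by rwa [hCD])
    (W := torsionPoint lam mu w τ') ?_
  · rw [this, hCD]
  · ext i j
    fin_cases i <;> fin_cases j <;> simp [torsionPoint, Matrix.mul_apply, Fin.sum_univ_two] <;>
      try simp only [starRingEnd_apply]
    · linear_combination -hw
    · linear_combination -(a - w * c) * lam * hw + (lam * w + mu) * hw'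
    · linear_combination -star lam * hw
    · linear_combination (-((a * star lam + c * star mu) * lam / 2 +
        (a * lam + c * mu) * star lam / 2) + (star lam * w + star mu) * c * lam) * hw +
        ((lam * w + mu) * star lam / 2 + (star lam * w + star mu) * lam / 2) * hw'

lemma mul_mem_ringInt (hd : d = -4 ∨ d = -3) {z w : ℂ} (hz : z ∈ ringInt d)
    (hw : w ∈ ringInt d) : z * w ∈ ringInt d := by
  obtain ⟨x, y, rfl⟩ := hz
  obtain ⟨x', y', rfl⟩ := hw
  obtain ⟨ν, hν⟩ := exists_om_mul_star hd
  refine ⟨x * x' - ν * y * y', x * y' + x' * y + d * y * y', ?_⟩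
  rw [star_om] at hν
  simp only [om] at hν
  push_cast
  linear_combination -(y : ℂ) * y' * hν

lemma add_mem_ringInt {z w : ℂ} (hz : z ∈ ringInt d) (hw : w ∈ ringInt d) : z + w ∈ ringInt d := by
  obtain ⟨x, y, rfl⟩ := hz
  obtain ⟨x', y', rfl⟩ := hw
  exact ⟨x + x', y + y', by push_cast; ring⟩

lemma neg_mem_ringInt {z : ℂ} (hz : z ∈ ringInt d) : -z ∈ ringInt d := by
  obtain ⟨x, y, rfl⟩ := hz
  exact ⟨-x, -y, by push_cast; ring⟩

lemma toFun_torsionPoint_add (hd : d = -4 ∨ d = -3) (f : HermitianModularForm d k) {lam mu lam₀ mu₀ : ℂ} {s : ℤ}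
    (hl : lam₀ ∈ ringInt d) (hm : mu₀ ∈ ringInt d)
    (hs : (s : ℂ) = (star lam * mu₀ + lam * star mu₀) / 2 - (star lam₀ * mu + lam₀ * star mu) / 2
      + (star lam₀ * mu₀ + lam₀ * star mu₀) / 2)
    (τ τ' : ℍ) :
    f.toFun (torsionPoint (lam + lam₀) (mu + mu₀) τ τ') = f.toFun (torsionPoint lam mu τ τ') := by
  have hneg := neg_mem_ringInt hl
  have hmem : fromBlocks !![1, 0; star lam₀, 1] (!![0, mu₀; star mu₀, (s : ℂ)] * !![1, -lam₀; 0, 1])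
      0 !![1, -lam₀; 0, 1] ∈ HermitianModularGroup d := by
    refine ⟨?_, ?_⟩
    · have := star_mem_ringInt hl
      have := star_mem_ringInt hm
      have : -(star mu₀ * lam₀) + s ∈ ringInt d :=
        add_mem_ringInt (neg_mem_ringInt (mul_mem_ringInt hd this hl)) (intCast_mem_ringInt d s)
      rintro (i | i) (j | j) <;> fin_cases i <;> fin_cases j <;>
        simp_all [zero_mem_ringInt, one_mem_ringInt]
    · rw [J2, fromBlocks_conjTranspose, fromBlocks_multiply, fromBlocks_multiply]
      congr 1 <;> ext i j <;> fin_cases i <;> fin_cases j <;>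
        simp [Matrix.mul_apply, Fin.sum_univ_two] <;> ring
  have hdet : (fromBlocks !![1, 0; star lam₀, 1] 
      (!![0, mu₀; star mu₀, (s : ℂ)] * !![1, -lam₀; 0, 1])
      0 !![1, -lam₀; 0, 1]).det = 1 := by
    rw [Matrix.det_fromBlocks_zero₂₁]
    simp [Matrix.det_fin_two]
  have hCD : ((0 : Matrix (Fin 2) (Fin 2) ℂ) * torsionPoint lam mu τ τ' +
      !![1, -lam₀; 0, 1]).det = 1 := by
    simp [Matrix.det_fin_two]
  have := toFun_eq_of_det_eq_one f hmem hdet (torsionPoint_mem lam mu τ τ') (by simp)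
    (W := torsionPoint (lam + lam₀) (mu + mu₀) τ τ') ?_
  · rw [this, hCD, _root_.one_zpow, one_mul]
  · ext i j
    fin_cases i <;> fin_cases j <;> simp [torsionPoint, Matrix.mul_apply, Fin.sum_univ_two] <;>
      try simp only [starRingEnd_apply]
    · ring
    · ring
    · linear_combination hs

end Transformations

end HalfWeight

namespace HalfWeight

open UpperHalfPlane hiding I
open scoped MatrixGroups

section Lattice

variable {d : ℤ}

lemma exists_coordinates (hd : d < 0) {H : Matrix (Fin 2) (Fin 2) ℂ} (hH : H ∈ HermLattice d) :
    ∃ (n m : ℕ) (a b : ℤ), H 0 0 = n ∧ H 1 1 = m ∧ H 0 1 = el d a b / sqrtD d ∧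
      H 1 0 = star (H 0 1) := by
  obtain ⟨⟨hherm, hdiag, hoff⟩, hpos⟩ := hH
  have hnat : ∀ i, ∃ n : ℕ, H i i = n := fun i ↦ by
    obtain ⟨n, hn⟩ := hdiag i
    have h0 : (0 : ℂ) ≤ n := hn ▸ hpos.diag_nonneg
    lift n to ℕ using (by exact_mod_cast h0)
    exact ⟨n, by simpa using hn⟩
  obtain ⟨n, hn⟩ := hnat 0
  obtain ⟨m, hm⟩ := hnat 1
  obtain ⟨a, b, hab⟩ := hoff 0 1
  refine ⟨n, m, a, b, hn, hm, ?_, (hherm.apply 1 0).symm⟩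
  rw [eq_div_iff (sqrtD_ne_zero hd), mul_comm]
  exact hab

/-- The exponent of `e(τ)` in the term attached to `H` at a torsion point. -/
def torsionExponent (lam : ℂ) (H : Matrix (Fin 2) (Fin 2) ℂ) : ℂ :=
  H 0 0 + (star (H 0 1) * lam + H 0 1 * star lam) + H 1 1 * (lam * star lam)

/-- The root of unity in the term attached to `H` at a torsion point. -/
def torsionPhase (lam mu : ℂ) (H : Matrix (Fin 2) (Fin 2) ℂ) : ℂ :=
  exp (2 * Real.pi * I * ((star (H 0 1) * mu + H 0 1 * star mu) +
    H 1 1 * ((star lam * mu + lam * star mu) / 2)))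

lemma trace_mul_torsionPoint {H : Matrix (Fin 2) (Fin 2) ℂ} (hH : H 1 0 = star (H 0 1))
    (lam mu τ τ' : ℂ) : (H * torsionPoint lam mu τ τ').trace = torsionExponent lam H * τ +
      ((star (H 0 1) * mu + H 0 1 * star mu) + H 1 1 * ((star lam * mu + lam * star mu) / 2)) +
      H 1 1 * τ' := by
  simp only [Matrix.trace_fin_two, Matrix.mul_apply, Fin.sum_univ_two, torsionPoint,
    torsionExponent, hH]
  simp
  ring

lemma quadratic_nonneg {H : Matrix (Fin 2) (Fin 2) ℂ} (hH : H.PosSemidef) (z : ℂ) :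
    0 ≤ torsionExponent z H := by
  have h := hH.dotProduct_mulVec_nonneg ![1, star z]
  convert! h using 1
  have : H 1 0 = star (H 0 1) := (hH.1.apply 1 0).symm
  simp [torsionExponent, dotProduct, Matrix.mulVec, Fin.sum_univ_two, this]
  ring

/-- The first torsion parameter of level `N` attached to an integral matrix. -/
def torsionLam (d : ℤ) (N : ℕ) (x : Matrix (Fin 2) (Fin 2) ℤ) : ℂ := el d (x 0 0) (x 1 0) / N

/-- The second torsion parameter of level `N` attached to an integral matrix. -/
def torsionMu (d : ℤ) (N : ℕ) (x : Matrix (Fin 2) (Fin 2) ℤ) : ℂ := el d (x 0 1) (x 1 1) / N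

variable {N : ℕ}

lemma exists_torsionExponent (hd : d = -4 ∨ d = -3) (hN : N ≠ 0) (x : Matrix (Fin 2) (Fin 2) ℤ)
    {H : Matrix (Fin 2) (Fin 2) ℂ} (hH : H ∈ HermLattice d) :
    ∃ j : ℕ, N ^ 2 * torsionExponent (torsionLam d N x) H = j := by
  have hd0 : d < 0 := by omega
  have hN' : (N : ℂ) ≠ 0 := by exact_mod_cast hN
  have h0 := quadratic_nonneg hH.2 (torsionLam d N x)
  obtain ⟨n, m, a, b, hn, hm, ht, -⟩ := exists_coordinates hd0 hH
  obtain ⟨ν, hν⟩ := exists_norm_el hd (x 0 0) (x 1 0)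
  have h1 := trace_pairing hd0 a b (x 0 0) (x 1 0)
  have key : N ^ 2 * torsionExponent (torsionLam d N x) H =
      ((N ^ 2 * n + N * (b * x 0 0 - a * x 1 0) + m * ν : ℤ) : ℂ) := by
    simp only [torsionExponent, torsionLam, hn, hm, ht, star_div₀ (el d (x 0 0) (x 1 0)),
      star_natCast]
    push_cast
    rw [← hν, ← h1]
    field_simp
  have h2 : (0 : ℂ) ≤ ((N ^ 2 * n + N * (b * x 0 0 - a * x 1 0) + m * ν : ℤ) : ℂ) := by
    rw [← key]
    have : (0 : ℂ) ≤ (N : ℂ) ^ 2 := by exact_mod_cast (Nat.zero_le (N ^ 2))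
    exact mul_nonneg this h0
  lift (N ^ 2 * n + N * (b * x 0 0 - a * x 1 0) + m * ν : ℤ) to ℕ using (by exact_mod_cast h2)
    with j hj
  exact ⟨j, by rw [key]; simp⟩

lemma torsionPhase_pow (hd : d = -4 ∨ d = -3) (hN : N ≠ 0) (x : Matrix (Fin 2) (Fin 2) ℤ)
    {H : Matrix (Fin 2) (Fin 2) ℂ} (hH : H ∈ HermLattice d) :
    torsionPhase (torsionLam d N x) (torsionMu d N x) H ^ (2 * N ^ 2) = 1 := by
  have hd0 : d < 0 := by omega
  have hN' : (N : ℂ) ≠ 0 := by exact_mod_cast hN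
  obtain ⟨n, m, a, b, hn, hm, ht, -⟩ := exists_coordinates hd0 hH
  obtain ⟨ν, hν⟩ := exists_trace_el hd (x 0 0) (x 1 0) (x 0 1) (x 1 1)
  have h1 := trace_pairing hd0 a b (x 0 1) (x 1 1)
  rw [torsionPhase, ← Complex.exp_nat_mul, Complex.exp_eq_one_iff]
  refine ⟨2 * N * (b * x 0 1 - a * x 1 1) + m * ν, ?_⟩
  simp only [torsionLam, torsionMu, hm, ht, star_div₀ (el d (x 0 0) (x 1 0)),
    star_div₀ (el d (x 0 1) (x 1 1)), star_natCast]
  push_cast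
  rw [← hν, ← h1]
  field_simp

/-- The pair of exponents `(m, j)` of `e(τ')` and `e(τ / N ^ 2)` in the term attached to `H`. -/
def torsionIndex (N : ℕ) (x : Matrix (Fin 2) (Fin 2) ℤ) (H : HermLattice d) : ℕ × ℕ :=
  (⌊(H.1 1 1).re⌋₊, ⌊(N ^ 2 * torsionExponent (torsionLam d N x) H.1).re⌋₊)

lemma natCast_torsionIndex_fst (hd : d < 0) (x : Matrix (Fin 2) (Fin 2) ℤ) (H : HermLattice d) :
    ((torsionIndex N x H).1 : ℂ) = H.1 1 1 := by
  obtain ⟨n, m, a, b, hn, hm, -⟩ := exists_coordinates hd H.2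
  simp [torsionIndex, hm]

lemma natCast_torsionIndex_snd (hd : d = -4 ∨ d = -3) (hN : N ≠ 0)
    (x : Matrix (Fin 2) (Fin 2) ℤ) (H : HermLattice d) :
    ((torsionIndex N x H).2 : ℂ) = N ^ 2 * torsionExponent (torsionLam d N x) H.1 := by
  obtain ⟨j, hj⟩ := exists_torsionExponent hd hN x H.2
  simp [torsionIndex, hj]

/-- Lattice elements with bounded diagonal entries form a finite set. -/
lemma finite_diag_le (hd : d < 0) (B : ℕ) :
    {H : Matrix (Fin 2) (Fin 2) ℂ | H ∈ HermLattice d ∧ (H 0 0).re ≤ B ∧ (H 1 1).re ≤ B}.Finite := by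
  set R : ℤ := ⌈2 * (B : ℝ) * (1 + ‖om d‖)⌉
  let box := (Finset.range (B + 1) ×ˢ Finset.range (B + 1)) ×ˢ (Finset.Icc (-R) R ×ˢ Finset.Icc (-R) R)
  let φ : (ℕ × ℕ) × (ℤ × ℤ) → Matrix (Fin 2) (Fin 2) ℂ := fun t ↦
    !![(t.1.1 : ℂ), el d t.2.1 t.2.2 / sqrtD d; star (el d t.2.1 t.2.2 / sqrtD d), (t.1.2 : ℂ)]
  refine (box.finite_toSet.image φ).subset ?_
  rintro H ⟨hH, h0, h1⟩
  obtain ⟨n, m, a, b, hn, hm, ht, ht'⟩ := exists_coordinates hd hH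
  have hnB : n ≤ B := by rw [hn] at h0; exact_mod_cast h0
  have hmB : m ≤ B := by rw [hm] at h1; exact_mod_cast h1
  have hdet : ‖H 0 1‖ ≤ B := by
    have h := hH.2.det_nonneg
    rw [Matrix.det_fin_two, hn, hm, ht', Complex.star_def, Complex.mul_conj, Complex.normSq_eq_norm_sq] at h
    have h' : (0 : ℝ) ≤ n * m - ‖H 0 1‖ ^ 2 := by exact_mod_cast h
    have : (n : ℝ) * m ≤ B * B := by exact_mod_cast Nat.mul_le_mul hnB hmB
    exact abs_le_of_sq_le_sq' (by nlinarith) (by positivity) |>.2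
  have habs : ∀ x y : ℤ, |((b * x - a * y : ℤ) : ℝ)| ≤ 2 * B * ‖el d x y‖ := fun x y ↦ by
    have h := trace_pairing hd a b x y
    rw [← ht] at h
    have : ((b * x - a * y : ℤ) : ℂ) = star (H 0 1) * el d x y + H 0 1 * star (el d x y) := by
      rw [h]; push_cast; rfl
    rw [← Complex.norm_intCast, this]
    refine (norm_add_le _ _).trans ?_
    rw [norm_mul, norm_mul, norm_star, norm_star]
    nlinarith [norm_nonneg (el d x y)]
  have hB : (0 : ℝ) ≤ B := by positivity
  have hR : ∀ c : ℤ, |(c : ℝ)| ≤ 2 * B * (1 + ‖om d‖) → c ∈ Finset.Icc (-R) R := fun c hc ↦ by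
    rw [Finset.mem_Icc, ← abs_le]
    have : |(c : ℝ)| ≤ R := hc.trans (Int.le_ceil _)
    exact_mod_cast this
  refine ⟨((n, m), (a, b)), ?_, ?_⟩
  · simp only [box, Finset.coe_product, Set.mem_prod, Finset.mem_coe, Finset.mem_range]
    refine ⟨⟨by omega, by omega⟩, hR a ?_, hR b ?_⟩
    · have := habs 0 1
      simp [el] at this
      nlinarith
    · have := habs 1 0
      simp [el] at this
      nlinarith [norm_nonneg (om d)]
  · ext i j
    fin_cases i <;> fin_cases j <;> simp [φ, hn, hm, ht, ht']

lemma finite_torsionIndex (hd : d = -4 ∨ d = -3) (hN : N ≠ 0) (x : Matrix (Fin 2) (Fin 2) ℤ)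
    (i : ℕ × ℕ) : (torsionIndex N x ⁻¹' {i} : Set (HermLattice d)).Finite := by
  have hd0 : d < 0 := by omega
  obtain ⟨m, j⟩ := i
  set L := ‖torsionLam d N x‖ ^ 2
  refine Set.Finite.of_finite_image (f := Subtype.val) (((finite_diag_le hd0
    (⌈2 * j + 2 * m * L⌉₊ + m)).subset ?_)) Subtype.val_injective.injOn
  rintro _ ⟨H, hH, rfl⟩
  have h1 := natCast_torsionIndex_fst hd0 (N := N) x H
  have h2 := natCast_torsionIndex_snd hd hN x H
  rw [Set.mem_preimage, Set.mem_singleton_iff] at hH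
  rw [hH] at h1 h2
  refine ⟨H.2, ?_, ?_⟩
  · have h3 := quadratic_nonneg H.2.2 (2 * torsionLam d N x)
    have h4 : H.1 0 0 = 2 * torsionExponent (torsionLam d N x) H.1 -
        torsionExponent (2 * torsionLam d N x) H.1 + ((2 * m * L : ℝ) : ℂ) := by
      have hL : ((L : ℝ) : ℂ) = torsionLam d N x * star (torsionLam d N x) := by
        rw [Complex.star_def, Complex.mul_conj, Complex.normSq_eq_norm_sq]
      push_cast
      rw [hL]
      simp only [torsionExponent, star_mul', star_ofNat, ← h1]
      ring
    have h5 : (torsionExponent (torsionLam d N x) H.1).re ≤ j := by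
      have h6 := (Complex.le_def.mp (quadratic_nonneg H.2.2 (torsionLam d N x))).1
      have h7 : (j : ℝ) = (N : ℝ) ^ 2 * (torsionExponent (torsionLam d N x) H.1).re := by
        have := congrArg Complex.re h2
        rw [← Nat.cast_pow, ← Complex.ofReal_natCast (N ^ 2), Complex.re_ofReal_mul] at this
        simpa using this
      have h8 : (1 : ℝ) ≤ (N : ℝ) ^ 2 := by
        exact_mod_cast Nat.one_le_pow _ _ (Nat.pos_of_ne_zero hN)
      rw [h7]
      exact le_mul_of_one_le_left (by simpa using h6) h8
    have h9 := (Complex.le_def.mp h3).1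
    have h10 := congrArg Complex.re h4
    rw [Complex.add_re, Complex.ofReal_re, Complex.sub_re] at h10
    have h11 := Nat.le_ceil (2 * (j : ℝ) + 2 * m * L)
    push_cast
    simp at h9 h10
    have : (0 : ℝ) ≤ m := by positivity
    linarith
  · rw [← h1]
    simp

end Lattice

end HalfWeight

namespace HalfWeight

open UpperHalfPlane hiding I
open scoped MatrixGroups
open Function.Periodic (qParam)

section FourierJacobi

variable {d k : ℤ} {N : ℕ}

/-- The Fourier coefficients of the Fourier–Jacobi coefficients at a torsion point. -/
def jacobiCoeff (d : ℤ) (a : Matrix (Fin 2) (Fin 2) ℂ → ℂ) (N : ℕ)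
    (x : Matrix (Fin 2) (Fin 2) ℤ) (i : ℕ × ℕ) : ℂ :=
  ∑' H : (torsionIndex N x ⁻¹' {i} : Set (HermLattice d)),
    a H.1 * torsionPhase (torsionLam d N x) (torsionMu d N x) H.1

/-- The `m`-th Fourier–Jacobi coefficient at a torsion point. -/
def jacobiFun (f : HermitianModularForm d k) (N : ℕ) (x : Matrix (Fin 2) (Fin 2) ℤ) (m : ℕ)
    (τ : ℍ) : ℂ :=
  ∑' j, jacobiCoeff d f.coeff N x (m, j) * qParam (N ^ 2 : ℕ) τ ^ j

lemma exp_trace_torsionPoint (hd : d = -4 ∨ d = -3) (hN : N ≠ 0) (x : Matrix (Fin 2) (Fin 2) ℤ)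
    (H : HermLattice d) (τ τ' : ℂ) :
    exp (2 * Real.pi * I * (H.1 * torsionPoint (torsionLam d N x) (torsionMu d N x) τ τ').trace) =
      torsionPhase (torsionLam d N x) (torsionMu d N x) H.1 *
        (qParam (N ^ 2 : ℕ) τ ^ (torsionIndex N x H).2 *
          qParam (1 : ℕ) τ' ^ (torsionIndex N x H).1) := by
  have hd0 : d < 0 := by omega
  have hN' : (N : ℂ) ≠ 0 := by exact_mod_cast hN
  obtain ⟨n, m, a, b, hn, hm, ht, ht'⟩ := exists_coordinates hd0 H.2
  have h2 := natCast_torsionIndex_snd hd hN x H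
  rw [trace_mul_torsionPoint ht', torsionPhase, qParam, qParam, ← Complex.exp_nat_mul,
    ← Complex.exp_nat_mul, ← Complex.exp_add, ← Complex.exp_add, natCast_torsionIndex_fst hd0, h2]
  congr 1
  push_cast
  field_simp
  ring

lemma hasSum_jacobiCoeff (hd : d = -4 ∨ d = -3) (hN : N ≠ 0) (f : HermitianModularForm d k)
    (x : Matrix (Fin 2) (Fin 2) ℤ) (τ τ' : ℍ) :
    HasSum (fun i : ℕ × ℕ ↦ jacobiCoeff d f.coeff N x i * (qParam (N ^ 2 : ℕ) τ ^ i.2 *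
      qParam (1 : ℕ) τ' ^ i.1))
      (f.toFun (torsionPoint (torsionLam d N x) (torsionMu d N x) τ τ')) := by
  have h := (f.expansion _ (torsionPoint_mem (torsionLam d N x) (torsionMu d N x) τ τ')).tsum_fiberwise
    (torsionIndex N x)
  convert! h using 1
  funext i
  rw [jacobiCoeff, ← tsum_mul_right]
  refine tsum_congr fun H ↦ ?_
  have hH : torsionIndex N x H.1 = i := H.2
  rw [exp_trace_torsionPoint hd hN, hH, mul_assoc]

lemma hasQ_jacobiFun (hd : d = -4 ∨ d = -3) (hN : N ≠ 0) (f : HermitianModularForm d k)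
    (x : Matrix (Fin 2) (Fin 2) ℤ) (m : ℕ) :
    HasQ (N ^ 2) (jacobiFun f N x m)
      (PowerSeries.mk fun j ↦ jacobiCoeff d f.coeff N x (m, j)) := fun τ ↦ by
  have h := (hasSum_jacobiCoeff hd hN f x τ UpperHalfPlane.I).summable.prod_factor m
  simp only [← mul_assoc] at h
  have hne : qParam (1 : ℕ) (UpperHalfPlane.I : ℍ) ^ m ≠ 0 := pow_ne_zero _ (Complex.exp_ne_zero _)
  have h' := (summable_mul_right_iff hne).mp h
  simpa only [PowerSeries.coeff_mk, jacobiFun] using h'.hasSum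

lemma hasQ_torsionPoint (hd : d = -4 ∨ d = -3) (hN : N ≠ 0) (f : HermitianModularForm d k)
    (x : Matrix (Fin 2) (Fin 2) ℤ) (τ : ℍ) :
    HasQ 1 (fun τ' ↦ f.toFun (torsionPoint (torsionLam d N x) (torsionMu d N x) τ τ'))
      (PowerSeries.mk fun m ↦ jacobiFun f N x m τ) := fun τ' ↦ by
  refine (hasSum_jacobiCoeff hd hN f x τ τ').prod_fiberwise fun m ↦ ?_
  have := (hasQ_jacobiFun hd hN f x m τ).mul_right (qParam (1 : ℕ) τ' ^ m)
  simpa only [PowerSeries.coeff_mk, mul_assoc] using this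

lemma jacobiFun_smul (hd : d = -4 ∨ d = -3) (hN : N ≠ 0) (f : HermitianModularForm d k)
    (x : Matrix (Fin 2) (Fin 2) ℤ) (m : ℕ) (γ : SL(2, ℤ)) (τ : ℍ) :
    jacobiFun f N x m (γ • τ) = denom γ τ ^ k * jacobiFun f N (x * γ.1) m τ := by
  have h1 := hasQ_torsionPoint hd hN f x (γ • τ)
  have h2 := (hasQ_torsionPoint hd hN f (x * γ.1) τ).const_mul (denom γ τ ^ k)
  have hl : torsionLam d N (x * γ.1) = γ 0 0 * torsionLam d N x + γ 1 0 * torsionMu d N x := by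
    simp [torsionLam, torsionMu, el, Matrix.mul_apply, Fin.sum_univ_two]
    ring
  have hm : torsionMu d N (x * γ.1) = γ 0 1 * torsionLam d N x + γ 1 1 * torsionMu d N x := by
    simp [torsionLam, torsionMu, el, Matrix.mul_apply, Fin.sum_univ_two]
    ring
  simp only [toFun_torsionPoint_smul] at h1
  rw [hl, hm] at h2
  have := congrArg (PowerSeries.coeff m) (h1.unique one_ne_zero h2)
  simpa using this

lemma jacobiFun_congr (hd : d = -4 ∨ d = -3) (hN : N ≠ 0) (f : HermitianModularForm d k)
    {x x' : Matrix (Fin 2) (Fin 2) ℤ}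
    (hx : x.map (Int.cast : ℤ → ZMod (2 * N ^ 2)) = x'.map Int.cast) (m : ℕ) :
    jacobiFun f N x m = jacobiFun f N x' m := by
  have hN' : (N : ℂ) ≠ 0 := by exact_mod_cast hN
  have hdvd : ∀ i j, ∃ y : ℤ, x i j = x' i j + 2 * N ^ 2 * y := fun i j ↦ by
    have h := congrFun (congrFun hx i) j
    simp only [Matrix.map_apply] at h
    obtain ⟨y, hy⟩ := (ZMod.intCast_eq_intCast_iff_dvd_sub _ _ _).mp h.symm
    exact ⟨y, by push_cast at hy; linarith⟩
  choose y hy using hdvd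
  have hl : torsionLam d N x = torsionLam d N x' + 2 * N * el d (y 0 0) (y 1 0) := by
    simp only [torsionLam, el, hy]
    push_cast
    field_simp
    ring
  have hm : torsionMu d N x = torsionMu d N x' + 2 * N * el d (y 0 1) (y 1 1) := by
    simp only [torsionMu, el, hy]
    push_cast
    field_simp
    ring
  have hmem : ∀ a b : ℤ, (2 * N * el d a b : ℂ) ∈ ringInt d := fun a b ↦
    ⟨2 * N * a, 2 * N * b, by simp only [el, om]; push_cast; ring⟩
  obtain ⟨n₁, h₁⟩ := exists_trace_el hd (x' 0 0) (x' 1 0) (y 0 1) (y 1 1)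
  obtain ⟨n₂, h₂⟩ := exists_trace_el hd (y 0 0) (y 1 0) (x' 0 1) (x' 1 1)
  obtain ⟨n₃, h₃⟩ := exists_trace_el hd (y 0 0) (y 1 0) (y 0 1) (y 1 1)
  funext τ
  have h1 := hasQ_torsionPoint hd hN f x τ
  have h2 := hasQ_torsionPoint hd hN f x' τ
  rw [hl, hm] at h1
  have key := fun τ' ↦ toFun_torsionPoint_add (lam := torsionLam d N x') (mu := torsionMu d N x') hd f
    (s := n₁ - n₂ + 2 * N ^ 2 * n₃) (hmem (y 0 0) (y 1 0)) (hmem (y 0 1) (y 1 1)) (by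
      push_cast
      rw [← h₁, ← h₂, ← h₃]
      simp only [torsionLam, torsionMu, star_div₀, star_mul', star_natCast, star_ofNat]
      field_simp) τ τ'
  simp only [key] at h1
  have := congrArg (PowerSeries.coeff m) (h1.unique one_ne_zero h2)
  simpa using this

end FourierJacobi

end HalfWeight

namespace HalfWeight

open UpperHalfPlane hiding I
open scoped MatrixGroups
open Function.Periodic (qParam)

section TorsionFamily

variable {d k : ℤ} {N : ℕ}

/-- Right translation by `γ` on matrices modulo `n`. -/
def rightMul (n : ℕ) (γ : SL(2, ℤ)) : Equiv.Perm (Matrix (Fin 2) (Fin 2) (ZMod n)) :=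
  Units.mulRight (Matrix.SpecialLinearGroup.toGL
    (Matrix.SpecialLinearGroup.map (Int.castRingHom (ZMod n)) γ))

/-- An integral representative of a matrix modulo `n`. -/
def liftMat {n : ℕ} (v : Matrix (Fin 2) (Fin 2) (ZMod n)) : Matrix (Fin 2) (Fin 2) ℤ :=
  v.map ZMod.cast

lemma map_liftMat {n : ℕ} (v : Matrix (Fin 2) (Fin 2) (ZMod n)) :
    (liftMat v).map (Int.cast : ℤ → ZMod n) = v := by
  ext i j
  simp [liftMat]

lemma isFamily_jacobiFun (hd : d = -4 ∨ d = -3) (hN : N ≠ 0) (f : HermitianModularForm d k)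
    (m : ℕ) : IsFamily (rightMul (2 * N ^ 2)) k fun v ↦ jacobiFun f N (liftMat v) m := by
  intro γ v τ
  dsimp only
  rw [jacobiFun_smul hd hN, jacobiFun_congr hd hN f (x' := liftMat (rightMul (2 * N ^ 2) γ v))]
  rw [map_liftMat]
  have := Matrix.map_mul (f := Int.castRingHom (ZMod (2 * N ^ 2))) (L := liftMat v) (M := γ.1)
  refine this.trans ?_
  congr 1
  exact map_liftMat v

lemma jacobiCoeff_congr (hd : d = -4 ∨ d = -3) (hN : N ≠ 0) (f : HermitianModularForm d k)
    {x x' : Matrix (Fin 2) (Fin 2) ℤ}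
    (hx : x.map (Int.cast : ℤ → ZMod (2 * N ^ 2)) = x'.map Int.cast) (m j : ℕ) :
    jacobiCoeff d f.coeff N x (m, j) = jacobiCoeff d f.coeff N x' (m, j) := by
  have h := hasQ_jacobiFun hd hN f x m
  rw [jacobiFun_congr hd hN f hx] at h
  simpa using congrArg (PowerSeries.coeff j)
    (h.unique (pow_ne_zero 2 hN) (hasQ_jacobiFun hd hN f x' m))

lemma jacobiCoeff_mem (hd : d = -4 ∨ d = -3) (hN : N ≠ 0) {O : Subring ℂ}
    (hO : ∀ z : ℂ, ∀ n : ℕ, n ≠ 0 → z ^ n = 1 → z ∈ O) {a : Matrix (Fin 2) (Fin 2) ℂ → ℂ}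
    (ha : ∀ H ∈ HermLattice d, a H ∈ O) (x : Matrix (Fin 2) (Fin 2) ℤ) (i : ℕ × ℕ) :
    jacobiCoeff d a N x i ∈ O := by
  have := (finite_torsionIndex hd hN x i).fintype
  rw [jacobiCoeff, tsum_fintype]
  exact Subring.sum_mem _ fun H _ ↦ O.mul_mem (ha _ H.1.2)
    (hO _ (2 * N ^ 2) (by positivity) (torsionPhase_pow hd hN x H.1.2))

lemma jacobiCoeff_sub_smul (hd : d = -4 ∨ d = -3) (hN : N ≠ 0)
    {a b c : Matrix (Fin 2) (Fin 2) ℂ → ℂ} {r : ℂ}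
    (h : ∀ H ∈ HermLattice d, b H - a H = r * c H) (x : Matrix (Fin 2) (Fin 2) ℤ) (i : ℕ × ℕ) :
    jacobiCoeff d b N x i - jacobiCoeff d a N x i = r * jacobiCoeff d c N x i := by
  have := (finite_torsionIndex hd hN x i).fintype
  rw [jacobiCoeff, jacobiCoeff, jacobiCoeff, tsum_fintype, tsum_fintype, tsum_fintype,
    Finset.mul_sum, ← Finset.sum_sub_distrib]
  refine Finset.sum_congr rfl fun H _ ↦ ?_
  rw [← sub_mul, h _ H.1.2, mul_assoc]

end TorsionFamily

section Nonvanishing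

variable {d : ℤ}

lemma sum_exp_eq {N : ℕ} (hN : N ≠ 0) (c : ℤ) :
    ∑ s ∈ Finset.range N, exp (2 * Real.pi * I * (c / N)) ^ s = if (N : ℤ) ∣ c then (N : ℂ) else 0 := by
  have hN' : (N : ℂ) ≠ 0 := by exact_mod_cast hN
  split_ifs with h
  · obtain ⟨e, rfl⟩ := h
    have : exp (2 * Real.pi * I * (((N * e : ℤ) : ℂ) / N)) = 1 :=
      Complex.exp_eq_one_iff.mpr ⟨e, by push_cast; field_simp⟩
    rw [this]
    simp
  · have h1 : exp (2 * Real.pi * I * (c / N)) ≠ 1 := fun h1 ↦ h <| by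
      obtain ⟨e, he⟩ := Complex.exp_eq_one_iff.mp h1
      refine ⟨e, ?_⟩
      have hpi := Complex.two_pi_I_ne_zero
      rw [mul_comm (e : ℂ)] at he
      have := mul_left_cancel₀ hpi he
      rw [div_eq_iff hN'] at this
      rw [mul_comm]
      exact_mod_cast this
    have h2 : exp (2 * Real.pi * I * (c / N)) ^ N = 1 := by
      rw [← Complex.exp_nat_mul, Complex.exp_eq_one_iff]
      exact ⟨c, by field_simp⟩
    have := geom_sum_mul (exp (2 * Real.pi * I * (c / N))) N
    rw [h2, sub_self] at this
    exact (mul_eq_zero.mp this).resolve_right (sub_ne_zero.mpr h1)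

/-- The exponential `e((b s - a t) / N)`. -/
def pairingExp (N : ℕ) (a b : ℤ) (s t : ℕ) : ℂ :=
  exp (2 * Real.pi * I * (b / N)) ^ s * exp (2 * Real.pi * I * ((-a : ℤ) / N)) ^ t

lemma pairingExp_pow {N : ℕ} (hN : N ≠ 0) (a b : ℤ) (s t : ℕ) : pairingExp N a b s t ^ N = 1 := by
  have hN' : (N : ℂ) ≠ 0 := by exact_mod_cast hN
  have h : ∀ c : ℤ, exp (2 * Real.pi * I * (c / N)) ^ N = 1 := fun c ↦ by
    rw [← Complex.exp_nat_mul, Complex.exp_eq_one_iff]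
    exact ⟨c, by field_simp⟩
  rw [pairingExp, mul_pow, pow_right_comm _ s, pow_right_comm _ t, h, h, one_pow, one_pow, one_mul]

lemma pairingExp_mul (N : ℕ) (a b a' b' : ℤ) (s t : ℕ) :
    pairingExp N a b s t * pairingExp N a' b' s t = pairingExp N (a + a') (b + b') s t := by
  simp only [pairingExp]
  rw [mul_mul_mul_comm, ← mul_pow, ← mul_pow, ← Complex.exp_add, ← Complex.exp_add]
  push_cast
  ring_nf

lemma sum_pairingExp {N : ℕ} (hN : N ≠ 0) (a b : ℤ) :
    ∑ s ∈ Finset.range N, ∑ t ∈ Finset.range N, pairingExp N a b s t =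
      if (N : ℤ) ∣ a ∧ (N : ℤ) ∣ b then (N : ℂ) ^ 2 else 0 := by
  simp only [pairingExp]
  rw [← Finset.sum_mul_sum, sum_exp_eq hN, sum_exp_eq hN]
  simp only [dvd_neg]
  split_ifs <;> simp_all [sq]

/-- The semi-positive lattice elements with prescribed diagonal. -/
def diagFiber (d : ℤ) (n m : ℕ) : Set (HermLattice d) := {H | H.1 0 0 = n ∧ H.1 1 1 = m}

lemma finite_diagFiber (hd : d < 0) (n m : ℕ) : (diagFiber d n m).Finite := by
  refine Set.Finite.of_finite_image (f := Subtype.val) (((finite_diag_le hd (n + m)).subset ?_))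
    Subtype.val_injective.injOn
  rintro _ ⟨H, ⟨hn, hm⟩, rfl⟩
  exact ⟨H.2, by simp [hn], by simp [hm]⟩

lemma jacobiCoeff_diag (hd : d = -4 ∨ d = -3) {N : ℕ} (hN : N ≠ 0)
    {A B : HermLattice d → ℤ} (hAB : ∀ H : HermLattice d, H.1 0 1 = el d (A H) (B H) / sqrtD d)
    (a : Matrix (Fin 2) (Fin 2) ℂ → ℂ) (n m s t : ℕ) :
    jacobiCoeff d a N !![0, (s : ℤ); 0, (t : ℤ)] (m, N ^ 2 * n) =
      ∑' H : diagFiber d n m, a H.1 * pairingExp N (A H) (B H) s t := by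
  have hd0 : d < 0 := by omega
  have hN' : (N : ℂ) ≠ 0 := by exact_mod_cast hN
  have hlam : torsionLam d N !![0, (s : ℤ); 0, (t : ℤ)] = 0 := by simp [torsionLam, el]
  have hset : torsionIndex N !![0, (s : ℤ); 0, (t : ℤ)] ⁻¹' {(m, N ^ 2 * n)} = diagFiber d n m := by
    ext H
    have h1 := natCast_torsionIndex_fst hd0 (N := N) !![0, (s : ℤ); 0, (t : ℤ)] H
    have h2 := natCast_torsionIndex_snd hd hN !![0, (s : ℤ); 0, (t : ℤ)] H
    rw [hlam] at h2
    simp only [torsionExponent, star_zero, mul_zero, add_zero] at h2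
    rw [Set.mem_preimage, Set.mem_singleton_iff, Prod.ext_iff, diagFiber, Set.mem_ofPred_eq, ← h1,
      and_comm, Nat.cast_inj, ← Nat.cast_inj (R := ℂ), h2]
    push_cast
    rw [mul_right_inj' (pow_ne_zero 2 hN')]
  rw [jacobiCoeff, hset, hlam]
  refine tsum_congr fun H ↦ ?_
  have h := trace_pairing hd0 (A H) (B H) s t
  rw [← hAB] at h
  congr 1
  rw [torsionPhase, pairingExp, ← Complex.exp_nat_mul, ← Complex.exp_nat_mul, ← Complex.exp_add]
  congr 1
  have hmu : torsionMu d N !![0, (s : ℤ); 0, (t : ℤ)] = el d s t / N := by simp [torsionMu]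
  rw [hmu, star_div₀, star_natCast, ← mul_div_assoc, ← mul_div_assoc, ← add_div, h]
  simp
  ring

lemma sum_jacobiCoeff (hd : d = -4 ∨ d = -3) (a : Matrix (Fin 2) (Fin 2) ℂ → ℂ)
    (H₀ : HermLattice d) {p : ℕ} (hp : p ≠ 0) : ∃ (N : ℕ) (A B : ℤ) (n m : ℕ), N ≠ 0 ∧ N ≡ 1 [MOD p] ∧
      ∑ s ∈ Finset.range N, ∑ t ∈ Finset.range N, pairingExp N A B s t *
        jacobiCoeff d a N !![0, (s : ℤ); 0, (t : ℤ)] (m, N ^ 2 * n) = N ^ 2 * a H₀ := by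
  have hd0 : d < 0 := by omega
  choose n m A B hn hm hAB hsymm using fun H : HermLattice d ↦ exists_coordinates hd0 H.2
  have := (finite_diagFiber hd0 (n H₀) (m H₀)).fintype
  obtain ⟨R, hR⟩ : ∃ R : ℕ, ∀ H : diagFiber d (n H₀) (m H₀),
      |A H - A H₀| < R ∧ |B H - B H₀| < R := by
    refine ⟨∑ H : diagFiber d (n H₀) (m H₀),
      ((A H - A H₀).natAbs + (B H - B H₀).natAbs + 1), fun H ↦ ?_⟩
    have := Finset.single_le_sum (f := fun H : diagFiber d (n H₀) (m H₀) ↦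
      ((A H - A H₀).natAbs + (B H - B H₀).natAbs + 1)) (fun _ _ ↦ Nat.zero_le _) (Finset.mem_univ H)
    rw [Int.abs_eq_natAbs, Int.abs_eq_natAbs]
    omega
  have hN : p * R + 1 ≠ 0 := by omega
  refine ⟨p * R + 1, -A H₀, -B H₀, n H₀, m H₀, hN, by simp [Nat.ModEq], ?_⟩
  have hzero : ∀ c : ℤ, |c| < R → ((p * R + 1 : ℕ) : ℤ) ∣ c → c = 0 := fun c hc hdvd ↦
    Int.eq_zero_of_abs_lt_dvd hdvd <| hc.trans_le <| by
      exact_mod_cast (Nat.le_mul_of_pos_left R (Nat.pos_of_ne_zero hp)).trans (Nat.le_succ _)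
  have hmem : H₀ ∈ diagFiber d (n H₀) (m H₀) := ⟨hn H₀, hm H₀⟩
  simp only [jacobiCoeff_diag hd hN hAB, tsum_fintype, Finset.mul_sum]
  have hterm : ∀ (H : diagFiber d (n H₀) (m H₀)) s t,
      pairingExp (p * R + 1) (-A H₀) (-B H₀) s t * (a H.1 * pairingExp (p * R + 1) (A H) (B H) s t) =
        a H.1 * pairingExp (p * R + 1) (A H - A H₀) (B H - B H₀) s t := fun H s t ↦ by
    rw [mul_left_comm, pairingExp_mul, neg_add_eq_sub, neg_add_eq_sub]
  simp only [hterm]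
  have hswap : ∀ g : diagFiber d (n H₀) (m H₀) → ℕ → ℕ → ℂ,
      ∑ s ∈ Finset.range (p * R + 1), ∑ t ∈ Finset.range (p * R + 1), ∑ H, g H s t =
        ∑ H, ∑ s ∈ Finset.range (p * R + 1), ∑ t ∈ Finset.range (p * R + 1), g H s t := fun g ↦ by
    simp only [Finset.sum_comm (s := Finset.range (p * R + 1))
      (t := (Finset.univ : Finset (diagFiber d (n H₀) (m H₀))))]
  rw [hswap]
  simp only [← Finset.mul_sum, sum_pairingExp hN]
  rw [Finset.sum_eq_single ⟨H₀, hmem⟩]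
  · simp [mul_comm]
  · intro H _ hne
    rw [if_neg, mul_zero]
    rintro ⟨hA, hB⟩
    refine hne (Subtype.ext (Subtype.ext ?_))
    have hA' := hzero _ (hR H).1 hA
    have hB' := hzero _ (hR H).2 hB
    have h01 : H.1.1 0 1 = H₀.1 0 1 := by
      rw [hAB, hAB, sub_eq_zero.mp hA', sub_eq_zero.mp hB']
    ext i j
    fin_cases i <;> fin_cases j
    · exact H.2.1.trans hmem.1.symm
    · exact h01
    · exact (hsymm H.1).trans ((congrArg star h01).trans (hsymm H₀).symm)
    · exact H.2.2.trans hmem.2.symm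
  · simp

end Nonvanishing

end HalfWeight

namespace HalfWeight

/-- The reduction of some Fourier coefficient of a Fourier–Jacobi coefficient at a torsion point
does not vanish. -/
lemma exists_map_jacobiCoeff_ne_zero {d : ℤ} (hd : d = -4 ∨ d = -3) {p : ℕ} (hp : p.Prime)
    {O : Subring ℂ} {F : Type*} [Field F] [CharP F p] (ρ : O →+* F) [IsLocalHom ρ]
    (hO : ∀ z : ℂ, ∀ n : ℕ, n ≠ 0 → z ^ n = 1 → z ∈ O) {a : Matrix (Fin 2) (Fin 2) ℂ → ℂ}
    (ha : ∀ H ∈ HermLattice d, a H ∈ O) {H₀ : Matrix (Fin 2) (Fin 2) ℂ} (hH₀ : H₀ ∈ HermLattice d)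
    (h₀ : ρ ⟨a H₀, ha H₀ hH₀⟩ ≠ 0) :
    ∃ (N : ℕ) (hN : N ≠ 0) (x : Matrix (Fin 2) (Fin 2) ℤ) (i : ℕ × ℕ),
      ρ ⟨jacobiCoeff d a N x i, jacobiCoeff_mem hd hN hO ha x i⟩ ≠ 0 := by
  obtain ⟨N, A, B, n, m, hN, hNp, hsum⟩ := sum_jacobiCoeff hd a ⟨H₀, hH₀⟩ hp.ne_zero
  by_contra! hcon
  have hO' : ∑ s ∈ Finset.range N, ∑ t ∈ Finset.range N,
      (⟨pairingExp N A B s t, hO _ N hN (pairingExp_pow hN A B s t)⟩ : O) *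
        ⟨_, jacobiCoeff_mem hd hN hO ha !![0, (s : ℤ); 0, (t : ℤ)] (m, N ^ 2 * n)⟩ =
      (N : O) ^ 2 * ⟨a H₀, ha H₀ hH₀⟩ := by
    apply Subtype.ext
    push_cast
    exact hsum
  have h1 := congrArg ρ hO'
  simp only [map_sum, map_mul, hcon N hN, mul_zero, Finset.sum_const_zero, map_pow,
    map_natCast] at h1
  have hNF : (N : F) = 1 := by
    have := (CharP.natCast_eq_natCast F p (a := N) (b := 1)).mpr hNp
    simpa using this
  rw [hNF, one_pow, one_mul] at h1
  exact h₀ h1.symm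

end HalfWeight

/-- **Well-definedness of the p-adic weight** (Theorem 1.3). Let `K = ℚ(√-1)` or
`ℚ(√-3)`, `k, k'` even, `p ≥ 5` prime, `l ≥ 1`. If `f`, `g` are symmetric
Hermitian modular forms of weights `k`, `k'` with `p`-integral Fourier
coefficients, `f ≢ 0 (mod p)` and `f ≡ g (mod p^l)` coefficientwise, then
`k ≡ k' (mod (p-1)p^(l-1))`. -/
theorem padic_weight_well_defined
    (d : ℤ) (hd : d = -4 ∨ d = -3) (p l : ℕ) (hp : Nat.Prime p) (hp5 : 5 ≤ p)
    (hl : 1 ≤ l) (k k' : ℤ) (hk : Even k) (hk' : Even k')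
    (f : HermitianModularForm d k) (g : HermitianModularForm d k')
    (hfsym : IsSymmetricHMF f) (hgsym : IsSymmetricHMF g)
    (hfint : ∀ H, IsPIntegral p (f.coeff H)) (hgint : ∀ H, IsPIntegral p (g.coeff H))
    (hf0 : ¬ ∀ H ∈ HermLattice d, ModCongr p 1 (f.coeff H) 0)
    (hfg : ∀ H ∈ HermLattice d, ModCongr p l (f.coeff H) (g.coeff H)) :
    ((p : ℤ) - 1) * (p : ℤ) ^ (l - 1) ∣ k - k' := by
  obtain ⟨O, F, _, _, _, ρ, _, hO⟩ := HalfWeight.exists_place hp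
  have : Fact p.Prime := ⟨hp⟩
  have hf : ∀ H ∈ HermLattice d, f.coeff H ∈ O := fun H _ ↦
    HalfWeight.mem_of_isPIntegral ρ (hfint H)
  have hg : ∀ H ∈ HermLattice d, g.coeff H ∈ O := fun H _ ↦
    HalfWeight.mem_of_isPIntegral ρ (hgint H)
  have hq : ∀ H ∈ HermLattice d, -((f.coeff H - g.coeff H) / (p : ℂ) ^ l) ∈ O := fun H hH ↦
    O.neg_mem (HalfWeight.mem_of_isPIntegral ρ (hfg H hH))
  push Not at hf0
  obtain ⟨H₀, hH₀, hne⟩ := hf0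
  obtain ⟨N, hN, x, ⟨m, j⟩, hx⟩ := HalfWeight.exists_map_jacobiCoeff_ne_zero hd hp ρ hO hf hH₀
    (HalfWeight.map_ne_zero_of_not_modCongr hp ρ (hfint H₀) hne)
  have : NeZero (2 * N ^ 2) := ⟨by positivity⟩
  have hp0 : (p : ℂ) ^ l ≠ 0 := pow_ne_zero _ (by exact_mod_cast hp.ne_zero)
  refine HalfWeight.dvd_of_isFamily hp5 ρ hk hk' (pow_ne_zero 2 hN)
    (HalfWeight.isFamily_jacobiFun hd hN f m) (HalfWeight.isFamily_jacobiFun hd hN g m)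
    (c := fun v ↦ PowerSeries.mk fun j ↦ ⟨_, HalfWeight.jacobiCoeff_mem hd hN hO hf
      (HalfWeight.liftMat v) (m, j)⟩)
    (d := fun v ↦ PowerSeries.mk fun j ↦ ⟨_, HalfWeight.jacobiCoeff_mem hd hN hO hg
      (HalfWeight.liftMat v) (m, j)⟩)
    (fun v ↦ ?_) (fun v ↦ ?_) hl (fun v ↦ ?_)
    (v₀ := x.map Int.cast) fun h ↦ hx ?_
  · convert! HalfWeight.hasQ_jacobiFun hd hN f (HalfWeight.liftMat v) m using 1
  · convert! HalfWeight.hasQ_jacobiFun hd hN g (HalfWeight.liftMat v) m using 1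
  · refine ⟨PowerSeries.mk fun j ↦ ⟨_, HalfWeight.jacobiCoeff_mem hd hN hO hq
      (HalfWeight.liftMat v) (m, j)⟩, ?_⟩
    ext j
    rw [← map_natCast (PowerSeries.C (R := O)), ← map_pow, PowerSeries.coeff_C_mul]
    simp only [map_sub, PowerSeries.coeff_mk]
    push_cast
    refine HalfWeight.jacobiCoeff_sub_smul hd hN (fun H _ ↦ ?_) _ _
    field_simp
    ring
  · have h1 := congrArg (PowerSeries.coeff j) h
    simp only [PowerSeries.coeff_map, PowerSeries.coeff_mk, map_zero] at h1
    convert! h1 using 3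
    exact HalfWeight.jacobiCoeff_congr hd hN f (HalfWeight.map_liftMat _).symm m j


end
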